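/- Let f ∈ K(z) be a rational function of degree d > 1 having no potentially good reductions, let g ∈ K(z) be a rational function of degree > 0, and let D be a non-empty open subset of P^1(K). Then lim_{n→∞} (sup_{w∈D} log [f^n(w), g(w)]_{P^1}) / (d^n + deg g) = 0, where f^n denotes the n-th iterate of f. -/

import Mathlib

open scoped Classical

open Polynomial Filter MeasureTheory Topology

variable (K : Type*) [NontriviallyNormedField K] [IsAlgClosed K] [CompleteSpace K]
  [IsUltrametricDist K]

/-- The degree of a rational function: max of degrees of numerator and denominator. -/
noncomputable def rdeg (h : RatFunc K) : ℕ := max h.num.natDegree h.denom.natDegree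

/-- Canonical homogeneous coordinates of a point of `P^1(K) = K ∪ {∞}`. -/
noncomputable def homCoord : OnePoint K → K × K :=
  OnePoint.rec (1, 0) (fun a => (a, 1))

/-- The (normalized) chordal metric on `P^1(K)`:
`[z,w] = |z0*w1 - z1*w0| / (max(|z0|,|z1|) * max(|w0|,|w1|))`. -/
noncomputable def chordal (x y : OnePoint K) : ℝ :=
  ‖(homCoord K x).1 * (homCoord K y).2 - (homCoord K x).2 * (homCoord K y).1‖ /
    (max ‖(homCoord K x).1‖ ‖(homCoord K x).2‖ * max ‖(homCoord K y).1‖ ‖(homCoord K y).2‖)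

/-- The action of a rational function on the projective line `P^1(K) = K ∪ {∞}`. -/
noncomputable def evalP1 (h : RatFunc K) : OnePoint K → OnePoint K :=
  OnePoint.rec
    (if h.denom.natDegree < h.num.natDegree then OnePoint.infty
      else ((h.num.coeff h.denom.natDegree / h.denom.leadingCoeff : K) : OnePoint K))
    (fun a => if h.denom.eval a = 0 then OnePoint.infty
      else ((h.num.eval a / h.denom.eval a : K) : OnePoint K))

/-- Composition of rational functions. -/
noncomputable def rcomp (f g : RatFunc K) : RatFunc K :=
  RatFunc.eval (algebraMap K (RatFunc K)) g f

/-- Iterates of a rational function, as rational functions. -/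
noncomputable def riter (f : RatFunc K) : ℕ → RatFunc K
  | 0 => RatFunc.X
  | n + 1 => rcomp K f (riter f n)

/-- The ring of `K`-integers. -/
noncomputable def intRing : Subring K where
  carrier := {x : K | ‖x‖ ≤ 1}
  mul_mem' := by
    intro a b ha hb
    simp only [Set.mem_setOf_eq, norm_mul] at *
    exact mul_le_one₀ ha (norm_nonneg _) hb
  one_mem' := by simp
  add_mem' := by
    intro a b ha hb
    exact le_trans (IsUltrametricDist.norm_add_le_max a b) (max_le ha hb)
  zero_mem' := by simp
  neg_mem' := by
    intro a ha
    simpa using ha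

/-- The maximal ideal `m_K = {x : ‖x‖ < 1}` of the ring of `K`-integers. -/
noncomputable def maxIdeal : Ideal (intRing K) where
  carrier := {x | ‖(x : K)‖ < 1}
  add_mem' := by
    intro a b ha hb
    exact lt_of_le_of_lt (IsUltrametricDist.norm_add_le_max (a : K) (b : K)) (max_lt ha hb)
  zero_mem' := by simp
  smul_mem' := by
    intro c x hx
    simp only [Set.mem_setOf_eq, smul_eq_mul, Subring.coe_mul, norm_mul] at *
    calc ‖(c : K)‖ * ‖(x : K)‖ ≤ 1 * ‖(x : K)‖ :=
          mul_le_mul_of_nonneg_right c.2 (norm_nonneg _)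
      _ = ‖(x : K)‖ := one_mul _
      _ < 1 := hx

/-- The residue field `k = O_K / m_K` (as a quotient ring). -/
noncomputable abbrev residueRing := intRing K ⧸ maxIdeal K

/-- A polynomial with `K`-integral coefficients, viewed as a polynomial over `K`. -/
noncomputable def toK : Polynomial (intRing K) → Polynomial K :=
  Polynomial.map (intRing K).subtype

/-- Reduction of a polynomial with `K`-integral coefficients modulo the maximal ideal. -/
noncomputable def redPoly : Polynomial (intRing K) → Polynomial (residueRing K) :=
  Polynomial.map (Ideal.Quotient.mk (maxIdeal K))

/-- `(P, Q)` is a normalized (non-degenerate homogeneous) lift of the rational function `h`: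
all coefficients are `K`-integers, at least one coefficient has absolute value `1`,
`h = P/Q`, `P` and `Q` are coprime, and `max (deg P) (deg Q) = deg h`. -/
def IsNormalizedLift (h : RatFunc K) (P Q : Polynomial (intRing K)) : Prop :=
  toK K Q ≠ 0 ∧ IsCoprime (toK K P) (toK K Q) ∧
    max (toK K P).natDegree (toK K Q).natDegree = rdeg K h ∧
    h * algebraMap (Polynomial K) (RatFunc K) (toK K Q) =
      algebraMap (Polynomial K) (RatFunc K) (toK K P) ∧
    ∃ i : ℕ, ‖(P.coeff i : K)‖ = 1 ∨ ‖(Q.coeff i : K)‖ = 1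

/-- The reduction modulo `m_K` of the (normalized lift `(P,Q)` of a) rational function of
degree `d` has degree `< d`: after reducing the pair of coefficients, either the reduced
pair has a common factor, or both reduced degrees drop (a common factor at infinity). -/
def ReductionDegreeDrops (P Q : Polynomial (intRing K)) (d : ℕ) : Prop :=
  ¬ IsCoprime (redPoly K P) (redPoly K Q) ∨
    ((redPoly K P).natDegree < d ∧ (redPoly K Q).natDegree < d)

/-- `f` has no potentially good reductions: for every Möbius conjugation
`φ ∘ f ∘ φ⁻¹` of `f`, the degree of the reduction modulo `m_K` drops below `deg f`. -/
def NoPotentiallyGoodReductions (f : RatFunc K) : Prop :=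
  ∀ φ ψ : RatFunc K, rdeg K φ = 1 → rdeg K ψ = 1 → rcomp K φ ψ = RatFunc.X →
    ∀ P Q : Polynomial (intRing K),
      IsNormalizedLift K (rcomp K (rcomp K φ f) ψ) P Q →
        ReductionDegreeDrops K P Q (rdeg K f)

/-- The exceptional set `E(f) = {a : ⋃_{n ≥ 0} f⁻ⁿ(a) is finite}`. -/
def exceptionalSet (f : RatFunc K) : Set (OnePoint K) :=
  {a | Set.Finite {b : OnePoint K | ∃ n : ℕ, (evalP1 K f)^[n] b = a}}

section HelpersA
set_option linter.unusedSectionVars false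
variable {K : Type*} [NontriviallyNormedField K] [IsAlgClosed K] [IsUltrametricDist K]

/-- Disc norm of a polynomial on the disc with centre `c` and radius `s`. -/
noncomputable def dn (c : K) (s : ℝ) (p : K[X]) : ℝ :=
  ‖p.leadingCoeff‖ * (p.roots.map (fun a => max s ‖c - a‖)).prod

lemma dn_zero (c : K) (s : ℝ) : dn c s 0 = 0 := by simp [dn]

lemma dn_C (c : K) (s : ℝ) (a : K) : dn c s (C a) = ‖a‖ := by simp [dn]

lemma dn_one (c : K) (s : ℝ) : dn c s 1 = 1 := by simp [dn]

lemma dn_X_sub_C (c : K) (s : ℝ) (a : K) : dn c s (X - C a) = max s ‖c - a‖ := by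
  simp [dn]

lemma dn_mul (c : K) (s : ℝ) (p q : K[X]) : dn c s (p * q) = dn c s p * dn c s q := by
  by_cases h : p * q = 0
  · rw [h, dn_zero]
    rcases mul_eq_zero.1 h with h | h <;> simp [h, dn_zero]
  · simp only [dn, roots_mul h, leadingCoeff_mul, norm_mul, Multiset.map_add, Multiset.prod_add]
    ring

lemma dn_pow (c : K) (s : ℝ) (p : K[X]) (n : ℕ) : dn c s (p ^ n) = dn c s p ^ n := by
  induction n with
  | zero => simp [dn_one]
  | succ n ih => rw [pow_succ, dn_mul, ih, pow_succ]

lemma dn_multiset_prod (c : K) (s : ℝ) (m : Multiset K[X]) :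
    dn c s m.prod = (m.map (dn c s)).prod := by
  induction m using Multiset.induction_on with
  | empty => simp [dn_one]
  | cons a m ih => simp [dn_mul, ih]

lemma poly_split (p : K[X]) : p = C p.leadingCoeff * (p.roots.map (fun a => X - C a)).prod :=
  ((IsAlgClosed.splits p).eq_prod_roots)

lemma dn_eq_gauss (c : K) {s : ℝ} (hs : 0 < s) (p : K[X]) :
    dn c s p = (p.comp (X + C c)).gaussNorm (NormedField.toAbsoluteValue K) s := by
  have hna : IsNonarchimedean (NormedField.toAbsoluteValue K) :=
    IsUltrametricDist.isNonarchimedean_norm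
  have key : ∀ m : Multiset K,
      (((m.map (fun a => X - C a)).prod).comp (X + C c)).gaussNorm
        (NormedField.toAbsoluteValue K) s = (m.map (fun a => max s ‖c - a‖)).prod := by
    intro m
    induction m using Multiset.induction_on with
    | empty =>
      simp only [Multiset.map_zero, Multiset.prod_zero, one_comp]
      rw [← C_1, gaussNorm_C]; simp
    | cons a m ih =>
      simp only [Multiset.map_cons, Multiset.prod_cons, mul_comp]
      rw [gaussNorm_mul hna hs, ih]
      congr 1
      have e : (X - C a).comp (X + C c) = X + C (c - a) := by
        simp [C_sub]; ring
      rw [e]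
      apply le_antisymm
      · refine (isNonarchimedean_gaussNorm _ hna hs.le X (C (c-a))).trans ?_
        rw [gaussNorm_C, ← monomial_one_one_eq_X, gaussNorm_monomial]
        simp [NormedField.toAbsoluteValue]
      · apply max_le
        · have := le_gaussNorm (NormedField.toAbsoluteValue K) (X + C (c-a)) hs.le 1
          simpa [coeff_X, coeff_C, NormedField.toAbsoluteValue] using this
        · have := le_gaussNorm (NormedField.toAbsoluteValue K) (X + C (c-a)) hs.le 0
          simpa [coeff_X, coeff_C, NormedField.toAbsoluteValue] using this
  conv_rhs => rw [poly_split p]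
  rw [mul_comp, gaussNorm_mul hna hs, key, C_comp, gaussNorm_C]
  rfl

lemma dn_add_le (c : K) {s : ℝ} (hs : 0 < s) (p q : K[X]) :
    dn c s (p + q) ≤ max (dn c s p) (dn c s q) := by
  rw [dn_eq_gauss c hs, dn_eq_gauss c hs, dn_eq_gauss c hs, add_comp]
  exact isNonarchimedean_gaussNorm _ IsUltrametricDist.isNonarchimedean_norm hs.le _ _

lemma dn_coeff_le (c : K) {s : ℝ} (hs : 0 < s) (p : K[X]) (i : ℕ) :
    ‖(p.comp (X + C c)).coeff i‖ * s ^ i ≤ dn c s p := by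
  rw [dn_eq_gauss c hs]
  exact le_gaussNorm (NormedField.toAbsoluteValue K) _ hs.le i

lemma dn_C_mul (c : K) (s : ℝ) (a : K) (p : K[X]) : dn c s (C a * p) = ‖a‖ * dn c s p := by
  rw [dn_mul, dn_C]

lemma dn_neg (c : K) (s : ℝ) (p : K[X]) : dn c s (-p) = dn c s p := by
  have := dn_C_mul c s (-1) p
  simpa using this

lemma dn_sub_le (c : K) {s : ℝ} (hs : 0 < s) (p q : K[X]) :
    dn c s (p - q) ≤ max (dn c s p) (dn c s q) := by
  rw [sub_eq_add_neg, ← dn_neg c s q]; exact dn_add_le c hs _ _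

lemma dn_sub_comm (c : K) (s : ℝ) (p q : K[X]) : dn c s (p - q) = dn c s (q - p) := by
  rw [← dn_neg, neg_sub]

lemma dn_add_eq (c : K) {s : ℝ} (hs : 0 < s) {p q : K[X]} (h : dn c s q < dn c s p) :
    dn c s (p + q) = dn c s p := by
  apply le_antisymm
  · exact (dn_add_le c hs p q).trans (max_le le_rfl h.le)
  · by_contra hlt
    push Not at hlt
    have := dn_sub_le c hs (p + q) q
    rw [add_sub_cancel_right] at this
    exact absurd this (not_le.2 (max_lt hlt h))

lemma dn_add_eq_max (c : K) {s : ℝ} (hs : 0 < s) {p q : K[X]} (h : dn c s p ≠ dn c s q) :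
    dn c s (p + q) = max (dn c s p) (dn c s q) := by
  rcases lt_or_gt_of_ne h with h | h
  · rw [add_comm, dn_add_eq c hs h, max_eq_right h.le]
  · rw [dn_add_eq c hs h, max_eq_left h.le]

lemma dn_nonneg (c : K) (s : ℝ) (p : K[X]) : 0 ≤ dn c s p := by
  unfold dn
  apply mul_nonneg (norm_nonneg _)
  apply Multiset.prod_nonneg
  intro x hx
  obtain ⟨a, -, rfl⟩ := Multiset.mem_map.1 hx
  exact le_max_of_le_right (norm_nonneg _)

lemma dn_pos (c : K) {s : ℝ} (hs : 0 < s) {p : K[X]} (hp : p ≠ 0) : 0 < dn c s p := by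
  unfold dn
  apply mul_pos (by simpa using hp)
  apply Multiset.prod_pos
  intro x hx
  obtain ⟨a, -, rfl⟩ := Multiset.mem_map.1 hx
  exact lt_max_of_lt_left hs

lemma ne_zero_of_dn_pos {c : K} {s : ℝ} {p : K[X]} (h : 0 < dn c s p) : p ≠ 0 := by
  rintro rfl; simp [dn_zero] at h

lemma max_recenter {c c' : K} {s : ℝ} (h : ‖c - c'‖ ≤ s) (a : K) :
    max s ‖c - a‖ = max s ‖c' - a‖ := by
  apply le_antisymm
  · apply max_le (le_max_left _ _)
    have : c - a = (c - c') + (c' - a) := by ring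
    rw [this]
    exact (IsUltrametricDist.norm_add_le_max _ _).trans (max_le_max h le_rfl)
  · apply max_le (le_max_left _ _)
    have : c' - a = (c' - c) + (c - a) := by ring
    rw [this]
    refine (IsUltrametricDist.norm_add_le_max _ _).trans (max_le_max ?_ le_rfl)
    rwa [norm_sub_rev]

lemma dn_recenter {c c' : K} {s : ℝ} (h : ‖c - c'‖ ≤ s) (p : K[X]) : dn c s p = dn c' s p := by
  unfold dn
  simp_rw [max_recenter h]

lemma dn_zero_radius (c : K) (p : K[X]) : dn c 0 p = ‖p.eval c‖ := by
  conv_rhs => rw [poly_split p]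
  unfold dn
  rw [eval_mul, eval_C, norm_mul, eval_multiset_prod, Multiset.map_map]
  congr 1
  induction p.roots using Multiset.induction_on with
  | empty => simp
  | cons a m ih =>
    simp only [Multiset.map_cons, Multiset.prod_cons, norm_mul, ih]
    simp

lemma multiset_prod_le {ι : Type*} (m : Multiset ι) (f g : ι → ℝ)
    (h : ∀ a ∈ m, 0 ≤ f a ∧ f a ≤ g a) : (m.map f).prod ≤ (m.map g).prod := by
  induction m using Multiset.induction_on with
  | empty => simp
  | cons a m ih =>
    simp only [Multiset.map_cons, Multiset.prod_cons]
    have h1 := h a (Multiset.mem_cons_self _ _)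
    have h2 := ih (fun b hb => h b (Multiset.mem_cons_of_mem hb))
    refine mul_le_mul h1.2 h2 ?_ (h1.1.trans h1.2)
    apply Multiset.prod_nonneg
    intro x hx
    obtain ⟨b, hb, rfl⟩ := Multiset.mem_map.1 hx
    exact (h b (Multiset.mem_cons_of_mem hb)).1

lemma dn_mono (c : K) {s s' : ℝ} (h : s ≤ s') (p : K[X]) : dn c s p ≤ dn c s' p := by
  unfold dn
  apply mul_le_mul_of_nonneg_left _ (norm_nonneg _)
  apply multiset_prod_le
  intro a _
  exact ⟨le_max_of_le_right (norm_nonneg _), max_le_max h le_rfl⟩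

lemma norm_eval_le {c x : K} {s : ℝ} (h : ‖x - c‖ ≤ s) (p : K[X]) : ‖p.eval x‖ ≤ dn c s p := by
  rw [← dn_recenter h, ← dn_zero_radius]
  exact dn_mono _ ((norm_nonneg _).trans h) _

lemma exists_root_of_lt {c x : K} {s : ℝ} (h : ‖x - c‖ ≤ s) {p : K[X]}
    (hlt : ‖p.eval x‖ < dn c s p) : ∃ a, p.IsRoot a ∧ p ≠ 0 ∧ ‖a - x‖ < s := by
  by_contra hcon
  push Not at hcon
  rw [← dn_recenter h, ← dn_zero_radius] at hlt
  apply hlt.ne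
  unfold dn
  congr 2
  apply Multiset.map_congr rfl
  intro a ha
  have := hcon a (mem_roots'.1 ha).2 (mem_roots'.1 ha).1
  rw [norm_sub_rev] at this
  rw [max_eq_right this, max_eq_right (norm_nonneg _)]

lemma dn_continuous (c : K) (p : K[X]) : Continuous (fun s => dn c s p) := by
  unfold dn
  apply continuous_const.mul
  induction p.roots using Multiset.induction_on with
  | empty => simpa using continuous_const
  | cons a m ih =>
    simp only [Multiset.map_cons, Multiset.prod_cons]
    exact (continuous_id.max continuous_const).mul ih

/-- number of roots satisfying a predicate -/
noncomputable def rcount (P : K → Prop) (p : K[X]) : ℕ := (p.roots.filter P).card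

lemma dn_scale (c : K) {s σ : ℝ} (hs : σ ≤ s) (p : K[X])
    (h : ∀ a ∈ p.roots, ‖c - a‖ < s → ‖c - a‖ ≤ σ) :
    dn c σ p * s ^ rcount (fun a => ‖c - a‖ < s) p =
      dn c s p * σ ^ rcount (fun a => ‖c - a‖ < s) p := by
  unfold dn rcount
  rw [mul_assoc, mul_assoc]
  congr 1
  revert h
  induction p.roots using Multiset.induction_on with
  | empty => simp
  | cons a m ih =>
    intro h
    have ih := ih (fun b hb => h b (Multiset.mem_cons_of_mem hb))
    have h1 := h a (Multiset.mem_cons_self _ _)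
    simp only [Multiset.map_cons, Multiset.prod_cons]
    by_cases ha : ‖c - a‖ < s
    · rw [Multiset.filter_cons_of_pos (p := fun b => ‖c - b‖ < s) m ha, Multiset.card_cons, pow_succ, pow_succ,
        max_eq_left (h1 ha), max_eq_left ha.le]
      linear_combination (σ * s) * ih
    · rw [Multiset.filter_cons_of_neg (p := fun b => ‖c - b‖ < s) m ha, max_eq_right (hs.trans (not_lt.1 ha)),
        max_eq_right (not_lt.1 ha)]
      linear_combination (‖c - a‖) * ih

/-- a radius slightly below `s` capturing all roots in the open ball -/
lemma exists_radius_below (c : K) {s : ℝ} (hs : 0 < s) (p : K[X]) :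
    ∃ σ, 0 < σ ∧ σ < s ∧ ∀ a ∈ p.roots, ‖c - a‖ < s → ‖c - a‖ ≤ σ := by
  induction p.roots using Multiset.induction_on with
  | empty => exact ⟨s / 2, by positivity, by linarith, by simp⟩
  | cons a m ih =>
    obtain ⟨σ, h0, h1, h2⟩ := ih
    by_cases ha : ‖c - a‖ < s
    · refine ⟨max σ ‖c - a‖, lt_max_of_lt_left h0, max_lt h1 ha, ?_⟩
      intro b hb hlt
      rcases Multiset.mem_cons.1 hb with rfl | hb
      · exact le_max_right _ _
      · exact (h2 b hb hlt).trans (le_max_left _ _)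
    · refine ⟨σ, h0, h1, ?_⟩
      intro b hb hlt
      rcases Multiset.mem_cons.1 hb with rfl | hb
      · exact absurd hlt ha
      · exact h2 b hb hlt

/-- generic point on a sphere -/
lemma exists_generic (c : K) {s : ℝ} {w : K} (hw : w ≠ 0) (hs : ‖w‖ = s) (p : K[X]) :
    ∃ x, ‖x - c‖ = s ∧ ‖p.eval x‖ = dn c s p := by
  have hs0 : 0 < s := hs ▸ norm_pos_iff.2 hw
  set T : Finset K := insert c (p.roots.toFinset.filter (fun a => ‖c - a‖ ≤ s)) with hT
  have hTc : ∀ a ∈ T, ‖c - a‖ ≤ s := by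
    intro a ha
    rcases Finset.mem_insert.1 ha with rfl | ha
    · simpa using hs0.le
    · exact (Finset.mem_filter.1 ha).2
  set F : K[X] := (∏ a ∈ T, (X - C a)) - C (w ^ T.card) with hF
  have hdeg : F.degree ≠ 0 := by
    have h1 : (∏ a ∈ T, (X - C a)).degree = (T.card : WithBot ℕ) := by
      rw [degree_prod]; simp
    have hc : 0 < T.card := Finset.card_pos.2 ⟨c, Finset.mem_insert_self _ _⟩
    rw [hF, degree_sub_C (by rw [h1]; exact_mod_cast hc), h1]
    exact_mod_cast hc.ne'
  obtain ⟨x, hx⟩ := IsAlgClosed.exists_root F hdeg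
  have hx' : ∏ a ∈ T, (x - a) = w ^ T.card := by
    have : F.eval x = 0 := hx
    rw [hF, eval_sub, eval_prod] at this
    simpa [sub_eq_zero] using this
  have hprod : ∏ a ∈ T, ‖x - a‖ = s ^ T.card := by
    rw [← norm_prod, hx', norm_pow, hs]
  have hcT : c ∈ T := Finset.mem_insert_self _ _
  -- all distances from x to T are equal to s
  have hle : ‖x - c‖ ≤ s := by
    by_contra hgt
    push Not at hgt
    have : ∀ a ∈ T, ‖x - a‖ = ‖x - c‖ := by
      intro a ha
      have e : x - a = (x - c) + (c - a) := by ring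
      rw [e]
      have := IsUltrametricDist.norm_add_eq_max_of_norm_ne_norm
        (x := x - c) (y := c - a) ((hTc a ha).trans_lt hgt).ne'
      rw [this, max_eq_left ((hTc a ha).trans hgt.le)]
    rw [Finset.prod_congr rfl this, Finset.prod_const] at hprod
    exact absurd hprod (pow_lt_pow_left₀ hgt hs0.le (Finset.card_pos.2 ⟨c, hcT⟩).ne').ne'
  have hle' : ∀ a ∈ T, ‖x - a‖ ≤ s := by
    intro a ha
    have e : x - a = (x - c) + (c - a) := by ring
    rw [e]
    exact (IsUltrametricDist.norm_add_le_max _ _).trans (max_le hle (hTc a ha))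
  have heq : ∀ a ∈ T, ‖x - a‖ = s := by
    by_contra hcon
    push Not at hcon
    obtain ⟨a, ha, hne⟩ := hcon
    have hpos : ∀ b ∈ T, 0 < ‖x - b‖ := by
      intro b hb
      rcases (norm_nonneg (x - b)).eq_or_lt with h | h
      · rw [Finset.prod_eq_zero hb h.symm] at hprod
        exact absurd hprod (pow_pos hs0 _).ne
      · exact h
    have := Finset.prod_lt_prod hpos hle' ⟨a, ha, lt_of_le_of_ne (hle' a ha) hne⟩
    rw [hprod, Finset.prod_const] at this
    exact lt_irrefl _ this
  refine ⟨x, heq c hcT, ?_⟩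
  rw [← dn_zero_radius, ← dn_recenter (heq c hcT).le]
  unfold dn
  congr 2
  apply Multiset.map_congr rfl
  intro a ha
  rw [max_eq_right (norm_nonneg _), eq_comm, max_eq_right_iff]
  by_cases h : ‖c - a‖ ≤ s
  · rw [heq a]
    exact Finset.mem_insert_of_mem (Finset.mem_filter.2 ⟨Multiset.mem_toFinset.2 ha, h⟩)
  · push Not at h
    have e : x - a = (x - c) + (c - a) := by ring
    rw [e]
    have := IsUltrametricDist.norm_add_eq_max_of_norm_ne_norm
        (x := x - c) (y := c - a) (((heq c hcT).le).trans_lt h).ne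
    rw [this]
    exact h.le.trans (le_max_right _ _)

/-- density of the value group -/
lemma exists_norm_between {s t : ℝ} (hs : 0 < s) (h : s < t) : ∃ w : K, s < ‖w‖ ∧ ‖w‖ < t := by
  obtain ⟨x, hx⟩ := NormedField.exists_one_lt_norm K
  have hr : 1 < t / s := (one_lt_div hs).2 h
  -- n large with ‖x‖^(1/n) < t/s
  obtain ⟨n, hn⟩ := pow_unbounded_of_one_lt ‖x‖ hr
  have hn0 : n ≠ 0 := by
    rintro rfl
    simp at hn; linarith
  obtain ⟨y, hy⟩ := IsAlgClosed.exists_pow_nat_eq x (Nat.pos_of_ne_zero hn0)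
  have hy1 : 1 < ‖y‖ := by
    by_contra hle
    push Not at hle
    have := pow_le_one₀ (norm_nonneg y) hle (n := n)
    rw [← norm_pow, hy] at this
    linarith
  have hy2 : ‖y‖ < t / s := by
    by_contra hle
    push Not at hle
    have := pow_le_pow_left₀ (by positivity) hle n
    rw [← norm_pow, hy] at this
    linarith
  have hy3 : ‖y‖ * s < t := by rwa [lt_div_iff₀ hs] at hy2
  obtain ⟨k, hk1, hk2⟩ := exists_mem_Ico_zpow hs hy1
  refine ⟨y ^ (k + 1), ?_, ?_⟩
  · rw [norm_zpow]; exact hk2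
  · rw [norm_zpow, zpow_add_one₀ (by linarith)]
    calc ‖y‖ ^ k * ‖y‖ ≤ s * ‖y‖ := by gcongr
      _ < t := by linarith

end HelpersA

section HelpersB
set_option linter.unusedSectionVars false
variable {K : Type*} [NontriviallyNormedField K] [IsAlgClosed K] [IsUltrametricDist K]

/-- homogeneous evaluation -/
noncomputable def hev {A : Type*} [CommRing A] [Algebra K A] (d : ℕ) (p : K[X]) (a b : A) : A :=
  MvPolynomial.aeval ![a, b] (p.homogenize d)

section
variable {A B : Type*} [CommRing A] [Algebra K A] [CommRing B] [Algebra K B]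

lemma hev_add (d : ℕ) (p q : K[X]) (a b : A) : hev d (p + q) a b = hev d p a b + hev d q a b := by
  simp [hev]

lemma hev_sub (d : ℕ) (p q : K[X]) (a b : A) : hev d (p - q) a b = hev d p a b - hev d q a b := by
  simp [hev, sub_eq_add_neg]

lemma hev_C_mul (d : ℕ) (c : K) (p : K[X]) (a b : A) :
    hev d (C c * p) a b = algebraMap K A c * hev d p a b := by
  simp [hev]

lemma hev_mul {d e : ℕ} {p q : K[X]} (hp : p.natDegree ≤ d) (hq : q.natDegree ≤ e) (a b : A) :
    hev (d + e) (p * q) a b = hev d p a b * hev e q a b := by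
  simp [hev, homogenize_mul p q hp hq]

lemma hev_one (d : ℕ) (a b : A) : hev d (1 : K[X]) a b = b ^ d := by
  simp [hev]

lemma hev_X_pow {d i : ℕ} (h : i ≤ d) (a b : A) :
    hev d (X ^ i : K[X]) a b = a ^ i * b ^ (d - i) := by
  simp [hev, homogenize_X_pow h]

lemma hev_X (a b : A) : hev 1 (X : K[X]) a b = a := by
  have := hev_X_pow (K := K) (le_refl 1) a b
  simpa using this

lemma hev_X_sub_C (c : K) (a b : A) : hev 1 (X - C c : K[X]) a b = a - algebraMap K A c * b := by
  rw [hev_sub, hev_X, ← mul_one (C c), hev_C_mul, hev_one, pow_one]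

lemma hev_X_one (d : ℕ) {p : K[X]} (hp : p.natDegree ≤ d) : hev d p (X : K[X]) 1 = p := by
  exact aeval_homogenize_X_one p hp

lemma hev_eval_one (d : ℕ) {p : K[X]} (hp : p.natDegree ≤ d) (x : K) :
    hev d p x (1 : K) = p.eval x := by
  unfold hev
  rw [aeval_homogenize_of_eq_one hp] <;> simp [coe_aeval_eq_eval]

lemma hev_sum (d : ℕ) (p : K[X]) (a b : A) :
    hev d p a b = ∑ i ∈ Finset.range (d + 1), algebraMap K A (p.coeff i) * (a ^ i * b ^ (d - i)) := by
  unfold hev homogenize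
  rw [map_sum, Finset.Nat.sum_antidiagonal_eq_sum_range_succ_mk]
  apply Finset.sum_congr rfl
  intro i _
  rw [Finsupp.update_eq_add_single (by simp)]
  rw [MvPolynomial.aeval_monomial, Finsupp.prod_add_index' (by simp) (by intros; rw [pow_add])]
  simp

lemma hev_map (f : A →ₐ[K] B) (d : ℕ) (p : K[X]) (a b : A) :
    f (hev d p a b) = hev d p (f a) (f b) := by
  rw [hev_sum, hev_sum, map_sum]
  simp

lemma eval_hev (d : ℕ) (p : K[X]) (a b : K[X]) (x : K) :
    (hev d p a b).eval x = hev d p (a.eval x) (b.eval x) := by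
  have := hev_map (aeval x : K[X] →ₐ[K] K) d p a b
  simpa [coe_aeval_eq_eval] using this

lemma hev_smul (d : ℕ) (p : K[X]) (l a b : A) :
    hev d p (l * a) (l * b) = l ^ d * hev d p a b := by
  rw [hev_sum, hev_sum, Finset.mul_sum]
  apply Finset.sum_congr rfl
  intro i hi
  have : l ^ d = l ^ i * l ^ (d - i) := by
    rw [← pow_add]; congr 1; have := Finset.mem_range.1 hi; omega
  rw [this]; ring

lemma hev_natDegree {d D : ℕ} (p : K[X]) {u v : K[X]} (hu : u.natDegree ≤ D)
    (hv : v.natDegree ≤ D) : (hev d p u v).natDegree ≤ D * d := by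
  rw [hev_sum]
  apply natDegree_sum_le_of_forall_le
  intro i hi
  have hi := Finset.mem_range.1 hi
  refine (natDegree_C_mul_le _ _).trans (natDegree_mul_le.trans ?_)
  have h1 := natDegree_pow_le_of_le i hu
  have h2 := natDegree_pow_le_of_le (d - i) hv
  calc _ ≤ i * D + (d - i) * D := add_le_add h1 h2
    _ = D * d := by rw [← add_mul]; rw [mul_comm]; congr 1; omega

lemma hev_pow {D : ℕ} {u : K[X]} (hu : u.natDegree ≤ D) (i : ℕ) (a b : A) :
    hev (D * i) (u ^ i) a b = hev D u a b ^ i := by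
  induction i with
  | zero => simp [hev_one]
  | succ i ih =>
    rw [pow_succ, pow_succ, ← ih, mul_add, mul_one, hev_mul _ hu]
    have := natDegree_pow_le_of_le i hu
    rwa [mul_comm]

lemma hev_comp {d D : ℕ} (p : K[X]) {u v : K[X]} (hu : u.natDegree ≤ D) (hv : v.natDegree ≤ D)
    (a b : A) :
    hev d p (hev D u a b) (hev D v a b) = hev (D * d) (hev d p u v) a b := by
  rw [hev_sum d p u v, hev_sum]
  have : ∀ s : Finset ℕ, (∀ i ∈ s, i ≤ d) → hev (D * d) (∑ i ∈ s, algebraMap K K[X] (p.coeff i) *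
      (u ^ i * v ^ (d - i))) a b = ∑ i ∈ s, algebraMap K A (p.coeff i) *
      (hev D u a b ^ i * hev D v a b ^ (d - i)) := by
    intro s
    induction s using Finset.induction_on with
    | empty => intro _; simp [hev]
    | insert j s hj ih =>
      intro hs
      rw [Finset.sum_insert hj, Finset.sum_insert hj, hev_add,
        ih (fun i hi => hs i (Finset.mem_insert_of_mem hi))]
      congr 1
      have hjd := hs j (Finset.mem_insert_self _ _)
      have e : algebraMap K K[X] (p.coeff j) = C (p.coeff j) := rfl
      rw [e, hev_C_mul]
      congr 1
      have e2 : D * d = D * j + D * (d - j) := by rw [← mul_add]; congr 1; omega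
      rw [e2, hev_mul, hev_pow hu, hev_pow hv]
      · have := natDegree_pow_le_of_le j hu
        rwa [mul_comm]
      · have := natDegree_pow_le_of_le (d - j) hv
        rwa [mul_comm]
  exact (this _ (fun i hi => by have := Finset.mem_range.1 hi; omega)).symm

lemma hev_multiset (m : Multiset K) (a b : A) :
    hev m.card (m.map (fun c => X - C c)).prod a b =
      (m.map (fun c => a - algebraMap K A c * b)).prod := by
  induction m using Multiset.induction_on with
  | empty => simp [hev_one]
  | cons c m ih =>
    rw [Multiset.map_cons, Multiset.prod_cons, Multiset.map_cons, Multiset.prod_cons,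
      Multiset.card_cons, add_comm, hev_mul, ih, hev_X_sub_C]
    · simp
    · rw [natDegree_multiset_prod_X_sub_C_eq_card]

/-- factorization of a homogeneous form -/
lemma hev_factor {D : ℕ} {φ : K[X]} (h : φ.natDegree ≤ D) (a b : A) :
    hev D φ a b = algebraMap K A φ.leadingCoeff * (b ^ (D - φ.natDegree) *
      (φ.roots.map (fun c => a - algebraMap K A c * b)).prod) := by
  conv_lhs => rw [poly_split φ]
  have hc : φ.roots.card = φ.natDegree := ((IsAlgClosed.splits φ).natDegree_eq_card_roots).symm
  rw [hev_C_mul]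
  congr 1
  have e : D = (D - φ.natDegree) + φ.roots.card := by omega
  conv_lhs => rw [e, ← one_mul (φ.roots.map (fun c => X - C c)).prod]
  rw [hev_mul, hev_one, hev_multiset]
  · simp
  · rw [natDegree_multiset_prod_X_sub_C_eq_card]

end

/-- one step of the homogeneous dynamics -/
noncomputable def hstep {A : Type*} [CommRing A] [Algebra K A] (d : ℕ) (p q : K[X]) (z : A × A) :
    A × A := (hev d p z.1 z.2, hev d q z.1 z.2)

/-- iterated pair -/
noncomputable def hit (d : ℕ) (p q : K[X]) (n : ℕ) : K[X] × K[X] := (hstep d p q)^[n] (X, 1)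

section
variable {A : Type*} [CommRing A] [Algebra K A]
variable {d : ℕ} {p q : K[X]}

lemma hstep_iter_natDegree {D : ℕ} {z : K[X] × K[X]} (h1 : z.1.natDegree ≤ D)
    (h2 : z.2.natDegree ≤ D) (n : ℕ) :
    ((hstep d p q)^[n] z).1.natDegree ≤ D * d ^ n ∧ ((hstep d p q)^[n] z).2.natDegree ≤ D * d ^ n := by
  induction n with
  | zero => simpa using ⟨h1, h2⟩
  | succ n ih =>
    rw [Function.iterate_succ_apply', pow_succ, ← mul_assoc]
    exact ⟨hev_natDegree _ ih.1 ih.2, hev_natDegree _ ih.1 ih.2⟩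

lemma hit_natDegree (n : ℕ) : (hit d p q n).1.natDegree ≤ d ^ n ∧ (hit d p q n).2.natDegree ≤ d ^ n := by
  have := hstep_iter_natDegree (d := d) (p := p) (q := q) (D := 1) (z := (X, 1)) (by simp) (by simp) n
  simpa [hit] using this

lemma hstep_iter (n : ℕ) (z : A × A) :
    (hstep d p q)^[n] z =
      (hev (d ^ n) (hit d p q n).1 z.1 z.2, hev (d ^ n) (hit d p q n).2 z.1 z.2) := by
  induction n with
  | zero =>
    simp [hit, hev_X, hev_one]
  | succ n ih =>
    rw [Function.iterate_succ_apply', ih]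
    have e : hit d p q (n + 1) = hstep d p q (hit d p q n) := by
      unfold hit; rw [Function.iterate_succ_apply']
    rw [e]
    unfold hstep
    have h := hit_natDegree (d := d) (p := p) (q := q) n
    simp only
    rw [hev_comp _ h.1 h.2, hev_comp _ h.1 h.2, pow_succ]

lemma hstep_iter_eval (n : ℕ) (z : K[X] × K[X]) (x : K) :
    (hstep d p q)^[n] (z.1.eval x, z.2.eval x) =
      (((hstep d p q)^[n] z).1.eval x, ((hstep d p q)^[n] z).2.eval x) := by
  rw [hstep_iter, hstep_iter]
  simp [eval_hev]

end

/-- The pair `(P,Q)` maps the disc `(c,s)` to the disc `(a,r)` -/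
def DMaps (P Q : K[X]) (c : K) (s : ℝ) (a : K) (r : ℝ) : Prop :=
  Q ≠ 0 ∧ ∀ a', dn c s (P - C a' * Q) = max r ‖a - a'‖ * dn c s Q

lemma DMaps.recenter_source {P Q : K[X]} {c c' : K} {s : ℝ} {a : K} {r : ℝ}
    (h : DMaps P Q c s a r) (hc : ‖c - c'‖ ≤ s) : DMaps P Q c' s a r := by
  refine ⟨h.1, fun a' => ?_⟩
  rw [← dn_recenter hc, ← dn_recenter hc]; exact h.2 a'

lemma DMaps.recenter_target {P Q : K[X]} {c : K} {s : ℝ} {a b : K} {r : ℝ}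
    (h : DMaps P Q c s a r) (hc : ‖a - b‖ ≤ r) : DMaps P Q c s b r := by
  refine ⟨h.1, fun a' => ?_⟩
  rw [h.2, max_recenter hc]

/-- functoriality -/
lemma DMaps.dn_hev {P Q : K[X]} {c : K} {s : ℝ} {a : K} {r : ℝ}
    (h : DMaps P Q c s a r) {D : ℕ} {φ : K[X]} (hφ : φ.natDegree ≤ D) :
    dn c s (hev D φ P Q) = dn a r φ * dn c s Q ^ D := by
  rw [hev_factor hφ]
  have e : ∀ c : K, algebraMap K K[X] c = C c := fun _ => rfl
  simp only [e]
  rw [dn_C_mul, dn_mul, dn_pow, dn_multiset_prod, Multiset.map_map]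
  have hc : φ.roots.card = φ.natDegree := ((IsAlgClosed.splits φ).natDegree_eq_card_roots).symm
  have : ∀ m : Multiset K, (m.map (dn c s ∘ fun b => P - C b * Q)).prod =
      (m.map (fun b => max r ‖a - b‖)).prod * dn c s Q ^ m.card := by
    intro m
    induction m using Multiset.induction_on with
    | empty => simp
    | cons b m ih =>
      rw [Multiset.map_cons, Multiset.prod_cons, ih, Function.comp_apply, h.2,
        Multiset.card_cons, pow_succ, Multiset.map_cons, Multiset.prod_cons]
      ring
  rw [this, hc]
  unfold dn
  have e2 : ∀ y : ℝ, y ^ D = y ^ (D - φ.natDegree) * y ^ φ.natDegree := by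
    intro y; rw [← pow_add]; congr 1; omega
  rw [e2]; ring

/-- composition of disc maps -/
lemma DMaps.comp {P Q : K[X]} {c : K} {s : ℝ} (hs : 0 < s) {a : K} {r : ℝ}
    (h : DMaps P Q c s a r) {D : ℕ} {u v : K[X]} (hu : u.natDegree ≤ D) (hv : v.natDegree ≤ D)
    {b : K} {t : ℝ} (hr : 0 < r) (h2 : DMaps u v a r b t) :
    DMaps (hev D u P Q) (hev D v P Q) c s b t := by
  have e : ∀ a', hev D u P Q - C a' * hev D v P Q =
      hev D (u - C a' * v) P Q := by
    intro a'; rw [hev_sub, hev_C_mul]; rfl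
  constructor
  · apply ne_zero_of_dn_pos (c := c) (s := s)
    rw [h.dn_hev hv]
    exact mul_pos (dn_pos _ hr h2.1) (pow_pos (dn_pos _ hs h.1) _)
  · intro a'
    rw [e, h.dn_hev, h.dn_hev hv, h2.2, mul_assoc]
    exact (natDegree_sub_le _ _).trans (max_le hu ((natDegree_C_mul_le _ _).trans hv))

/-- cancellation of disc maps -/
lemma DMaps.of_comp {P Q : K[X]} {c : K} {s : ℝ} (hs : 0 < s) {a : K} {r : ℝ}
    (h : DMaps P Q c s a r) {D : ℕ} {u v : K[X]} (hu : u.natDegree ≤ D) (hv : v.natDegree ≤ D)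
    {b : K} {t : ℝ} (h2 : DMaps (hev D u P Q) (hev D v P Q) c s b t) :
    DMaps u v a r b t := by
  have e : ∀ a', hev D u P Q - C a' * hev D v P Q =
      hev D (u - C a' * v) P Q := by
    intro a'; rw [hev_sub, hev_C_mul]; rfl
  have hpos := pow_pos (dn_pos c hs h.1) D
  constructor
  · rintro rfl
    apply h2.1
    simp [hev]
  · intro a'
    have := h2.2 a'
    rw [e, h.dn_hev, h.dn_hev hv, ← mul_assoc] at this
    · exact mul_right_cancel₀ hpos.ne' this
    · exact (natDegree_sub_le _ _).trans (max_le hu ((natDegree_C_mul_le _ _).trans hv))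

/-- crossing lemma -/
lemma DMaps.of_crossing {p q : K[X]} (hq : q ≠ 0) {c : K} {r : ℝ} (hr : 0 < r) {a : K} {ρ : ℝ}
    (heq : dn c r (p - C a * q) = ρ * dn c r q)
    (hfr : ∃ᶠ s in 𝓝 r, dn c s (p - C a * q) ≠ ρ * dn c s q) : DMaps p q c r a ρ := by
  refine ⟨hq, fun a' => ?_⟩
  have e : p - C a' * q = (p - C a * q) + C (a - a') * q := by rw [C_sub]; ring
  have hqp := dn_pos c hr hq
  by_cases h : ‖a - a'‖ = ρ
  · -- limit argument
    have hcl : IsClosed {s : ℝ | dn c s (p - C a' * q) =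
        max (dn c s (p - C a * q)) (ρ * dn c s q)} :=
      isClosed_eq (dn_continuous _ _)
        ((dn_continuous _ _).max (continuous_const.mul (dn_continuous _ _)))
    have hmem : r ∈ {s : ℝ | dn c s (p - C a' * q) =
        max (dn c s (p - C a * q)) (ρ * dn c s q)} := by
      apply hcl.mem_of_frequently_of_tendsto _ tendsto_id
      refine (hfr.and_eventually (lt_mem_nhds hr)).mono ?_
      rintro s ⟨h1, h2⟩
      simp only [id, Set.mem_ofPred_eq]
      rw [e, dn_add_eq_max c h2, dn_C_mul, h]
      rw [dn_C_mul, h]; exact h1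
    simp only [Set.mem_ofPred_eq] at hmem
    rw [hmem, heq, max_self, h, max_self]
  · rw [e, dn_add_eq_max c hr, heq, dn_C_mul, max_mul_of_nonneg _ _ hqp.le]
    rw [heq, dn_C_mul]
    intro h'
    exact h (mul_right_cancel₀ hqp.ne' h').symm

end HelpersB

section HelpersC
set_option linter.unusedSectionVars false
variable {K : Type*} [NontriviallyNormedField K] [IsAlgClosed K] [IsUltrametricDist K]

lemma rcount_mul_le (Pr : K → Prop) (p q : K[X]) :
    rcount Pr (p * q) ≤ rcount Pr p + rcount Pr q := by
  unfold rcount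
  by_cases h : p * q = 0
  · simp [h]
  · rw [roots_mul h, Multiset.filter_add, Multiset.card_add]

lemma rcount_C (Pr : K → Prop) (a : K) : rcount Pr (C a) = 0 := by simp [rcount]

lemma rcount_pow_le (Pr : K → Prop) (p : K[X]) (n : ℕ) : rcount Pr (p ^ n) ≤ n * rcount Pr p := by
  induction n with
  | zero => rw [pow_zero, ← C_1, rcount_C]; simp
  | succ n ih =>
    rw [pow_succ, add_mul, one_mul]
    exact (rcount_mul_le _ _ _).trans (Nat.add_le_add_right ih _)

lemma rcount_prod_le (Pr : K → Prop) (m : Multiset K) (g : K → K[X]) (b : ℕ)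
    (h : ∀ a ∈ m, rcount Pr (g a) ≤ b) : rcount Pr (m.map g).prod ≤ m.card * b := by
  induction m using Multiset.induction_on with
  | empty => simp only [Multiset.map_zero, Multiset.prod_zero]; rw [← C_1, rcount_C]; simp
  | cons a m ih =>
    rw [Multiset.map_cons, Multiset.prod_cons, Multiset.card_cons, add_mul, one_mul, add_comm]
    exact (rcount_mul_le _ _ _).trans (add_le_add (h a (Multiset.mem_cons_self _ _))
      (ih (fun b hb => h b (Multiset.mem_cons_of_mem hb))))

lemma rcount_hev_le (Pr : K → Prop) {M : ℕ} {φ : K[X]} (hφ : φ.natDegree ≤ M) {P Q : K[X]} {b : ℕ}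
    (h1 : ∀ β, rcount Pr (P - C β * Q) ≤ b) (h2 : rcount Pr Q ≤ b) :
    rcount Pr (hev M φ P Q) ≤ M * b := by
  rw [hev_factor hφ]
  have e : ∀ c : K, algebraMap K K[X] c = C c := fun _ => rfl
  simp only [e]
  refine (rcount_mul_le _ _ _).trans ?_
  rw [rcount_C, zero_add]
  refine (rcount_mul_le _ _ _).trans ?_
  have hc : φ.roots.card = φ.natDegree := ((IsAlgClosed.splits φ).natDegree_eq_card_roots).symm
  have a1 := (rcount_pow_le Pr Q (M - φ.natDegree)).trans (Nat.mul_le_mul_left _ h2)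
  have a2 := rcount_prod_le Pr φ.roots (fun c => P - C c * Q) b (fun a _ => h1 a)
  rw [hc] at a2
  refine (add_le_add a1 a2).trans ?_
  rw [← add_mul]
  apply Nat.mul_le_mul_right
  omega

lemma rcount_hev_le' (Pr : K → Prop) {M : ℕ} {φ : K[X]} (hφ : φ.natDegree ≤ M) (h0 : φ ≠ 0)
    {P Q : K[X]} {b : ℕ}
    (h1 : ∀ β, rcount Pr (P - C β * Q) ≤ b) (h2 : rcount Pr Q ≤ b) {β : K} (hβ : φ.IsRoot β)
    (h3 : rcount Pr (P - C β * Q) = 0) :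
    rcount Pr (hev M φ P Q) ≤ (M - 1) * b := by
  obtain ⟨ψ, hψ⟩ := dvd_iff_isRoot.2 hβ
  have hψ0 : ψ ≠ 0 := by rintro rfl; simp at hψ; exact h0 hψ
  have hdeg : φ.natDegree = 1 + ψ.natDegree := by
    rw [hψ, natDegree_mul (X_sub_C_ne_zero _) hψ0, natDegree_X_sub_C]
  have e : M = 1 + (M - 1) := by omega
  have : hev M φ P Q = (P - C β * Q) * hev (M - 1) ψ P Q := by
    conv_lhs => rw [e, hψ, hev_mul (by simp) (by omega), hev_X_sub_C]
    rfl
  rw [this]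
  refine (rcount_mul_le _ _ _).trans ?_
  rw [h3, zero_add]
  exact rcount_hev_le Pr (by omega) h1 h2

/-- combinatorial weighting lemma -/
lemma weight_lemma (m1 m2 : Multiset K) (ℓ : K → ℝ) (hℓ : ∀ x, 0 ≤ ℓ x)
    (F : Finset (Set K)) (hdis : ∀ U ∈ F, ∀ V ∈ F, U ≠ V → Disjoint U V)
    (hconst : ∀ U ∈ F, ∃ l, ∀ x ∈ U, ℓ x = l)
    (hcard : ∀ U ∈ F, (m2.filter (· ∈ U)).card ≤ (m1.filter (· ∈ U)).card) :
    ((m2.filter (fun x => ∃ U ∈ F, x ∈ U)).map ℓ).sum ≤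
      ((m1.filter (fun x => ∃ U ∈ F, x ∈ U)).map ℓ).sum := by
  induction F using Finset.induction_on with
  | empty => simp
  | insert U F hU ih =>
    have ih := ih (fun V hV W hW => hdis V (Finset.mem_insert_of_mem hV) W
      (Finset.mem_insert_of_mem hW)) (fun V hV => hconst V (Finset.mem_insert_of_mem hV))
      (fun V hV => hcard V (Finset.mem_insert_of_mem hV))
    have key : ∀ m : Multiset K, m.filter (fun x => ∃ V ∈ insert U F, x ∈ V) =
        m.filter (· ∈ U) + m.filter (fun x => ∃ V ∈ F, x ∈ V) := by
      intro m
      rw [Multiset.filter_add_filter]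
      have h0 : m.filter (fun x => x ∈ U ∧ ∃ V ∈ F, x ∈ V) = 0 := by
        apply Multiset.filter_eq_nil.2
        rintro x - ⟨hx, V, hV, hxV⟩
        have := hdis U (Finset.mem_insert_self _ _) V (Finset.mem_insert_of_mem hV)
          (by rintro rfl; exact hU hV)
        exact Set.disjoint_left.1 this hx hxV
      rw [h0, add_zero]
      apply Multiset.filter_congr
      intro x _
      simp
    obtain ⟨l, hl⟩ := hconst U (Finset.mem_insert_self _ _)
    have hsum : ∀ m : Multiset K, ((m.filter (· ∈ U)).map ℓ).sum = (m.filter (· ∈ U)).card * l := by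
      intro m
      have : (m.filter (· ∈ U)).map ℓ = (m.filter (· ∈ U)).map (fun _ => l) := by
        apply Multiset.map_congr rfl
        intro x hx
        exact hl x (Multiset.mem_filter.1 hx).2
      rw [this]; simp
    rw [key, key, Multiset.map_add, Multiset.map_add, Multiset.sum_add, Multiset.sum_add,
      hsum, hsum]
    apply add_le_add _ ih
    rcases U.eq_empty_or_nonempty with rfl | ⟨x, hx⟩
    · simp
    · apply mul_le_mul_of_nonneg_right _ (hl x hx ▸ hℓ x)
      exact_mod_cast hcard U (Finset.mem_insert_self _ _)

/-- growth of disc norms in terms of root weights -/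
lemma dn_growth (b : K) {s S : ℝ} (hs : 0 < s) (hS : s ≤ S) (p : K[X]) :
    dn b S p = dn b s p *
      Real.exp ((p.roots.map (fun β => Real.log (max S ‖b - β‖ / max s ‖b - β‖))).sum) := by
  unfold dn
  rw [mul_assoc]
  congr 1
  induction p.roots using Multiset.induction_on with
  | empty => simp
  | cons a m ih =>
    simp only [Multiset.map_cons, Multiset.prod_cons, Multiset.sum_cons, Real.exp_add]
    have h1 : 0 < max s ‖b - a‖ := lt_max_of_lt_left hs
    have h2 : 0 < max S ‖b - a‖ := lt_max_of_lt_left (hs.trans_le hS)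
    rw [Real.exp_log (div_pos h2 h1), ih]
    field_simp

/-- many directions -/
lemma exists_directions (α : K) {ρ : ℝ} {w : K} (hw : w ≠ 0) (hρ : ‖w‖ = ρ) (n : ℕ) :
    ∃ T : Finset K, T.card = n ∧ (∀ a ∈ T, ‖α - a‖ ≤ ρ) ∧
      ∀ a ∈ T, ∀ b ∈ T, a ≠ b → ‖a - b‖ = ρ := by
  have hρ0 : 0 < ρ := hρ ▸ norm_pos_iff.2 hw
  induction n with
  | zero => exact ⟨∅, by simp⟩
  | succ n ih =>
    obtain ⟨T, hT, h1, h2⟩ := ih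
    obtain ⟨x, hx, hx2⟩ := exists_generic α hw hρ (∏ a ∈ T, (X - C a))
    have hdn : dn α ρ (∏ a ∈ T, (X - C a)) = ∏ a ∈ T, ρ := by
      rw [Finset.prod, dn_multiset_prod, Multiset.map_map]
      apply Finset.prod_congr rfl
      intro a ha
      simp only [Function.comp, dn_X_sub_C]
      exact max_eq_left (h1 a ha)
    rw [hdn, eval_prod, norm_prod] at hx2
    simp only [eval_sub, eval_X, eval_C] at hx2
    have hle : ∀ a ∈ T, ‖x - a‖ ≤ ρ := by
      intro a ha
      have e : x - a = (x - α) + (α - a) := by ring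
      rw [e]
      exact (IsUltrametricDist.norm_add_le_max _ _).trans (max_le hx.le (h1 a ha))
    have heq : ∀ a ∈ T, ‖x - a‖ = ρ := by
      by_contra hcon
      push Not at hcon
      obtain ⟨a, ha, hne⟩ := hcon
      have hpos : ∀ b ∈ T, 0 < ‖x - b‖ := by
        intro b hb
        rcases (norm_nonneg (x - b)).eq_or_lt with h | h
        · rw [Finset.prod_eq_zero hb h.symm] at hx2
          exact absurd hx2 (Finset.prod_pos (fun _ _ => hρ0)).ne
        · exact h
      have := Finset.prod_lt_prod hpos hle ⟨a, ha, lt_of_le_of_ne (hle a ha) hne⟩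
      rw [hx2] at this
      exact lt_irrefl _ this
    have hxT : x ∉ T := by
      intro hx'
      have := heq x hx'
      simp at this
      exact hρ0.ne this
    refine ⟨insert x T, by rw [Finset.card_insert_of_notMem hxT, hT], ?_, ?_⟩
    · intro a ha
      rcases Finset.mem_insert.1 ha with rfl | ha
      · rw [norm_sub_rev]; exact hx.le
      · exact h1 a ha
    · intro a ha b hb hab
      rcases Finset.mem_insert.1 ha with hax | ha' <;>
        rcases Finset.mem_insert.1 hb with hbx | hb'
      · exact absurd (hax.trans hbx.symm) hab
      · rw [hax]; exact heq b hb'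
      · rw [norm_sub_rev, hbx]; exact heq a ha'
      · exact h2 a ha' b hb' hab

/-- two directions give the root count comparison in a hole -/
lemma hole_count {P Q A B : K[X]} {b : K} {s : ℝ} (hs : 0 < s) {α : K} {ρ : ℝ} (hρ : 0 < ρ)
    (hm : DMaps P Q b s α ρ) (hB : B ≠ 0)
    (hnd : dn b s (P * B - Q * A) = dn b s Q * max (ρ * dn b s B) (dn b s (A - C α * B)))
    {γ γ' : K} (h1 : ‖α - γ‖ ≤ ρ) (h2 : ‖α - γ'‖ ≤ ρ) (h12 : ‖γ - γ'‖ = ρ) :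
    rcount (fun a => ‖b - a‖ < s) (P - C γ * Q) ≤ rcount (fun a => ‖b - a‖ < s) (P * B - Q * A) ∨
    rcount (fun a => ‖b - a‖ < s) (P - C γ' * Q) ≤ rcount (fun a => ‖b - a‖ < s) (P * B - Q * A) := by
  set R := P * B - Q * A with hR
  set u := P - C γ * Q with hu
  set u' := P - C γ' * Q with hu'
  have hQ := dn_pos b hs hm.1
  have hdu : dn b s u = ρ * dn b s Q := by rw [hu, hm.2, max_eq_left h1]
  have hdu' : dn b s u' = ρ * dn b s Q := by rw [hu', hm.2, max_eq_left h2]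
  set G := max (ρ * dn b s B) (dn b s (A - C α * B)) with hG
  have hG0 : 0 < G := lt_max_of_lt_left (mul_pos hρ (dn_pos b hs hB))
  -- common radius
  obtain ⟨σ, hσ0, hσs, hσ⟩ := exists_radius_below b hs (R * (u * u'))
  have hR0 : R ≠ 0 := ne_zero_of_dn_pos (c := b) (s := s) (by rw [hnd]; positivity)
  have hu0 : u ≠ 0 := ne_zero_of_dn_pos (c := b) (s := s) (by rw [hdu]; positivity)
  have hu0' : u' ≠ 0 := ne_zero_of_dn_pos (c := b) (s := s) (by rw [hdu']; positivity)
  rw [roots_mul (mul_ne_zero hR0 (mul_ne_zero hu0 hu0')), roots_mul (mul_ne_zero hu0 hu0')] at hσ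
  have sR := dn_scale b hσs.le R (fun a ha => hσ a (by simp only [Multiset.mem_add]; tauto))
  have su := dn_scale b hσs.le u (fun a ha => hσ a (by simp only [Multiset.mem_add]; tauto))
  have su' := dn_scale b hσs.le u' (fun a ha => hσ a (by simp only [Multiset.mem_add]; tauto))
  set nR := rcount (fun a => ‖b - a‖ < s) R
  set nu := rcount (fun a => ‖b - a‖ < s) u
  set nu' := rcount (fun a => ‖b - a‖ < s) u'
  -- bound on R at σ
  have hGle : ∀ g : K, ‖α - g‖ ≤ ρ → dn b σ (A - C g * B) ≤ G := by
    intro g hg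
    refine (dn_mono b hσs.le _).trans ?_
    have e : A - C g * B = C (α - g) * B + (A - C α * B) := by rw [C_sub]; ring
    rw [e]
    refine (dn_add_le b hs _ _).trans (max_le_max ?_ le_rfl)
    rw [dn_C_mul]
    exact mul_le_mul_of_nonneg_right hg (dn_nonneg _ _ _)
  have hkey : ρ * dn b σ R ≤ max (dn b σ u) (dn b σ u') * G := by
    have e : C (γ' - γ) * R = u' * (A - C γ * B) - u * (A - C γ' * B) := by
      rw [hR, hu, hu', C_sub]; ring
    rw [← h12, norm_sub_rev, ← dn_C_mul, e]
    refine (dn_sub_le b hσ0 _ _).trans (max_le ?_ ?_)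
    · rw [dn_mul]
      exact mul_le_mul (le_max_right _ _) (hGle γ h1) (dn_nonneg _ _ _)
        ((dn_nonneg _ _ _).trans (le_max_left _ _))
    · rw [dn_mul]
      exact mul_le_mul (le_max_left _ _) (hGle γ' h2) (dn_nonneg _ _ _)
        ((dn_nonneg _ _ _).trans (le_max_left _ _))
  have hx0 : 0 < σ / s := div_pos hσ0 hs
  have hx1 : σ / s < 1 := (div_lt_one hs).2 hσs
  have tr : ∀ (v : K[X]) (n : ℕ), dn b σ v * s ^ n = dn b s v * σ ^ n →
      dn b σ v = dn b s v * (σ / s) ^ n := by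
    intro v n h
    rw [div_pow, mul_div_assoc', ← h, mul_div_assoc, div_self (pow_pos hs n).ne', mul_one]
  rw [tr R nR sR, tr u nu su, tr u' nu' su', hdu, hdu', hnd, ← mul_max_of_nonneg _ _ (by positivity)] at hkey
  have hfin : (σ / s) ^ nR ≤ max ((σ / s) ^ nu) ((σ / s) ^ nu') := by
    have hpos : 0 < ρ * dn b s Q * G := by positivity
    refine le_of_mul_le_mul_left ?_ hpos
    calc _ = ρ * (dn b s Q * G * (σ / s) ^ nR) := by ring
      _ ≤ _ := hkey
      _ = _ := by ring
  rcases le_max_iff.1 hfin with h | h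
  · left; exact (pow_le_pow_iff_right_of_lt_one₀ hx0 hx1).1 h
  · right; exact (pow_le_pow_iff_right_of_lt_one₀ hx0 hx1).1 h

end HelpersC

section HelpersD
set_option linter.unusedSectionVars false
variable {K : Type*} [NontriviallyNormedField K] [IsAlgClosed K] [IsUltrametricDist K]

/-- radii at which the image disc is inside `(c0,r)` -/
def holeSet (P Q : K[X]) (c0 : K) (r S : ℝ) (y : K) : Set ℝ :=
  {s | s ∈ Set.Icc 0 S ∧ dn y s (P - C c0 * Q) ≤ r * dn y s Q}

noncomputable def holeRad (P Q : K[X]) (c0 : K) (r S : ℝ) (y : K) : ℝ := sSup (holeSet P Q c0 r S y)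

lemma hole_spec {P Q : K[X]} {c0 : K} {r S : ℝ} (hS : 0 < S) {y : K}
    (h0 : ‖(P - C c0 * Q).eval y‖ < r * ‖Q.eval y‖)
    (h1 : r * dn y S Q < dn y S (P - C c0 * Q)) :
    IsGreatest (holeSet P Q c0 r S y) (holeRad P Q c0 r S y) ∧ 0 < holeRad P Q c0 r S y ∧
      holeRad P Q c0 r S y < S ∧ DMaps P Q y (holeRad P Q c0 r S y) c0 r := by
  have hQ : Q ≠ 0 := by 
    rintro rfl
    simp at h0
    exact absurd h0 (not_lt.2 (norm_nonneg _))
  have c1 := dn_continuous y (P - C c0 * Q)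
  have c2 : Continuous (fun s => r * dn y s Q) := continuous_const.mul (dn_continuous y Q)
  have hcomp : IsCompact (holeSet P Q c0 r S y) := by
    have : holeSet P Q c0 r S y = Set.Icc 0 S ∩ {s | dn y s (P - C c0 * Q) ≤ r * dn y s Q} := rfl
    rw [this]
    exact isCompact_Icc.inter_right (isClosed_le c1 c2)
  have hz : (0 : ℝ) ∈ holeSet P Q c0 r S y := by
    refine ⟨⟨le_rfl, hS.le⟩, ?_⟩
    rw [dn_zero_radius, dn_zero_radius]; exact h0.le
  have hg : IsGreatest (holeSet P Q c0 r S y) (holeRad P Q c0 r S y) :=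
    hcomp.isGreatest_sSup ⟨0, hz⟩
  set s := holeRad P Q c0 r S y with hs
  have hlt : s < S := by
    rcases hg.1.1.2.eq_or_lt with h | h
    · exfalso
      have := hg.1.2
      rw [h] at this
      linarith
    · exact h
  -- a strict inequality at x < S propagates
  have hprop : ∀ x, 0 ≤ x → x < S → dn y x (P - C c0 * Q) < r * dn y x Q → x < s := by
    intro x hx0 hxS hx
    have hev : ∀ᶠ t in 𝓝 x, dn y t (P - C c0 * Q) < r * dn y t Q :=
      c1.continuousAt.eventually_lt c2.continuousAt hx
    have hev2 : ∀ᶠ t in 𝓝[>] x, t ∈ holeSet P Q c0 r S y ∧ x < t := by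
      filter_upwards [nhdsWithin_le_nhds hev, self_mem_nhdsWithin,
        nhdsWithin_le_nhds (gt_mem_nhds hxS)] with t h1 h2 h3
      have h2 : x < t := h2
      exact ⟨⟨⟨hx0.trans h2.le, h3.le⟩, h1.le⟩, h2⟩
    obtain ⟨t, ht1, ht2⟩ := hev2.exists
    exact ht2.trans_le (hg.2 ht1)
  have hpos : 0 < s := by
    apply hprop 0 le_rfl hS
    rw [dn_zero_radius, dn_zero_radius]; exact h0
  have heq : dn y s (P - C c0 * Q) = r * dn y s Q := by
    apply le_antisymm hg.1.2
    by_contra hcon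
    push Not at hcon
    exact lt_irrefl _ (hprop s hpos.le hlt hcon)
  refine ⟨hg, hpos, hlt, DMaps.of_crossing hQ hpos heq ?_⟩
  have hev2 : ∀ᶠ t in 𝓝[>] s, dn y t (P - C c0 * Q) ≠ r * dn y t Q := by
    filter_upwards [self_mem_nhdsWithin, nhdsWithin_le_nhds (gt_mem_nhds hlt)] with t h2 h3
    have h2 : s < t := h2
    intro h
    have : t ∈ holeSet P Q c0 r S y := ⟨⟨hpos.le.trans h2.le, h3.le⟩, h.le⟩
    exact absurd (hg.2 this) (not_le.2 h2)
  exact hev2.frequently.filter_mono nhdsWithin_le_nhds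

/-- capturing -/
def Cap (P Q : K[X]) (c0 : K) (r : ℝ) (x : K) : Prop :=
  ∃ β, ‖β - c0‖ < r ∧ P.eval x = β * Q.eval x

lemma Cap.lt {P Q : K[X]} {c0 : K} {r : ℝ} {x : K} (h : Cap P Q c0 r x)
    (hnv : P.eval x ≠ 0 ∨ Q.eval x ≠ 0) : ‖(P - C c0 * Q).eval x‖ < r * ‖Q.eval x‖ := by
  obtain ⟨β, hβ, h⟩ := h
  have hq : Q.eval x ≠ 0 := by
    intro hq
    rw [hq, mul_zero] at h
    tauto
  have e : (P - C c0 * Q).eval x = (β - c0) * Q.eval x := by simp [h]; ring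
  rw [e, norm_mul]
  exact mul_lt_mul_of_pos_right hβ (norm_pos_iff.2 hq)

lemma hole_root {P Q : K[X]} {c0 : K} {r S : ℝ} (hr : 0 < r) (hS : 0 < S) {y : K}
    (hnv : ∀ x, P.eval x ≠ 0 ∨ Q.eval x ≠ 0) (hy : ‖y‖ < S) (hc : Cap P Q c0 r y)
    (h1 : r * dn 0 S Q < dn 0 S (P - C c0 * Q)) :
    ∃ b ∈ (P - C c0 * Q).roots, ‖b‖ < S ∧ Cap P Q c0 r b ∧
      ‖b - y‖ < holeRad P Q c0 r S b := by
  have rec0 : ∀ x : K, ‖x‖ < S → r * dn x S Q < dn x S (P - C c0 * Q) := by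
    intro x hx
    rw [dn_recenter (c := x) (c' := 0) (by simpa using hx.le),
      dn_recenter (c := x) (c' := 0) (by simpa using hx.le)]
    exact h1
  obtain ⟨hg, hpos, hlt, hm⟩ := hole_spec hS (hc.lt (hnv y)) (rec0 y hy)
  set s := holeRad P Q c0 r S y with hs
  have h2 : ‖(P - C c0 * Q).eval y‖ < dn y s (P - C c0 * Q) := by
    rw [hm.2, sub_self, norm_zero, max_eq_left hr.le]
    exact (hc.lt (hnv y)).trans_le (mul_le_mul_of_nonneg_left
      (norm_eval_le (by simpa using hpos.le) _) hr.le)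
  obtain ⟨b, hb1, hb2, hb3⟩ := exists_root_of_lt (by simpa using hpos.le) h2
  have hbS : ‖b‖ < S := by
    have e : b = (b - y) + y := by ring
    rw [e]
    exact (IsUltrametricDist.norm_add_le_max _ _).trans_lt (max_lt (hb3.trans hlt) hy)
  have hcb : Cap P Q c0 r b := by
    refine ⟨c0, by simpa using hr, ?_⟩
    have : (P - C c0 * Q).eval b = 0 := hb1
    simpa [sub_eq_zero] using this
  obtain ⟨hg', -⟩ := hole_spec hS (hcb.lt (hnv b)) (rec0 b hbS)
  refine ⟨b, (mem_roots hb2).2 hb1, hbS, hcb, hb3.trans_le ?_⟩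
  apply hg'.2
  refine ⟨hg.1.1, ?_⟩
  rw [dn_recenter hb3.le, dn_recenter hb3.le]
  exact hg.1.2

lemma rcount_le_natDegree (Pr : K → Prop) (p : K[X]) : rcount Pr p ≤ p.natDegree :=
  (Multiset.card_le_card (Multiset.filter_le _ _)).trans (card_roots' _)

lemma rcount_mono {Pr Pr' : K → Prop} (h : ∀ x, Pr x → Pr' x) (p : K[X]) :
    rcount Pr p ≤ rcount Pr' p :=
  Multiset.card_le_card (Multiset.monotone_filter_right _ h)

lemma rcount_eq_zero {Pr : K → Prop} {p : K[X]} (h : ∀ x ∈ p.roots, ¬ Pr x) : rcount Pr p = 0 := by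
  unfold rcount
  rw [Multiset.card_eq_zero]
  exact Multiset.filter_eq_nil.2 h

/-- points not captured at times in `[T, T+i)` -/
def Avoid (P Q : ℕ → K[X]) (c0 : K) (r : ℝ) (T i : ℕ) (x : K) : Prop :=
  ∀ t, T ≤ t → t < T + i → ¬ Cap (P t) (Q t) c0 r x

section seqs
variable {M : ℕ} {u v : K[X]} {P Q : ℕ → K[X]}

lemma seq_comb (hP : ∀ t, P (t + 1) = hev M u (P t) (Q t)) (hQ : ∀ t, Q (t + 1) = hev M v (P t) (Q t))
    (e0 e1 : K) (t : ℕ) : C e1 * P (t + 1) - C e0 * Q (t + 1) =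
    hev M (C e1 * u - C e0 * v) (P t) (Q t) := by
  rw [hP, hQ, hev_sub, hev_C_mul, hev_C_mul]; rfl

lemma comb_natDegree (hu : u.natDegree ≤ M) (hv : v.natDegree ≤ M)
    (e0 e1 : K) : (C e1 * u - C e0 * v).natDegree ≤ M :=
  (natDegree_sub_le _ _).trans (max_le ((natDegree_C_mul_le _ _).trans hu)
    ((natDegree_C_mul_le _ _).trans hv))

lemma seq_dmaps (hu : u.natDegree ≤ M) (hv : v.natDegree ≤ M) (hP : ∀ t, P (t + 1) = hev M u (P t) (Q t)) (hQ : ∀ t, Q (t + 1) = hev M v (P t) (Q t))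
    {α c0 : K} {r ρ : ℝ} (hr : 0 < r) (hρ : 0 < ρ)
    (hz : DMaps u v c0 r α ρ) (hζ : DMaps u v α ρ α ρ) {b : K} {s : ℝ} (hs : 0 < s) {t : ℕ}
    (h : DMaps (P t) (Q t) b s c0 r) {t' : ℕ} (ht : t < t') :
    DMaps (P t') (Q t') b s α ρ := by
  induction t', ht using Nat.le_induction with
  | base => rw [hP, hQ]; exact h.comp hs hu hv hr hz
  | succ n _ ih => rw [hP, hQ]; exact ih.comp hs hu hv hρ hζ

lemma avoid_count (hu : u.natDegree ≤ M) (hv : v.natDegree ≤ M) (hP : ∀ t, P (t + 1) = hev M u (P t) (Q t)) (hQ : ∀ t, Q (t + 1) = hev M v (P t) (Q t))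
    {D : ℕ} (hdP : ∀ t, (P t).natDegree ≤ D * M ^ t)
    (hdQ : ∀ t, (Q t).natDegree ≤ D * M ^ t) {c0 : K} {r : ℝ}
    (hcov : ∀ e0 e1 : K, (e0 ≠ 0 ∨ e1 ≠ 0) → ∃ x, ‖x - c0‖ < r ∧ e1 * u.eval x = e0 * v.eval x)
    (T i : ℕ) (e0 e1 : K) (he : e0 ≠ 0 ∨ e1 ≠ 0) :
    rcount (Avoid P Q c0 r T i)
      (C e1 * P (T + i) - C e0 * Q (T + i)) ≤ (M - 1) ^ i * (D * M ^ T) := by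
  induction i generalizing e0 e1 with
  | zero =>
    simp only [add_zero, pow_zero, one_mul]
    refine (rcount_le_natDegree _ _).trans ?_
    exact (natDegree_sub_le _ _).trans (max_le ((natDegree_C_mul_le _ _).trans (hdP T))
      ((natDegree_C_mul_le _ _).trans (hdQ T)))
  | succ i ih =>
    have hmono : ∀ p : K[X], rcount (Avoid P Q c0 r T (i + 1)) p
        ≤ rcount (Avoid P Q c0 r T i) p := by
      intro p
      apply rcount_mono
      intro x hx t h1 h2
      exact hx t h1 (by omega)
    rw [← add_assoc, seq_comb hP hQ, pow_succ', mul_assoc]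
    by_cases h0 : C e1 * u - C e0 * v = 0
    · rw [h0]; simp [hev, rcount]
    have f1 : ∀ β, rcount (Avoid P Q c0 r T (i + 1))
        (P (T + i) - C β * Q (T + i)) ≤ (M - 1) ^ i * (D * M ^ T) := by
      intro β
      have := (hmono _).trans (ih β 1 (Or.inr one_ne_zero))
      simpa using this
    have f2 : rcount (Avoid P Q c0 r T (i + 1))
        (Q (T + i)) ≤ (M - 1) ^ i * (D * M ^ T) := by
      have := (hmono _).trans (ih (-1) 0 (Or.inl (by simp)))
      simpa using this
    obtain ⟨x, hx1, hx2⟩ := hcov e0 e1 he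
    refine rcount_hev_le' _ (comb_natDegree hu hv e0 e1) h0 f1 f2 (β := x) ?_ ?_
    · simp [IsRoot, hx2]
    · apply rcount_eq_zero
      intro y hy hcon
      apply hcon (T + i) (by omega) (by omega)
      refine ⟨x, hx1, ?_⟩
      have := (mem_roots'.1 hy).2
      simpa [IsRoot, sub_eq_zero] using this

lemma avoid_count' (hu : u.natDegree ≤ M) (hv : v.natDegree ≤ M) (hP : ∀ t, P (t + 1) = hev M u (P t) (Q t)) (hQ : ∀ t, Q (t + 1) = hev M v (P t) (Q t))
    {D : ℕ} (hdP : ∀ t, (P t).natDegree ≤ D * M ^ t)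
    (hdQ : ∀ t, (Q t).natDegree ≤ D * M ^ t) {c0 : K} {r : ℝ}
    (hcov : ∀ e0 e1 : K, (e0 ≠ 0 ∨ e1 ≠ 0) → ∃ x, ‖x - c0‖ < r ∧ e1 * u.eval x = e0 * v.eval x)
    (T i l : ℕ) (e0 e1 : K) (he : e0 ≠ 0 ∨ e1 ≠ 0) :
    rcount (Avoid P Q c0 r T i)
      (C e1 * P (T + i + l) - C e0 * Q (T + i + l)) ≤ M ^ l * ((M - 1) ^ i * (D * M ^ T)) := by
  induction l generalizing e0 e1 with
  | zero => simpa using avoid_count hu hv hP hQ hdP hdQ hcov T i e0 e1 he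
  | succ l ih =>
    rw [← add_assoc, seq_comb hP hQ, pow_succ', mul_assoc]
    apply rcount_hev_le _ (comb_natDegree hu hv e0 e1)
    · intro β
      simpa using ih β 1 (Or.inr one_ne_zero)
    · simpa using ih (-1) 0 (Or.inl (by simp))

end seqs

end HelpersD

section HelpersE
set_option linter.unusedSectionVars false
variable {K : Type*} [NontriviallyNormedField K] [IsAlgClosed K] [IsUltrametricDist K]

lemma good_gamma {P Q A B : K[X]} {α : K} {ρ : ℝ} (hρ : 0 < ρ) {w : K} (hw : ‖w‖ = ρ) (hB : B ≠ 0)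
    (H : Finset (K × ℝ)) (h0 : ∀ h ∈ H, 0 < h.2) (hm : ∀ h ∈ H, DMaps P Q h.1 h.2 α ρ)
    (hnd : ∀ h ∈ H, dn h.1 h.2 (P * B - Q * A) =
      dn h.1 h.2 Q * max (ρ * dn h.1 h.2 B) (dn h.1 h.2 (A - C α * B))) :
    ∃ γ, ‖α - γ‖ ≤ ρ ∧ ∀ h ∈ H, rcount (fun a => ‖h.1 - a‖ < h.2) (P - C γ * Q) ≤
      rcount (fun a => ‖h.1 - a‖ < h.2) (P * B - Q * A) := by
  by_contra hcon
  push Not at hcon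
  have hw0 : w ≠ 0 := by rw [← norm_pos_iff, hw]; exact hρ
  obtain ⟨T, hT, hT1, hT2⟩ := exists_directions α hw0 hw (H.card + 1)
  choose! φ hφ1 hφ2 using hcon
  obtain ⟨x, hx, y, hy, hxy, he⟩ := Finset.exists_ne_map_eq_of_card_lt_of_maps_to
    (s := T) (t := H) (f := φ) (by omega) (fun a ha => hφ1 a (hT1 a ha))
  have a1 := hφ2 x (hT1 x hx)
  have a2 := hφ2 y (hT1 y hy)
  rw [← he] at a2
  have hh := hφ1 x (hT1 x hx)
  rcases hole_count (h0 _ hh) hρ (hm _ hh) hB (hnd _ hh) (hT1 x hx) (hT1 y hy) (hT2 x hx y hy hxy)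
    with h | h
  · exact absurd h (not_le.2 a1)
  · exact absurd h (not_le.2 a2)

/-- the open disc -/
def obl (h : K × ℝ) : Set K := {a | ‖h.1 - a‖ < h.2}

lemma obl_nested {h h' : K × ℝ} {x : K} (hx : x ∈ obl h) (hx' : x ∈ obl h') (hle : h.2 ≤ h'.2) :
    obl h ⊆ obl h' := by
  intro y hy
  have hx : ‖h.1 - x‖ < h.2 := hx
  have hx' : ‖h'.1 - x‖ < h'.2 := hx'
  have hy : ‖h.1 - y‖ < h.2 := hy
  change ‖h'.1 - y‖ < h'.2
  have e : h'.1 - y = (h'.1 - x) + (-(h.1 - x) + (h.1 - y)) := by ring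
  rw [e]
  refine (IsUltrametricDist.norm_add_le_max _ _).trans_lt (max_lt hx' ?_)
  refine (IsUltrametricDist.norm_add_le_max _ _).trans_lt (max_lt ?_ (hy.trans_le hle))
  rw [norm_neg]; exact hx.trans_le hle

lemma growth_compare (H : Finset (K × ℝ)) (m1 m2 : Multiset K) (b : K) {s S : ℝ} (hs : 0 < s)
    (hS : s ≤ S) (hmax : ∀ h ∈ H, b ∈ obl h → h.2 ≤ s)
    (hcard : ∀ h ∈ H, (m2.filter (· ∈ obl h)).card ≤ (m1.filter (· ∈ obl h)).card)
    (hin : ∀ x ∈ m2, ‖b - x‖ ≤ S) {N : ℕ}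
    (hN : (m2.filter (fun x => ∀ h ∈ H, x ∉ obl h)).card ≤ N) :
    (m2.map (fun β => Real.log (max S ‖b - β‖ / max s ‖b - β‖))).sum ≤
      (m1.map (fun β => Real.log (max S ‖b - β‖ / max s ‖b - β‖))).sum + N * Real.log (S / s) := by
  set ℓ : K → ℝ := fun β => Real.log (max S ‖b - β‖ / max s ‖b - β‖) with hℓ
  have hℓ0 : ∀ x, 0 ≤ ℓ x := by
    intro x
    apply Real.log_nonneg
    rw [le_div_iff₀ (lt_max_of_lt_left hs), one_mul]
    exact max_le_max_right _ hS
  set F0 := H.image obl with hF0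
  set F := F0.filter (fun U => Maximal (· ∈ F0) U) with hF
  have hFm : ∀ U ∈ F, ∃ h ∈ H, obl h = U := by
    intro U hU
    have := (Finset.mem_filter.1 hU).1
    simpa [hF0] using this
  have hcov : ∀ x, (∃ U ∈ F, x ∈ U) ↔ ∃ h ∈ H, x ∈ obl h := by
    intro x
    constructor
    · rintro ⟨U, hU, hx⟩
      obtain ⟨h, hh, rfl⟩ := hFm U hU
      exact ⟨h, hh, hx⟩
    · rintro ⟨h, hh, hx⟩
      obtain ⟨V, hV1, hV2⟩ := F0.exists_le_maximal (Finset.mem_image_of_mem obl hh)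
      exact ⟨V, Finset.mem_filter.2 ⟨hV2.1, hV2⟩, hV1 hx⟩
  have hdis : ∀ U ∈ F, ∀ V ∈ F, U ≠ V → Disjoint U V := by
    intro U hU V hV hne
    rw [Set.disjoint_left]
    intro x hxU hxV
    obtain ⟨h, hh, rfl⟩ := hFm U hU
    obtain ⟨h', hh', rfl⟩ := hFm V hV
    have m1 := (Finset.mem_filter.1 hU).2
    have m2 := (Finset.mem_filter.1 hV).2
    apply hne
    rcases le_total h.2 h'.2 with hle | hle
    · exact m1.eq_of_le m2.1 (obl_nested hxU hxV hle)
    · exact (m2.eq_of_le m1.1 (obl_nested hxV hxU hle)).symm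
  have hconst : ∀ U ∈ F, ∃ l, ∀ x ∈ U, ℓ x = l := by
    intro U hU
    obtain ⟨h, hh, rfl⟩ := hFm U hU
    by_cases hb : b ∈ obl h
    · refine ⟨Real.log (S / s), fun x hx => ?_⟩
      have h1 := hmax h hh hb
      have h2 : ‖b - x‖ < s := by
        have hb : ‖h.1 - b‖ < h.2 := hb
        have hx : ‖h.1 - x‖ < h.2 := hx
        have e : b - x = -(h.1 - b) + (h.1 - x) := by ring
        rw [e]
        refine (IsUltrametricDist.norm_add_le_max _ _).trans_lt (max_lt ?_ (hx.trans_le h1))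
        rw [norm_neg]; exact hb.trans_le h1
      simp only [hℓ]
      rw [max_eq_left h2.le, max_eq_left (h2.le.trans hS)]
    · refine ⟨ℓ h.1, fun x hx => ?_⟩
      have hb : h.2 ≤ ‖h.1 - b‖ := not_lt.1 hb
      have hx : ‖h.1 - x‖ < h.2 := hx
      have h2 : ‖b - x‖ = ‖b - h.1‖ := by
        have e : b - x = (b - h.1) + (h.1 - x) := by ring
        have h3 : ‖h.1 - x‖ < ‖b - h.1‖ := by rw [norm_sub_rev b]; exact hx.trans_le hb
        rw [e, IsUltrametricDist.norm_add_eq_max_of_norm_ne_norm h3.ne', max_eq_left h3.le]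
      simp only [hℓ]; rw [h2]
  have hw := weight_lemma m1 m2 ℓ hℓ0 F hdis hconst (by
    intro U hU
    obtain ⟨h, hh, rfl⟩ := hFm U hU
    exact hcard h hh)
  have e2 : (m2.map ℓ).sum = ((m2.filter (fun x => ∃ U ∈ F, x ∈ U)).map ℓ).sum +
      ((m2.filter (fun x => ¬ ∃ U ∈ F, x ∈ U)).map ℓ).sum := by
    rw [← Multiset.sum_add, ← Multiset.map_add, Multiset.filter_add_not]
  have e1 : ((m1.filter (fun x => ∃ U ∈ F, x ∈ U)).map ℓ).sum ≤ (m1.map ℓ).sum := by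
    conv_rhs => rw [← Multiset.filter_add_not (fun x => ∃ U ∈ F, x ∈ U) m1, Multiset.map_add,
      Multiset.sum_add]
    have : 0 ≤ ((m1.filter (fun x => ¬ ∃ U ∈ F, x ∈ U)).map ℓ).sum := by
      apply Multiset.sum_nonneg
      intro y hy
      obtain ⟨x, -, rfl⟩ := Multiset.mem_map.1 hy
      exact hℓ0 x
    linarith
  have e3 : ((m2.filter (fun x => ¬ ∃ U ∈ F, x ∈ U)).map ℓ).sum ≤ N * Real.log (S / s) := by
    have hl : 0 ≤ Real.log (S / s) := Real.log_nonneg (by rw [le_div_iff₀ hs]; linarith)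
    have h1 : ((m2.filter (fun x => ¬ ∃ U ∈ F, x ∈ U)).map ℓ).sum ≤
        (m2.filter (fun x => ¬ ∃ U ∈ F, x ∈ U)).card • Real.log (S / s) := by
      have := Multiset.sum_le_card_nsmul ((m2.filter (fun x => ¬ ∃ U ∈ F, x ∈ U)).map ℓ)
        (Real.log (S / s)) (by
          intro y hy
          obtain ⟨x, hx, rfl⟩ := Multiset.mem_map.1 hy
          have hx' := hin x (Multiset.mem_filter.1 hx).1
          simp only [hℓ]
          rw [max_eq_left hx']
          apply Real.log_le_log
          · apply div_pos (hs.trans_le hS) (lt_max_of_lt_left hs)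
          · exact div_le_div_of_nonneg_left (hs.le.trans hS) hs (le_max_left _ _))
      rwa [Multiset.card_map] at this
    refine h1.trans ?_
    rw [nsmul_eq_mul]
    apply mul_le_mul_of_nonneg_right _ hl
    have : m2.filter (fun x => ¬ ∃ U ∈ F, x ∈ U) = m2.filter (fun x => ∀ h ∈ H, x ∉ obl h) := by
      apply Multiset.filter_congr
      intro x _
      rw [hcov]; push Not; rfl
    rw [this]
    exact_mod_cast hN
  linarith


lemma final_estimate {M : ℕ} (hM : 2 ≤ M) {u v : K[X]} (hu : u.natDegree ≤ M)
    (hv : v.natDegree ≤ M)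
    {P Q : ℕ → K[X]} (hP : ∀ t, P (t + 1) = hev M u (P t) (Q t))
    (hQ : ∀ t, Q (t + 1) = hev M v (P t) (Q t)) {D : ℕ} (hD : 1 ≤ D)
    (hdP : ∀ t, (P t).natDegree ≤ D * M ^ t) (hdQ : ∀ t, (Q t).natDegree ≤ D * M ^ t)
    (hnv : ∀ t x, (P t).eval x ≠ 0 ∨ (Q t).eval x ≠ 0)
    {A B : K[X]} (hB : B ≠ 0) {S S' R R' : ℝ} (hS0 : 0 < S) (hS : S < S') (hR : R < R')
    {c0 α : K} {r ρ : ℝ} (hr : 0 < r) (hρ : 0 < ρ) (hc0R : ‖c0‖ ≤ R) (hrR : r ≤ R)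
    (hαR : ‖α‖ ≤ R) (hρR : ρ ≤ R) {w : K} (hw : ‖w‖ = ρ)
    (hz : DMaps u v c0 r α ρ) (hζ : DMaps u v α ρ α ρ)
    (hcov : ∀ e0 e1 : K, (e0 ≠ 0 ∨ e1 ≠ 0) → ∃ x, ‖x - c0‖ < r ∧ e1 * u.eval x = e0 * v.eval x)
    {𝒯 : ℕ → Prop} (h𝒯 : ∃ᶠ t in atTop, 𝒯 t) (hS' : ∀ t, DMaps (P t) (Q t) 0 S' 0 R')
    (hPW : ∀ t, 𝒯 t → ∀ γ, ‖γ‖ ≤ R → (P t - C γ * Q t).natDegree = D * M ^ t ∧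
      ∀ x ∈ (P t - C γ * Q t).roots, ‖x‖ ≤ S)
    {Cc ε : ℝ} (hε : 0 < ε)
    (hCL : ∀ t, 𝒯 t → dn 0 S' (P t * B - Q t * A) ≤
      Cc * Real.exp (-ε * (D * M ^ t)) * dn 0 S' (Q t))
    (hND : ∃ T0, ∀ t, T0 ≤ t → ∀ b s, 0 < s → DMaps (P t) (Q t) b s c0 r → ∀ᶠ t' in atTop,
      dn b s (P t' * B - Q t' * A) =
        dn b s (Q t') * max (ρ * dn b s B) (dn b s (A - C α * B))) : False := by
  obtain ⟨T0, hT0⟩ := hND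
  have hS'0 : 0 < S' := hS0.trans hS
  have hR0 : 0 ≤ R := (norm_nonneg _).trans hc0R
  have hR'0 : 0 < R' := hR0.trans_lt hR
  obtain ⟨T, hT𝒯, hTT0⟩ := (h𝒯.and_eventually (eventually_ge_atTop T0)).exists
  have hout : ∀ t, r * dn 0 S' (Q t) < dn 0 S' (P t - C c0 * Q t) := by
    intro t
    rw [(hS' t).2, zero_sub, norm_neg, max_eq_left (hc0R.trans hR.le)]
    exact mul_lt_mul_of_pos_right (hrR.trans_lt hR) (dn_pos _ hS'0 (hS' t).1)
  have hout' : ∀ t (x : K), ‖x‖ < S' → r * dn x S' (Q t) < dn x S' (P t - C c0 * Q t) := by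
    intro t x hx
    rw [dn_recenter (c := x) (c' := 0) (by simpa using hx.le),
      dn_recenter (c := x) (c' := 0) (by simpa using hx.le)]
    exact hout t
  -- holes
  have hcap : ∀ t b, b ∈ (P t - C c0 * Q t).roots → Cap (P t) (Q t) c0 r b := by
    intro t b hb
    have : (P t - C c0 * Q t).eval b = 0 := (mem_roots'.1 hb).2
    exact ⟨c0, by simpa using hr, by simpa [sub_eq_zero] using this⟩
  have hole := fun t b (hb : b ∈ (P t - C c0 * Q t).roots) (hbS : ‖b‖ < S') =>
    hole_spec hS'0 ((hcap t b hb).lt (hnv t b)) (hout' t b hbS)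
  obtain ⟨b1, hb1⟩ : ∃ b, b ∈ (P T - C c0 * Q T).roots := by
    have h1 := (hPW T hT𝒯 c0 hc0R).1
    have h2 : 0 < (P T - C c0 * Q T).natDegree := by
      rw [h1]; positivity
    have h3 : (P T - C c0 * Q T).degree ≠ 0 := by
      intro h; rw [natDegree_eq_of_degree_eq_some h] at h2; exact lt_irrefl _ h2
    obtain ⟨x, hx⟩ := IsAlgClosed.exists_root _ h3
    refine ⟨x, (mem_roots ?_).2 hx⟩
    rintro h; rw [h] at h2; simp at h2
  have hb1S : ‖b1‖ ≤ S := (hPW T hT𝒯 c0 hc0R).2 b1 hb1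
  obtain ⟨-, hs1, hs1S, hm1⟩ := hole T b1 hb1 (hb1S.trans_lt hS)
  set s1 := holeRad (P T) (Q T) c0 r S' b1 with hs1def
  have hMr : (2 : ℝ) ≤ M := by exact_mod_cast hM
  have hM0 : (0 : ℝ) < M := by linarith
  obtain ⟨i, hi1, hi2⟩ : ∃ i : ℕ, 1 ≤ i ∧ (((M : ℝ) - 1) / M) ^ i * Real.log (S' / s1) < ε / 2 := by
    have h1 : Tendsto (fun i : ℕ => (((M : ℝ) - 1) / M) ^ i * Real.log (S' / s1)) atTop
        (𝓝 (0 * Real.log (S' / s1))) := by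
      apply Tendsto.mul_const
      apply tendsto_pow_atTop_nhds_zero_of_lt_one
      · apply div_nonneg <;> linarith
      · rw [div_lt_one hM0]; linarith
    rw [zero_mul] at h1
    obtain ⟨i, hi, hi'⟩ := ((h1.eventually (gt_mem_nhds (half_pos hε))).and
      (eventually_ge_atTop 1)).exists
    exact ⟨i, hi', hi⟩
  set H : Finset (K × ℝ) := (Finset.range i).biUnion (fun j =>
    ((P (T + j) - C c0 * Q (T + j)).roots.toFinset.filter (fun b => ‖b‖ < S')).image
      (fun b => (b, holeRad (P (T + j)) (Q (T + j)) c0 r S' b))) with hH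
  have hHmem : ∀ h, h ∈ H ↔ ∃ j < i, h.1 ∈ (P (T + j) - C c0 * Q (T + j)).roots ∧ ‖h.1‖ < S' ∧
      h.2 = holeRad (P (T + j)) (Q (T + j)) c0 r S' h.1 := by
    rintro ⟨b, s⟩
    simp only [hH, Finset.mem_biUnion, Finset.mem_range, Finset.mem_image, Finset.mem_filter,
      Multiset.mem_toFinset, Prod.mk.injEq]
    constructor
    · rintro ⟨j, hj, b', ⟨h1, h2⟩, rfl, rfl⟩
      exact ⟨j, hj, h1, h2, rfl⟩
    · rintro ⟨j, hj, h1, h2, h3⟩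
      exact ⟨j, hj, b, ⟨h1, h2⟩, rfl, h3.symm⟩
  have hHprop : ∀ h ∈ H, 0 < h.2 ∧ h.2 < S' ∧ ‖h.1‖ < S' ∧
      ∃ j < i, DMaps (P (T + j)) (Q (T + j)) h.1 h.2 c0 r := by
    intro h hh
    obtain ⟨j, hj, h1, h2, h3⟩ := (hHmem h).1 hh
    obtain ⟨-, g1, g2, g3⟩ := hole (T + j) h.1 h1 h2
    rw [← h3] at g1 g2 g3
    exact ⟨g1, g2, h2, j, hj, g3⟩
  -- maximal hole containing b1
  have hb1H : (b1, s1) ∈ H := (hHmem _).2 ⟨0, hi1, hb1, hb1S.trans_lt hS, rfl⟩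
  obtain ⟨hst, hst1, hst2⟩ := (H.filter (fun h => b1 ∈ obl h)).exists_max_image (fun h => h.2)
    ⟨(b1, s1), Finset.mem_filter.2 ⟨hb1H, by simpa [obl] using hs1⟩⟩
  have hstH := (Finset.mem_filter.1 hst1).1
  have hstb : ‖hst.1 - b1‖ < hst.2 := (Finset.mem_filter.1 hst1).2
  have hmax : ∀ h ∈ H, b1 ∈ obl h → h.2 ≤ hst.2 := fun h hh hb =>
    hst2 h (Finset.mem_filter.2 ⟨hh, hb⟩)
  set s := hst.2 with hsdef
  have hs1s : s1 ≤ s := hmax (b1, s1) hb1H (by simpa [obl] using hs1)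
  have hs0 : 0 < s := hs1.trans_le hs1s
  have hsS : s < S' := (hHprop _ hstH).2.1
  have hGB := dn_pos b1 hs0 hB
  -- choose t'
  have hev1 : ∀ᶠ t' in atTop, ∀ h ∈ H, dn h.1 h.2 (P t' * B - Q t' * A) =
        dn h.1 h.2 (Q t') * max (ρ * dn h.1 h.2 B) (dn h.1 h.2 (A - C α * B)) := by
    rw [Finset.eventually_all]
    intro h hh
    obtain ⟨g1, g2, g3, j, hj, g4⟩ := hHprop h hh
    exact hT0 (T + j) (by omega) h.1 h.2 g1 g4
  have hev2 : ∀ᶠ t' : ℕ in atTop, Cc / (dn b1 s B * R') < Real.exp (ε / 2 * (D * M ^ t')) := by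
    have h1 : Tendsto (fun t' : ℕ => (M : ℝ) ^ t') atTop atTop :=
      tendsto_pow_atTop_atTop_of_one_lt (by linarith)
    have hD' : (0 : ℝ) < D := by exact_mod_cast hD
    have h2 : Tendsto (fun t' : ℕ => ε / 2 * (D * (M : ℝ) ^ t')) atTop atTop :=
      (h1.const_mul_atTop hD').const_mul_atTop (half_pos hε)
    exact (Real.tendsto_exp_atTop.comp h2).eventually (eventually_gt_atTop _)
  obtain ⟨t', ht𝒯, ht1, ht2, ht3⟩ :=
    (h𝒯.and_eventually (hev1.and (hev2.and (eventually_ge_atTop (T + i))))).exists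
  have hmt : ∀ h ∈ H, DMaps (P t') (Q t') h.1 h.2 α ρ := by
    intro h hh
    obtain ⟨g1, g2, g3, j, hj, g4⟩ := hHprop h hh
    exact seq_dmaps hu hv hP hQ hr hρ hz hζ g1 g4 (by omega)
  obtain ⟨γ, hγ1, hγ2⟩ := good_gamma hρ hw hB H (fun h hh => (hHprop h hh).1) hmt ht1
  have hγR : ‖γ‖ ≤ R := by
    have e : γ = α + -(α - γ) := by ring
    rw [e]
    refine (IsUltrametricDist.norm_add_le_max _ _).trans (max_le hαR ?_)
    rw [norm_neg]; exact hγ1.trans hρR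
  have hpw := (hPW t' ht𝒯 γ hγR).2
  obtain ⟨l, rfl⟩ := Nat.exists_eq_add_of_le ht3
  -- the count of avoiding roots
  have hav := avoid_count' hu hv hP hQ hdP hdQ hcov T i l γ 1 (Or.inr one_ne_zero)
  rw [map_one, one_mul] at hav
  have hb1S' : ‖b1 - 0‖ ≤ S' := by simpa using (hb1S.trans hS.le)
  have hgc := growth_compare H (P (T + i + l) * B - Q (T + i + l) * A).roots
    (P (T + i + l) - C γ * Q (T + i + l)).roots b1 hs0 hsS.le hmax (by
      intro h hh
      exact hγ2 h hh) (by
      intro x hx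
      have e : b1 - x = b1 + -x := by ring
      rw [e]
      refine (IsUltrametricDist.norm_add_le_max _ _).trans (max_le (hb1S.trans hS.le) ?_)
      rw [norm_neg]; exact (hpw x hx).trans hS.le)
    (N := M ^ l * ((M - 1) ^ i * (D * M ^ T))) (by
      refine le_trans ?_ hav
      apply Multiset.card_le_card
      rw [Multiset.le_filter]
      refine ⟨Multiset.filter_le _ _, ?_⟩
      intro x hx t h1 h2 hc
      obtain ⟨hx1, hx2⟩ := Multiset.mem_filter.1 hx
      obtain ⟨j, rfl⟩ := Nat.exists_eq_add_of_le h1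
      obtain ⟨b, g1, g2, g3, g4⟩ := hole_root hr hS'0 (hnv _) ((hpw x hx1).trans_lt hS) hc (hout _)
      exact hx2 (b, holeRad (P (T + j)) (Q (T + j)) c0 r S' b)
        ((hHmem _).2 ⟨j, by omega, g1, g2, rfl⟩) g4)
  have hg1 := dn_growth b1 hs0 hsS.le (P (T + i + l) * B - Q (T + i + l) * A)
  have hg2 := dn_growth b1 hs0 hsS.le (P (T + i + l) - C γ * Q (T + i + l))
  set sig1 := ((P (T + i + l) * B - Q (T + i + l) * A).roots.map
    (fun β => Real.log (max S' ‖b1 - β‖ / max s ‖b1 - β‖))).sum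
  set sig2 := ((P (T + i + l) - C γ * Q (T + i + l)).roots.map
    (fun β => Real.log (max S' ‖b1 - β‖ / max s ‖b1 - β‖))).sum
  have hmb : DMaps (P (T + i + l)) (Q (T + i + l)) b1 s α ρ :=
    (hmt hst hstH).recenter_source hstb.le
  have hndb := ht1 hst hstH
  simp only [← hsdef] at hndb
  simp only [dn_recenter hstb.le] at hndb
  set X1 : ℝ := D * (M : ℝ) ^ (T + i + l) with hX1
  have hX : 0 ≤ X1 := by positivity
  have hN : ((M ^ l * ((M - 1) ^ i * (D * M ^ T)) : ℕ) : ℝ) * Real.log (S' / s) ≤ ε / 2 * X1 := by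
    have hl : Real.log (S' / s) ≤ Real.log (S' / s1) := by
      apply Real.log_le_log (div_pos hS'0 hs0)
      exact div_le_div_of_nonneg_left hS'0.le hs1 hs1s
    have e : ((M ^ l * ((M - 1) ^ i * (D * M ^ T)) : ℕ) : ℝ) = (((M : ℝ) - 1) / M) ^ i * X1 := by
      have : 1 ≤ M := by omega
      push_cast [Nat.cast_sub this]
      rw [hX1, div_pow, pow_add, pow_add]
      field_simp
    rw [e]
    have hnn : 0 ≤ (((M : ℝ) - 1) / M) ^ i * X1 := by
      rw [← e]; positivity
    calc _ ≤ (((M : ℝ) - 1) / M) ^ i * X1 * Real.log (S' / s1) := mul_le_mul_of_nonneg_left hl hnn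
      _ = (((M : ℝ) - 1) / M) ^ i * Real.log (S' / s1) * X1 := by ring
      _ ≤ _ := mul_le_mul_of_nonneg_right hi2.le hX
  have hsig : sig2 - ε / 2 * X1 ≤ sig1 := by linarith
  have hcl := hCL _ ht𝒯
  rw [← dn_recenter hb1S', ← dn_recenter hb1S', hg1, hndb] at hcl
  have hg2' : R' * dn b1 S' (Q (T + i + l)) = ρ * dn b1 s (Q (T + i + l)) * Real.exp sig2 := by
    rw [hmb.2, max_eq_left hγ1, dn_recenter hb1S', (hS' _).2, zero_sub, norm_neg,
      max_eq_left (hγR.trans hR.le)] at hg2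
    rw [dn_recenter hb1S', hg2]
  have hQpos := dn_pos b1 hs0 hmb.1
  have hQpos' := dn_pos b1 hS'0 hmb.1
  have hlow : dn b1 s B * (R' * dn b1 S' (Q (T + i + l))) * Real.exp (-(ε / 2 * X1)) ≤
      Cc * Real.exp (-ε * X1) * dn b1 S' (Q (T + i + l)) := by
    refine le_trans ?_ hcl
    rw [hg2']
    have : Real.exp sig2 * Real.exp (-(ε / 2 * X1)) ≤ Real.exp sig1 := by
      rw [← Real.exp_add]; exact Real.exp_le_exp.2 (by linarith)
    calc _ = dn b1 s (Q (T + i + l)) * (ρ * dn b1 s B) *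
          (Real.exp sig2 * Real.exp (-(ε / 2 * X1))) := by ring
      _ ≤ dn b1 s (Q (T + i + l)) * (ρ * dn b1 s B) * Real.exp sig1 :=
          mul_le_mul_of_nonneg_left this (by positivity)
      _ ≤ _ := by
          apply mul_le_mul_of_nonneg_right _ (Real.exp_pos _).le
          exact mul_le_mul_of_nonneg_left (le_max_left _ _) hQpos.le
  rw [div_lt_iff₀ (by positivity)] at ht2
  have e1 : Real.exp (-ε * X1) = Real.exp (-(ε / 2 * X1)) * Real.exp (-(ε / 2 * X1)) := by
    rw [← Real.exp_add]; ring_nf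
  have e2 : Real.exp (ε / 2 * X1) * Real.exp (-(ε / 2 * X1)) = 1 := by
    rw [← Real.exp_add]; simp
  have hE := Real.exp_pos (-(ε / 2 * X1))
  have : Cc * Real.exp (-ε * X1) * dn b1 S' (Q (T + i + l)) <
      dn b1 s B * (R' * dn b1 S' (Q (T + i + l))) * Real.exp (-(ε / 2 * X1)) := by
    calc _ = Cc * (Real.exp (-(ε / 2 * X1)) * Real.exp (-(ε / 2 * X1)) *
            dn b1 S' (Q (T + i + l))) := by rw [e1]; ring
      _ < Real.exp (ε / 2 * X1) * (dn b1 s B * R') * (Real.exp (-(ε / 2 * X1)) *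
            Real.exp (-(ε / 2 * X1)) * dn b1 S' (Q (T + i + l))) :=
          mul_lt_mul_of_pos_right ht2 (by positivity)
      _ = (Real.exp (ε / 2 * X1) * Real.exp (-(ε / 2 * X1))) * (dn b1 s B * (R' * dn b1 S' (Q (T + i + l))) * Real.exp (-(ε / 2 * X1))) := by ring
      _ = _ := by rw [e2, one_mul]
  linarith

end HelpersE

section HelpersF
set_option linter.unusedSectionVars false
variable {K : Type*} [NontriviallyNormedField K] [IsAlgClosed K] [IsUltrametricDist K]

lemma dn_upper (c : K) {R1 R2 : ℝ} (h1 : 0 < R1) (h2 : R1 ≤ R2) {p : K[X]} {N : ℕ}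
    (hp : p.natDegree ≤ N) : dn c R2 p * R1 ^ N ≤ dn c R1 p * R2 ^ N := by
  have hR2 : 0 < R2 := h1.trans_le h2
  have key : ∀ m : Multiset K, (m.map (fun a => max R2 ‖c - a‖)).prod * R1 ^ m.card ≤
      (m.map (fun a => max R1 ‖c - a‖)).prod * R2 ^ m.card := by
    intro m
    have := multiset_prod_le m (fun a => max R2 ‖c - a‖ * R1) (fun a => max R1 ‖c - a‖ * R2) (by
      intro a _
      refine ⟨by positivity, ?_⟩
      rcases le_total R1 ‖c - a‖ with h | h
      · rw [max_eq_right h]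
        rcases le_total R2 ‖c - a‖ with h' | h'
        · rw [max_eq_right h']; gcongr
        · rw [max_eq_left h', mul_comm]; gcongr
      · rw [max_eq_left h, max_eq_left (h.trans h2), mul_comm])
    simpa [Multiset.prod_map_mul] using this
  have hc : p.roots.card ≤ N := (card_roots' p).trans hp
  obtain ⟨j, rfl⟩ := Nat.exists_eq_add_of_le hc
  have h3 := key p.roots
  unfold dn
  have h4 : R1 ^ j ≤ R2 ^ j := by gcongr
  rw [pow_add, pow_add]
  calc _ = ‖p.leadingCoeff‖ * ((p.roots.map (fun a => max R2 ‖c - a‖)).prod * R1 ^ p.roots.card) * R1 ^ j := by ring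
    _ ≤ ‖p.leadingCoeff‖ * ((p.roots.map (fun a => max R1 ‖c - a‖)).prod * R2 ^ p.roots.card) * R2 ^ j := by
        have : 0 ≤ (p.roots.map (fun a => max R1 ‖c - a‖)).prod := by
          apply Multiset.prod_nonneg
          intro x hx
          obtain ⟨a, -, rfl⟩ := Multiset.mem_map.1 hx
          positivity
        gcongr
    _ = _ := by ring

lemma full_growth (c : K) {R1 R2 : ℝ} (h1 : 0 < R1) (h2 : R1 < R2) {p : K[X]} {N : ℕ}
    (hp : p.natDegree ≤ N) (hp0 : p ≠ 0) (h : dn c R1 p * R2 ^ N ≤ dn c R2 p * R1 ^ N) :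
    p.natDegree = N ∧ ∀ β ∈ p.roots, ‖c - β‖ ≤ R1 := by
  have hR2 : 0 < R2 := h1.trans h2
  constructor
  · by_contra hne
    have hlt : p.natDegree < N := lt_of_le_of_ne hp hne
    obtain ⟨n, rfl⟩ : ∃ n, N = n + 1 := ⟨N - 1, by omega⟩
    have h3 := dn_upper c h1 h2.le (p := p) (N := n) (by omega)
    have h4 := dn_pos c h1 hp0
    rw [pow_succ, pow_succ] at h
    have h5 : dn c R1 p * R2 ^ n * R1 < dn c R1 p * R2 ^ n * R2 :=
      mul_lt_mul_of_pos_left h2 (by positivity)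
    have h6 : dn c R2 p * R1 ^ n * R1 ≤ dn c R1 p * R2 ^ n * R1 := by gcongr
    linarith
  · intro β hβ
    by_contra hcon
    push Not at hcon
    obtain ⟨p1, rfl⟩ := dvd_iff_isRoot.2 (mem_roots'.1 hβ).2
    have hp1 : p1 ≠ 0 := right_ne_zero_of_mul hp0
    rw [natDegree_mul (X_sub_C_ne_zero β) hp1, natDegree_X_sub_C] at hp
    obtain ⟨n, rfl⟩ : ∃ n, N = n + 1 := ⟨N - 1, by omega⟩
    have h3 := dn_upper c h1 h2.le (p := p1) (N := n) (by omega)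
    rw [dn_mul, dn_mul, dn_X_sub_C, dn_X_sub_C, max_eq_right hcon.le] at h
    have h4 := dn_pos c h1 hp1
    have h5 : max R2 ‖c - β‖ * R1 < ‖c - β‖ * R2 := by
      rcases le_total R2 ‖c - β‖ with h' | h'
      · rw [max_eq_right h']; gcongr; linarith
      · rw [max_eq_left h', mul_comm]; gcongr
    have : dn c R2 p1 * R1 ^ n * (max R2 ‖c - β‖ * R1) < dn c R1 p1 * R2 ^ n * (‖c - β‖ * R2) := by
      calc _ ≤ dn c R1 p1 * R2 ^ n * (max R2 ‖c - β‖ * R1) := by gcongr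
        _ < _ := mul_lt_mul_of_pos_left h5 (by positivity)
    rw [pow_succ, pow_succ] at h
    linarith

lemma full_conv (c : K) {s : ℝ} {p : K[X]} (h : ∀ β ∈ p.roots, ‖c - β‖ ≤ s) :
    dn c s p = ‖p.leadingCoeff‖ * s ^ p.natDegree := by
  unfold dn
  rw [Multiset.map_congr rfl (fun a ha => max_eq_left (h a ha)), Multiset.map_const',
    Multiset.prod_replicate, IsAlgClosed.card_roots_eq_natDegree]

lemma full_conv_eval (c : K) {s : ℝ} {p : K[X]} {x : K} (hx : ‖x - c‖ = s)
    (h : ∀ β ∈ p.roots, ‖c - β‖ < s) : ‖p.eval x‖ = ‖p.leadingCoeff‖ * s ^ p.natDegree := by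
  rw [← full_conv c (fun β hβ => (h β hβ).le)]
  apply le_antisymm (norm_eval_le hx.le p)
  by_contra hcon
  push Not at hcon
  obtain ⟨a, ha, hp, hax⟩ := exists_root_of_lt hx.le hcon
  have h1 := h a ((mem_roots hp).2 ha)
  have e : x - c = -(a - x) + -(c - a) := by ring
  rw [e] at hx
  have := IsUltrametricDist.norm_add_le_max (-(a - x)) (-(c - a))
  rw [hx, norm_neg, norm_neg] at this
  exact absurd this (not_le.2 (max_lt hax h1))

lemma exists_gap {R R2 : ℝ} (h : R < R2) (p : K[X]) :
    ∃ t, R < t ∧ t < R2 ∧ ∀ a ∈ p.roots, ‖a‖ < t → ‖a‖ ≤ R := by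
  have h1 : ∀ᶠ t in 𝓝[>] R, ∀ a ∈ p.roots.toFinset, ‖a‖ < t → ‖a‖ ≤ R := by
    rw [Finset.eventually_all]
    intro a _
    rcases le_or_gt ‖a‖ R with h | h
    · exact Eventually.of_forall (fun t _ => h)
    · filter_upwards [nhdsWithin_le_nhds (gt_mem_nhds h)] with t ht h'
      exact absurd h' (not_lt.2 (le_of_lt ht))
  have h5 : ∀ᶠ t in 𝓝[>] R, t < R2 := nhdsWithin_le_nhds (gt_mem_nhds h)
  have h6 : ∀ᶠ t in 𝓝[>] R, R < t := self_mem_nhdsWithin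
  obtain ⟨t, h2, h3, h4⟩ := (h1.and (h5.and h6)).exists
  exact ⟨t, h4, h3, fun a ha => h2 a (Multiset.mem_toFinset.2 ha)⟩

lemma count_eq {c : K} {R t l : ℝ} {k : ℕ} {q : K[X]} (hR : 0 < R) (ht : R < t) (hl : 0 < l)
    (h1 : dn c R q = l * R ^ k) (h2 : dn c t q = l * t ^ k)
    (hg : ∀ a ∈ q.roots, ‖c - a‖ < t → ‖c - a‖ ≤ R) : rcount (fun a => ‖c - a‖ < t) q = k := by
  have := dn_scale c ht.le q hg
  set n := rcount (fun a => ‖c - a‖ < t) q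
  rw [h1, h2] at this
  have ht0 : 0 < t := hR.trans ht
  have h3 : (t / R) ^ n = (t / R) ^ k := by
    rw [div_pow, div_pow, div_eq_div_iff (by positivity) (by positivity)]
    have : l * (t ^ n * R ^ k) = l * (t ^ k * R ^ n) := by linarith
    exact mul_left_cancel₀ hl.ne' this
  exact pow_right_injective₀ (by positivity) (by rw [ne_eq, div_eq_one_iff_eq hR.ne']; exact ht.ne') h3

/-- a disc on which the map is bad covers everything -/
lemma cov_of_bad {p q : K[X]} {α : K} {ρ : ℝ} (hρ : 0 < ρ) (h : DMaps p q α ρ α ρ) {y : K}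
    (hy : ‖y - α‖ ≤ ρ) (h1 : ‖q.eval y‖ < dn α ρ q)
    (h2 : ‖p.eval y - α * q.eval y‖ < ρ * dn α ρ q) (e0 e1 : K) (he : e0 ≠ 0 ∨ e1 ≠ 0) :
    ∃ x, ‖x - y‖ < ρ ∧ e1 * p.eval x = e0 * q.eval x := by
  have hN := dn_pos α hρ h.1
  suffices hs : ‖(C e1 * p - C e0 * q).eval y‖ < dn α ρ (C e1 * p - C e0 * q) by
    obtain ⟨x, hx, -, hx2⟩ := exists_root_of_lt hy hs
    refine ⟨x, hx2, ?_⟩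
    have : (C e1 * p - C e0 * q).eval x = 0 := hx
    simpa [sub_eq_zero] using this
  by_cases h0 : e1 = 0
  · subst h0
    have he0 : e0 ≠ 0 := by tauto
    simp only [map_zero, zero_mul, zero_sub, dn_neg, dn_C_mul, eval_neg, eval_mul, eval_C, norm_neg,
      norm_mul]
    exact mul_lt_mul_of_pos_left h1 (norm_pos_iff.2 he0)
  · have e : C e1 * p - C e0 * q = C e1 * (p - C (e0 / e1) * q) := by
      rw [mul_sub, ← mul_assoc, ← C_mul, mul_div_cancel₀ _ h0]
    rw [e, dn_C_mul, h.2, eval_mul, eval_C, norm_mul]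
    apply mul_lt_mul_of_pos_left _ (norm_pos_iff.2 h0)
    have e2 : (p - C (e0 / e1) * q).eval y = (p.eval y - α * q.eval y) + (α - e0 / e1) * q.eval y := by
      simp; ring
    rw [e2]
    refine (IsUltrametricDist.norm_add_le_max _ _).trans_lt (max_lt ?_ ?_)
    · exact h2.trans_le (mul_le_mul_of_nonneg_right (le_max_left _ _) hN.le)
    · rw [norm_mul]
      by_cases h3 : α - e0 / e1 = 0
      · rw [h3, norm_zero, zero_mul]; positivity
      · calc _ < ‖α - e0 / e1‖ * dn α ρ q := mul_lt_mul_of_pos_left h1 (norm_pos_iff.2 h3)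
          _ ≤ _ := mul_le_mul_of_nonneg_right (le_max_right _ _) hN.le

/-- first crossing, in the case the map is close to the identity. -/
lemma first_crossing {p q : K[X]} {α γ c0 : K} {ρ : ℝ} (hρ : 0 < ρ) (h : DMaps p q α ρ α ρ)
    (hid : dn α ρ (p - X * q) < ρ * dn α ρ q) (hc0 : ‖c0 - α‖ ≤ ρ) (hγ : ‖γ - α‖ ≤ ρ)
    (hcγ : ‖c0 - γ‖ = ρ) (hroot : p.eval c0 = γ * q.eval c0) (hq : q.eval c0 ≠ 0) :
    ∃ r, 0 < r ∧ r < ρ ∧ DMaps p q c0 r α ρ ∧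
      ∀ β, ‖β - γ‖ < ρ → ∃ x, ‖x - c0‖ < r ∧ p.eval x = β * q.eval x := by
  have c1 := dn_continuous c0 (p - C γ * q)
  have c2 : Continuous (fun s => ρ * dn c0 s q) := continuous_const.mul (dn_continuous c0 q)
  set E : Set ℝ := Set.Icc 0 ρ ∩ {s | ρ * dn c0 s q ≤ dn c0 s (p - C γ * q)} with hE
  have hcomp : IsCompact E := isCompact_Icc.inter_right (isClosed_le c2 c1)
  -- near ρ
  have hnear : ∃ s, 0 ≤ s ∧ s < ρ ∧ s ∈ E := by
    have c3 := dn_continuous c0 (p - X * q)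
    have hlt : dn c0 ρ (p - X * q) < ρ * dn c0 ρ q := by
      rw [dn_recenter hc0, dn_recenter hc0]; exact hid
    have hev : ∀ᶠ s in 𝓝[<] ρ, dn c0 s (p - X * q) < ρ * dn c0 s q :=
      nhdsWithin_le_nhds (c3.continuousAt.eventually_lt c2.continuousAt hlt)
    have h5 : ∀ᶠ s in 𝓝[<] ρ, s < ρ := self_mem_nhdsWithin
    have h6 : ∀ᶠ s in 𝓝[<] ρ, 0 < s := nhdsWithin_le_nhds (lt_mem_nhds hρ)
    obtain ⟨s, hs1, hs2, hs3⟩ := (hev.and (h5.and h6)).exists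
    refine ⟨s, hs3.le, hs2, ⟨hs3.le, hs2.le⟩, ?_⟩
    have e : p - C γ * q = (X - C γ) * q + (p - X * q) := by ring
    have e2 : dn c0 s ((X - C γ) * q) = ρ * dn c0 s q := by
      rw [dn_mul, dn_X_sub_C, hcγ, max_eq_right hs2.le]
    change ρ * dn c0 s q ≤ dn c0 s (p - C γ * q)
    rw [e, dn_add_eq c0 hs3 (by rw [e2]; exact hs1), e2]
  obtain ⟨s0, hs0, hs0ρ, hs0E⟩ := hnear
  have hg : IsLeast E (sInf E) := hcomp.isLeast_sInf ⟨s0, hs0E⟩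
  set r := sInf E with hr
  have hrρ : r < ρ := (hg.2 hs0E).trans_lt hs0ρ
  have hz : (p - C γ * q).eval c0 = 0 := by simp [hroot]
  have hr0 : 0 < r := by
    rcases hg.1.1.1.eq_or_lt with h0 | h0
    · exfalso
      have := hg.1.2
      simp only [Set.mem_ofPred_eq] at this
      rw [← h0, dn_zero_radius, dn_zero_radius, hz, norm_zero] at this
      have h3 := mul_pos hρ (norm_pos_iff.2 hq)
      linarith
    · exact h0
  have hbelow : ∀ s, 0 ≤ s → s < r → dn c0 s (p - C γ * q) < ρ * dn c0 s q := by
    intro s h1 h2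
    by_contra hcon
    push Not at hcon
    exact absurd (hg.2 (show s ∈ E from ⟨⟨h1, h2.le.trans hrρ.le⟩, hcon⟩)) (not_le.2 h2)
  have hev : ∀ᶠ s in 𝓝[<] r, dn c0 s (p - C γ * q) < ρ * dn c0 s q := by
    filter_upwards [self_mem_nhdsWithin, nhdsWithin_le_nhds (lt_mem_nhds hr0)] with s h1 h2
    exact hbelow s (le_of_lt h2) h1
  have heq : dn c0 r (p - C γ * q) = ρ * dn c0 r q := by
    apply le_antisymm _ hg.1.2
    exact le_of_tendsto_of_tendsto (c1.continuousAt.tendsto.mono_left nhdsWithin_le_nhds)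
      (c2.continuousAt.tendsto.mono_left nhdsWithin_le_nhds) (hev.mono (fun s hs => hs.le))
  have hm : DMaps p q c0 r γ ρ := DMaps.of_crossing h.1 hr0 heq
    ((hev.mono (fun s hs => hs.ne)).frequently.filter_mono nhdsWithin_le_nhds)
  refine ⟨r, hr0, hrρ, hm.recenter_target hγ, ?_⟩
  intro β hβ
  have hN := dn_pos c0 hr0 h.1
  have : ‖(p - C β * q).eval c0‖ < dn c0 r (p - C β * q) := by
    rw [hm.2, max_eq_left (by rw [norm_sub_rev]; exact hβ.le)]
    have e : (p - C β * q).eval c0 = -(β - γ) * q.eval c0 := by simp [hroot]; ring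
    rw [e, norm_mul, norm_neg]
    calc _ < ρ * ‖q.eval c0‖ := mul_lt_mul_of_pos_right hβ (norm_pos_iff.2 hq)
      _ ≤ _ := mul_le_mul_of_nonneg_left (norm_eval_le (by simpa using hr0.le) _) hρ.le
  obtain ⟨x, hx, -, hx2⟩ := exists_root_of_lt (by simpa using hr0.le) this
  refine ⟨x, hx2, ?_⟩
  have h3 : (p - C β * q).eval x = 0 := hx
  simpa [sub_eq_zero] using h3

end HelpersF

section HelpersG
set_option linter.unusedSectionVars false
variable {K : Type*} [NontriviallyNormedField K] [IsAlgClosed K] [IsUltrametricDist K]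

lemma mono_approx (β : K) {s : ℝ} (hs : 0 < s) {u : K[X]} (hu : u ≠ 0)
    (hno : ∀ a ∈ u.roots, ‖a - β‖ ≠ s) :
    ∃ c : K, ∃ n : ℕ, dn β s (u - C c * (X - C β) ^ n) < dn β s u := by
  have key : ∀ m : Multiset K, (∀ a ∈ m, ‖a - β‖ ≠ s) → ∃ c : K, ∃ n : ℕ,
      dn β s ((m.map (fun a => X - C a)).prod - C c * (X - C β) ^ n) <
        dn β s (m.map (fun a => X - C a)).prod := by
    intro m
    induction m using Multiset.induction_on with
    | empty =>
      intro _
      refine ⟨1, 0, ?_⟩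
      simp [dn_zero, dn_one]
    | cons a m ih =>
      intro h
      obtain ⟨c, n, hcn⟩ := ih (fun x hx => h x (Multiset.mem_cons_of_mem hx))
      have ha := h a (Multiset.mem_cons_self a m)
      rw [Multiset.map_cons, Multiset.prod_cons]
      set pr0 := (m.map (fun a => X - C a)).prod
      have hpos : 0 < dn β s pr0 := (dn_nonneg _ _ _).trans_lt hcn
      have hY : dn β s (X - C β) = s := by rw [dn_X_sub_C, sub_self, norm_zero, max_eq_left hs.le]
      rcases lt_or_gt_of_ne ha with h1 | h1
      · refine ⟨c, n + 1, ?_⟩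
        have e : (X - C a) * pr0 - C c * (X - C β) ^ (n + 1) =
          C (β - a) * pr0 + (X - C β) * (pr0 - C c * (X - C β) ^ n) := by rw [C_sub]; ring
        rw [norm_sub_rev] at h1
        rw [e, dn_mul, dn_X_sub_C, max_eq_left h1.le]
        refine (dn_add_le β hs _ _).trans_lt (max_lt ?_ ?_)
        · rw [dn_C_mul]; exact mul_lt_mul_of_pos_right h1 hpos
        · rw [dn_mul, hY]; exact mul_lt_mul_of_pos_left hcn hs
      · refine ⟨(β - a) * c, n, ?_⟩
        have e : (X - C a) * pr0 - C ((β - a) * c) * (X - C β) ^ n =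
          (X - C β) * pr0 + C (β - a) * (pr0 - C c * (X - C β) ^ n) := by
          rw [C_mul, C_sub]; ring
        rw [norm_sub_rev] at h1
        rw [e, dn_mul, dn_X_sub_C, max_eq_right h1.le]
        refine (dn_add_le β hs _ _).trans_lt (max_lt ?_ ?_)
        · rw [dn_mul, hY]; exact mul_lt_mul_of_pos_right h1 hpos
        · rw [dn_C_mul]; exact mul_lt_mul_of_pos_left hcn (hs.trans h1)
  obtain ⟨c, n, h⟩ := key u.roots hno
  have hl : 0 < ‖u.leadingCoeff‖ := norm_pos_iff.2 (leadingCoeff_ne_zero.2 hu)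
  refine ⟨u.leadingCoeff * c, n, ?_⟩
  have e1 := poly_split u
  set pr0 := (u.roots.map (fun a => X - C a)).prod
  have e2 : u - C (u.leadingCoeff * c) * (X - C β) ^ n =
      C u.leadingCoeff * (pr0 - C c * (X - C β) ^ n) := by
    conv_lhs => rw [e1]
    simp only [leadingCoeff_mul, leadingCoeff_C]
    rw [show (pr0).leadingCoeff = 1 from (monic_multisetProd_X_sub_C _)]
    rw [C_mul, C_mul]; simp only [map_one, mul_one]; ring
  have e3 : dn β s u = ‖u.leadingCoeff‖ * dn β s pr0 := by
    conv_lhs => rw [e1]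
    rw [dn_C_mul]
  rw [e2, e3, dn_C_mul]
  exact mul_lt_mul_of_pos_left h hl

lemma sphere_lemma {A B : K[X]} {b : K} {s : ℝ} (hs : 0 < s) {α γ1 γ2 : K} {ρ : ℝ} (hρ : 0 < ρ)
    (h : DMaps A B b s α ρ) (hγ1 : ‖α - γ1‖ ≤ ρ) (hγ2 : ‖α - γ2‖ ≤ ρ) (h12 : ‖γ1 - γ2‖ = ρ)
    {β : K} (hβ : ‖b - β‖ ≤ s) :
    ∃ a ∈ ((A - C γ1 * B) * (A - C γ2 * B) * B).roots, ‖a - β‖ = s := by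
  by_contra hcon
  push Not at hcon
  replace h := h.recenter_source hβ
  have hBpos := dn_pos β hs h.1
  have n1 : dn β s (A - C γ1 * B) = ρ * dn β s B := by rw [h.2, max_eq_left hγ1]
  have n2 : dn β s (A - C γ2 * B) = ρ * dn β s B := by rw [h.2, max_eq_left hγ2]
  have z1 : A - C γ1 * B ≠ 0 := ne_zero_of_dn_pos (c := β) (s := s) (by rw [n1]; positivity)
  have z2 : A - C γ2 * B ≠ 0 := ne_zero_of_dn_pos (c := β) (s := s) (by rw [n2]; positivity)
  have hr : ((A - C γ1 * B) * (A - C γ2 * B) * B).roots =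
      (A - C γ1 * B).roots + (A - C γ2 * B).roots + B.roots := by
    rw [roots_mul (mul_ne_zero (mul_ne_zero z1 z2) h.1), roots_mul (mul_ne_zero z1 z2)]
  simp only [hr, Multiset.mem_add] at hcon
  obtain ⟨c1, k1, a1⟩ := mono_approx β hs z1 (fun a ha => hcon a (by tauto))
  obtain ⟨c2, k2, a2⟩ := mono_approx β hs z2 (fun a ha => hcon a (by tauto))
  obtain ⟨c3, k3, a3⟩ := mono_approx β hs h.1 (fun a ha => hcon a (by tauto))
  set Y : K[X] := X - C β with hY
  have hc3 : c3 ≠ 0 := by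
    rintro rfl
    simp at a3
  have hm3 : dn β s (C c3 * Y ^ k3) = dn β s B := by
    have e : C c3 * Y ^ k3 = B + -(B - C c3 * Y ^ k3) := by ring
    rw [e]
    apply dn_add_eq β hs
    rw [dn_neg]; exact a3
  rw [n1] at a1
  rw [n2] at a2
  have hsY : dn β s Y = s := by rw [hY, dn_X_sub_C, sub_self, norm_zero, max_eq_left hs.le]
  -- equal exponents impossible
  have keyeq : ∀ γ c, ‖α - γ‖ ≤ ρ →
      dn β s ((A - C γ * B) - C c * Y ^ k3) < ρ * dn β s B → False := by
    intro γ c hγ hlt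
    have e : A - C (γ + c / c3) * B =
        ((A - C γ * B) - C c * Y ^ k3) - C (c / c3) * (B - C c3 * Y ^ k3) := by
      have : C c = C (c / c3) * C c3 := by rw [← C_mul, div_mul_cancel₀ _ hc3]
      rw [this, C_add]; ring
    have hm : dn β s (C c * Y ^ k3) = ‖c / c3‖ * dn β s B := by
      rw [← hm3, ← dn_C_mul, ← mul_assoc, ← C_mul, div_mul_cancel₀ _ hc3]
    have h4 : ‖c / c3‖ ≤ ρ := by
      have : dn β s (C c * Y ^ k3) ≤ ρ * dn β s B := by
        have e : C c * Y ^ k3 = (A - C γ * B) - ((A - C γ * B) - C c * Y ^ k3) := by ring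
        rw [e]
        refine (dn_sub_le β hs _ _).trans (max_le ?_ hlt.le)
        rw [h.2, max_eq_left hγ]
      rw [hm] at this
      exact le_of_mul_le_mul_right this hBpos
    have h2 : dn β s (A - C (γ + c / c3) * B) < ρ * dn β s B := by
      rw [e]
      refine (dn_sub_le β hs _ _).trans_lt (max_lt hlt ?_)
      rw [dn_C_mul]
      calc _ ≤ ρ * dn β s (B - C c3 * Y ^ k3) :=
            mul_le_mul_of_nonneg_right h4 (dn_nonneg _ _ _)
        _ < _ := mul_lt_mul_of_pos_left a3 hρ
    have h3 : ρ * dn β s B ≤ dn β s (A - C (γ + c / c3) * B) := by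
      rw [h.2]; exact mul_le_mul_of_nonneg_right (le_max_left _ _) hBpos.le
    linarith
  by_cases e1 : k1 = k3
  · exact keyeq γ1 c1 hγ1 (by rw [← e1]; exact a1)
  by_cases e2 : k2 = k3
  · exact keyeq γ2 c2 hγ2 (by rw [← e2]; exact a2)
  have hE : dn β s (C c1 * Y ^ k1 - C c2 * Y ^ k2 - C ((γ2 - γ1) * c3) * Y ^ k3) <
      ρ * dn β s B := by
    have e : C c1 * Y ^ k1 - C c2 * Y ^ k2 - C ((γ2 - γ1) * c3) * Y ^ k3 =
      (((A - C γ2 * B) - C c2 * Y ^ k2) - ((A - C γ1 * B) - C c1 * Y ^ k1)) +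
        C (γ2 - γ1) * (B - C c3 * Y ^ k3) := by
      rw [C_mul, C_sub]; ring
    rw [e]
    refine (dn_add_le β hs _ _).trans_lt (max_lt ?_ ?_)
    · exact (dn_sub_le β hs _ _).trans_lt (max_lt a2 a1)
    · rw [dn_C_mul, norm_sub_rev, h12]
      exact mul_lt_mul_of_pos_left a3 hρ
  have hco := dn_coeff_le β hs (C c1 * Y ^ k1 - C c2 * Y ^ k2 - C ((γ2 - γ1) * c3) * Y ^ k3) k3
  have ec : ((C c1 * Y ^ k1 - C c2 * Y ^ k2 - C ((γ2 - γ1) * c3) * Y ^ k3).comp (X + C β)).coeff k3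
      = -((γ2 - γ1) * c3) := by
    have : (C c1 * Y ^ k1 - C c2 * Y ^ k2 - C ((γ2 - γ1) * c3) * Y ^ k3).comp (X + C β) =
        C c1 * X ^ k1 - C c2 * X ^ k2 - C ((γ2 - γ1) * c3) * X ^ k3 := by
      simp [hY]
    rw [this]
    simp only [coeff_sub, coeff_C_mul_X_pow, if_neg (Ne.symm e1), if_neg (Ne.symm e2), if_true]
    ring
  rw [ec, norm_neg, norm_mul, norm_sub_rev, h12] at hco
  have h5 : dn β s B = ‖c3‖ * s ^ k3 := by rw [← hm3, dn_C_mul, dn_pow, hsY]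
  rw [h5] at hE
  linarith [hco.trans_lt hE]

/-- finitely many discs mapped onto a given one -/
lemma finite_discs {A B : K[X]} {α γ : K} {ρ : ℝ} (hρ : 0 < ρ) (h12 : ‖α - γ‖ = ρ) :
    ∃ Z : Finset (K × ℝ), ∀ b s, 0 < s → DMaps A B b s α ρ → ∃ z ∈ Z, z.2 = s ∧ ‖b - z.1‖ ≤ s := by
  set Rt := ((A - C α * B) * (A - C γ * B) * B).roots.toFinset with hRt
  refine ⟨(Rt ×ˢ Rt).image (fun z => (z.1, ‖z.2 - z.1‖)), ?_⟩
  intro b s hs h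
  obtain ⟨a, ha, hab⟩ := sphere_lemma hs hρ h (γ1 := α) (γ2 := γ) (by simpa using hρ.le) h12.le h12
    (β := b) (by simpa using hs.le)
  have hba : ‖b - a‖ ≤ s := by rw [norm_sub_rev]; exact hab.le
  obtain ⟨a', ha', hab'⟩ := sphere_lemma hs hρ h (γ1 := α) (γ2 := γ) (by simpa using hρ.le) h12.le h12
    (β := a) hba
  refine ⟨(a, ‖a' - a‖), ?_, hab', hba⟩
  rw [Finset.mem_image]
  exact ⟨(a, a'), by simp only [Finset.mem_product, hRt, Multiset.mem_toFinset]; exact ⟨ha, ha'⟩, rfl⟩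

/-- Nondegeneracy dichotomy. -/
lemma degenerate_lt {P Q A B : K[X]} {b : K} {s : ℝ} (hs : 0 < s) {α : K} {ρ : ℝ}
    (h : DMaps P Q b s α ρ)
    (hnd : dn b s (P * B - Q * A) ≠ dn b s Q * max (ρ * dn b s B) (dn b s (A - C α * B))) (hρ : 0 < ρ) :
    dn b s (P * B - Q * A) < ρ * dn b s Q * dn b s B := by
  have e : P * B - Q * A = (P - C α * Q) * B + -(Q * (A - C α * B)) := by ring
  have n1 : dn b s ((P - C α * Q) * B) = dn b s Q * (ρ * dn b s B) := by
    rw [dn_mul, h.2, sub_self, norm_zero, max_eq_left hρ.le]; ring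
  have n2 : dn b s (-(Q * (A - C α * B))) = dn b s Q * dn b s (A - C α * B) := by
    rw [dn_neg, dn_mul]
  have hQ := dn_pos b hs h.1
  have hle : dn b s (P * B - Q * A) ≤ dn b s Q * max (ρ * dn b s B) (dn b s (A - C α * B)) := by
    rw [e]
    refine (dn_add_le b hs _ _).trans ?_
    rw [n1, n2, mul_max_of_nonneg _ _ hQ.le]
  by_cases heq : ρ * dn b s B = dn b s (A - C α * B)
  · rw [← heq, max_self] at hle hnd
    have := lt_of_le_of_ne hle hnd
    linarith
  · exfalso
    apply hnd
    rw [e, dn_add_eq_max b hs, n1, n2, mul_max_of_nonneg _ _ hQ.le]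
    rw [n1, n2]
    intro h'
    exact heq (mul_left_cancel₀ hQ.ne' h')

lemma degenerate_dmaps {P Q A B : K[X]} {b : K} {s : ℝ} (hs : 0 < s) {α : K} {ρ : ℝ}
    (h : DMaps P Q b s α ρ) (hB : B ≠ 0)
    (hlt : dn b s (P * B - Q * A) < ρ * dn b s Q * dn b s B) : DMaps A B b s α ρ := by
  refine ⟨hB, fun a' => ?_⟩
  have hQ := dn_pos b hs h.1
  have hBp := dn_pos b hs hB
  have e : Q * (A - C a' * B) = (P - C a' * Q) * B + -(P * B - Q * A) := by ring
  have n1 : dn b s ((P - C a' * Q) * B) = max ρ ‖α - a'‖ * dn b s Q * dn b s B := by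
    rw [dn_mul, h.2]
  have n2 : dn b s (Q * (A - C a' * B)) = max ρ ‖α - a'‖ * dn b s Q * dn b s B := by
    rw [e, ← n1]
    apply dn_add_eq b hs
    rw [dn_neg, n1]
    refine hlt.trans_le ?_
    gcongr
    exact le_max_left _ _
  rw [dn_mul] at n2
  apply mul_left_cancel₀ hQ.ne'
  rw [n2]; ring

/-- Two degenerate times give an iterate close to the identity. -/
lemma degenerate_two {P Q A B : K[X]} {b : K} {s : ℝ} (hs : 0 < s) {α : K} {ρ : ℝ} (hρ : 0 < ρ)
    (h : DMaps P Q b s α ρ) (hB : B ≠ 0) {M : ℕ} {u v : K[X]} (hu : u.natDegree ≤ M)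
    (hv : v.natDegree ≤ M) (hv0 : v ≠ 0)
    (h1 : dn b s (P * B - Q * A) < ρ * dn b s Q * dn b s B)
    (h2 : dn b s (hev M u P Q * B - hev M v P Q * A) < ρ * dn b s (hev M v P Q) * dn b s B) :
    dn α ρ (u - X * v) < ρ * dn α ρ v := by
  have hQ := dn_pos b hs h.1
  have hBp := dn_pos b hs hB
  have e : (hev M u P Q * Q - P * hev M v P Q) = hev (M + 1) (u - X * v) P Q := by
    rw [hev_sub, show (X * v : K[X]) = v * X from mul_comm _ _, hev_mul hv natDegree_X_le, hev_X,
      show u = u * 1 from (mul_one u).symm, hev_mul hu (by simp), hev_one]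
    simp; ring
  have hn := h.dn_hev (D := M + 1) (φ := u - X * v) (by
    refine (natDegree_sub_le _ _).trans (max_le (by omega) ?_)
    refine natDegree_mul_le.trans ?_
    have := natDegree_X_le (R := K)
    omega)
  have hn' := h.dn_hev hv
  have hv' := dn_pos α hρ hv0
  rw [← e] at hn
  have e2 : (hev M u P Q * Q - P * hev M v P Q) * B =
      (hev M u P Q * B - hev M v P Q * A) * Q - (P * B - Q * A) * hev M v P Q := by ring
  have h3 : dn b s ((hev M u P Q * Q - P * hev M v P Q) * B) <
      ρ * dn b s Q * dn b s (hev M v P Q) * dn b s B := by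
    rw [e2]
    refine (dn_sub_le b hs _ _).trans_lt (max_lt ?_ ?_)
    · rw [dn_mul]
      calc _ < ρ * dn b s (hev M v P Q) * dn b s B * dn b s Q := mul_lt_mul_of_pos_right h2 hQ
        _ = _ := by ring
    · rw [dn_mul]
      have : 0 < dn b s (hev M v P Q) := by rw [hn']; positivity
      calc _ < ρ * dn b s Q * dn b s B * dn b s (hev M v P Q) := mul_lt_mul_of_pos_right h1 this
        _ = _ := by ring
  rw [dn_mul, hn, hn'] at h3
  have h4 := lt_of_mul_lt_mul_right h3 hBp.le
  rw [pow_succ] at h4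
  have h5 : dn α ρ (u - X * v) * (dn b s Q ^ M * dn b s Q) <
      (ρ * dn α ρ v) * (dn b s Q ^ M * dn b s Q) := by linarith
  exact lt_of_mul_lt_mul_right h5 (by positivity)

/-- Abstract rigidity: a map with homogeneous iterate is homogeneous. -/
lemma rigid {T : Type*} (F : T → T) (a : T → ℝ) {d per : ℕ} (hd : 2 ≤ d) (hper : 1 ≤ per)
    {c L : ℝ} (h1 : ∀ Y, a (F^[per] Y) = c + (d : ℝ) ^ per * a Y)
    (h2 : ∀ Y, a (F Y) - d * a Y ≤ L) : ∃ l, ∀ Y, a (F Y) = d * a Y + l := by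
  set N : ℝ := (d : ℝ) ^ per with hN
  have hd' : (2 : ℝ) ≤ d := by exact_mod_cast hd
  have hN2 : 2 ≤ N := by
    calc (2 : ℝ) ≤ d := hd'
      _ = (d : ℝ) ^ 1 := (pow_one _).symm
      _ ≤ N := pow_le_pow_right₀ (by linarith) hper
  set l : ℝ := (d - 1) * c / (N - 1) with hl
  have hlN : l * (N - 1) = (d - 1) * c := by
    rw [hl]; field_simp [show N - 1 ≠ 0 by linarith]
  set φ : T → ℝ := fun Y => a (F Y) - d * a Y - l with hφ
  have hmul : ∀ Y, φ (F^[per] Y) = N * φ Y := by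
    intro Y
    simp only [hφ]
    rw [← Function.iterate_succ_apply' F per Y, Function.iterate_succ_apply, h1, h1]
    linarith
  have hmulk : ∀ k Y, φ ((F^[per])^[k] Y) = N ^ k * φ Y := by
    intro k
    induction k with
    | zero => intro Y; simp
    | succ k ih => intro Y; rw [Function.iterate_succ_apply, ih, hmul]; ring
  have hle : ∀ Y, φ Y ≤ 0 := by
    intro Y
    by_contra hcon
    push Not at hcon
    have ht : Tendsto (fun k : ℕ => N ^ k * φ Y) atTop atTop :=
      (tendsto_pow_atTop_atTop_of_one_lt (by linarith)).atTop_mul_const hcon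
    obtain ⟨k, hk⟩ := (ht.eventually (eventually_gt_atTop (L - l))).exists
    rw [← hmulk] at hk
    have := h2 ((F^[per])^[k] Y)
    simp only [hφ] at hk
    linarith
  -- telescoping
  have htel : ∀ n Y, a (F^[n] Y) ≤ (d : ℝ) ^ n * a Y + l * (((d : ℝ) ^ n - 1) / (d - 1)) := by
    intro n
    induction n with
    | zero => intro Y; simp
    | succ n ih =>
      intro Y
      rw [Function.iterate_succ_apply']
      have h3 := hle (F^[n] Y)
      simp only [hφ] at h3
      have h4 := ih Y
      have h5 : a (F (F^[n] Y)) ≤ d * ((d : ℝ) ^ n * a Y + l * (((d : ℝ) ^ n - 1) / (d - 1))) + l := by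
        nlinarith
      refine h5.trans (le_of_eq ?_)
      have : (d : ℝ) - 1 ≠ 0 := by linarith
      field_simp
      ring
  refine ⟨l, fun Y => ?_⟩
  obtain ⟨m, rfl⟩ : ∃ m, per = m + 1 := ⟨per - 1, by omega⟩
  have h3 := htel m (F Y)
  rw [← Function.iterate_succ_apply, h1] at h3
  have h4 := hle Y
  simp only [hφ] at h4
  have hd1 : (d : ℝ) - 1 ≠ 0 := by linarith
  have h5 : c = l * (N - 1) / (d - 1) := by rw [hlN]; field_simp
  have h6 : 0 < (d : ℝ) ^ m := by positivity
  have h7 : l * (N - 1) / (d - 1) - l * (((d : ℝ) ^ m - 1) / (d - 1)) = (d : ℝ) ^ m * l := by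
    rw [hN, pow_succ]; field_simp; ring
  have h8 : (d : ℝ) ^ m * (d * a Y + l) ≤ (d : ℝ) ^ m * a (F Y) := by
    have : N = (d : ℝ) ^ m * d := by rw [hN, pow_succ]
    rw [this] at h3
    rw [h5] at h3
    rw [this] at h3 h7
    nlinarith
  have h9 := le_of_mul_le_mul_left h8 h6
  linarith

end HelpersG

section HelpersH
set_option linter.unusedSectionVars false
variable {K : Type*} [NontriviallyNormedField K] [IsAlgClosed K] [IsUltrametricDist K]

lemma roots_bound (p : K[X]) : ∃ T : ℝ, ∀ a ∈ p.roots, ‖a‖ < T := by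
  obtain ⟨T, hT⟩ := (p.roots.toFinset.image (fun a => ‖a‖)).bddAbove
  refine ⟨T + 1, fun a ha => ?_⟩
  have : ‖a‖ ≤ T := hT (by simpa using ⟨a, by simpa using ha, rfl⟩)
  linarith

/-- frame at infinity for the pair (A,B) -/
structure Frame (A B : K[X]) (S κ : ℝ) (k : ℕ) : Prop where
  hB : B ≠ 0
  hS1 : 1 < S
  hκ : 0 < κ
  hk : 1 ≤ k
  hκ1 : 1 ≤ κ * S ^ k
  hA : ∀ s, S ≤ s → dn 0 s A = κ * s ^ k * dn 0 s B
  hx : ∀ x : K, S < ‖x‖ → A.eval x ≠ 0 ∧ ‖A.eval x‖ = κ * ‖x‖ ^ k * ‖B.eval x‖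

lemma exists_frame {A B : K[X]} (hA0 : A ≠ 0) (hB0 : B ≠ 0) (hdeg : B.natDegree < A.natDegree) :
    ∃ S κ k, Frame A B S κ k := by
  obtain ⟨T1, hT1⟩ := roots_bound A
  obtain ⟨T2, hT2⟩ := roots_bound B
  have hla : 0 < ‖A.leadingCoeff‖ := by simpa using hA0
  have hlb : 0 < ‖B.leadingCoeff‖ := by simpa using hB0
  set κ := ‖A.leadingCoeff‖ / ‖B.leadingCoeff‖ with hκ
  have hκp : 0 < κ := by positivity
  set k := A.natDegree - B.natDegree with hk
  have hk1 : 1 ≤ k := by omega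
  have hk2 : A.natDegree = k + B.natDegree := by omega
  set S := max (max T1 T2) (max 2 κ⁻¹) with hS
  have hS2 : 2 ≤ S := le_trans (le_max_left _ _) (le_max_right _ _)
  have hS3 : κ⁻¹ ≤ S := le_trans (le_max_right _ _) (le_max_right _ _)
  have hST1 : T1 ≤ S := le_trans (le_max_left _ _) (le_max_left _ _)
  have hST2 : T2 ≤ S := le_trans (le_max_right _ _) (le_max_left _ _)
  refine ⟨S, κ, k, hB0, by linarith, hκp, hk1, ?_, ?_, ?_⟩
  · have : S ≤ S ^ k := le_self_pow₀ (by linarith) (by omega)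
    calc (1:ℝ) = κ * κ⁻¹ := by field_simp
      _ ≤ κ * S ^ k := by gcongr; linarith
  · intro s hs
    rw [full_conv (p := A) 0 (fun β hβ => by rw [zero_sub, norm_neg]; linarith [hT1 β hβ]),
      full_conv (p := B) 0 (fun β hβ => by rw [zero_sub, norm_neg]; linarith [hT2 β hβ]), hk2, pow_add, hκ]
    field_simp
  · intro x hx
    have e1 := full_conv_eval (p := A) (x := x) 0 (s := ‖x‖) (by simp)
      (fun β hβ => by rw [zero_sub, norm_neg]; linarith [hT1 β hβ])
    have e2 := full_conv_eval (p := B) (x := x) 0 (s := ‖x‖) (by simp)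
      (fun β hβ => by rw [zero_sub, norm_neg]; linarith [hT2 β hβ])
    have hxp : 0 < ‖x‖ := by linarith
    constructor
    · rw [← norm_ne_zero_iff, e1]; positivity
    · rw [e1, e2, hk2, pow_add, hκ]; field_simp

variable {A B : K[X]} {S κ : ℝ} {k : ℕ}

lemma Frame.lt (F : Frame A B S κ k) {s t : ℝ} (hs : S ≤ s) (h : s < t) : κ * s ^ k < κ * t ^ k := by
  have := F.hκ; have := F.hS1
  have hk := F.hk
  have : s ^ k < t ^ k := pow_lt_pow_left₀ h (by linarith) (by omega)
  gcongr

lemma Frame.le (F : Frame A B S κ k) {s t : ℝ} (hs : S ≤ s) (h : s ≤ t) : κ * s ^ k ≤ κ * t ^ k := by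
  have := F.hκ; have := F.hS1
  have : s ^ k ≤ t ^ k := pow_le_pow_left₀ (by linarith) h _
  gcongr

lemma Frame.dmaps (F : Frame A B S κ k) {s : ℝ} (hs : S ≤ s) : DMaps A B 0 s 0 (κ * s ^ k) := by
  have := F.hS1
  refine DMaps.of_crossing F.hB (by linarith) ?_ ?_
  · simpa using F.hA s hs
  · have h1 : ∃ᶠ t in 𝓝[>] s, dn 0 t (A - C 0 * B) ≠ κ * s ^ k * dn 0 t B := by
      apply Eventually.frequently
      filter_upwards [self_mem_nhdsWithin] with t ht
      have ht : s < t := ht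
      rw [map_zero, zero_mul, sub_zero, F.hA t (by linarith)]
      have := dn_pos 0 (show 0 < t by linarith) F.hB
      have h3 := F.lt hs ht
      intro h
      have := mul_right_cancel₀ this.ne' h
      linarith
    exact h1.filter_mono nhdsWithin_le_nhds

lemma pt_to_dn {P Q A B : K[X]} {δ : ℝ}
    (hpt : ∀ x : K, 1 ≤ ‖x‖ → ‖(P * B - Q * A).eval x‖ ≤
      δ * max ‖P.eval x‖ ‖Q.eval x‖ * max ‖A.eval x‖ ‖B.eval x‖) (hδ : 0 ≤ δ) {s : ℝ} (hs : 1 ≤ s) :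
    dn 0 s (P * B - Q * A) ≤ δ * max (dn 0 s P) (dn 0 s Q) * max (dn 0 s A) (dn 0 s B) := by
  by_contra hcon
  push Not at hcon
  have c1 : Continuous (fun s => dn 0 s (P * B - Q * A)) := dn_continuous _ _
  have c2 : Continuous (fun s => δ * max (dn 0 s P) (dn 0 s Q) * max (dn 0 s A) (dn 0 s B)) :=
    (continuous_const.mul ((dn_continuous 0 P).max (dn_continuous 0 Q))).mul
      ((dn_continuous 0 A).max (dn_continuous 0 B))
  have h : ∀ᶠ t in 𝓝 s, δ * max (dn 0 t P) (dn 0 t Q) * max (dn 0 t A) (dn 0 t B) <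
      dn 0 t (P * B - Q * A) := c2.continuousAt.eventually_lt c1.continuousAt hcon
  obtain ⟨e, he, h⟩ := Metric.eventually_nhds_iff.1 h
  obtain ⟨w, hw1, hw2⟩ := exists_norm_between (K := K) (show 0 < s by linarith) (show s < s + e by linarith)
  have hw0 : w ≠ 0 := by rw [← norm_pos_iff]; linarith
  obtain ⟨x, hx, hxe⟩ := exists_generic 0 hw0 rfl (P * B - Q * A)
  have h2 := h (y := ‖w‖) (by rw [Real.dist_eq, abs_lt]; constructor <;> linarith)
  rw [← hxe] at h2
  have hxn : ‖x‖ = ‖w‖ := by simpa using hx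
  have h3 := hpt x (by linarith)
  have m : ∀ p : K[X], ‖p.eval x‖ ≤ dn 0 ‖w‖ p := fun p => norm_eval_le hx.le p
  have h4 : δ * max ‖P.eval x‖ ‖Q.eval x‖ * max ‖A.eval x‖ ‖B.eval x‖ ≤
    δ * max (dn 0 ‖w‖ P) (dn 0 ‖w‖ Q) * max (dn 0 ‖w‖ A) (dn 0 ‖w‖ B) := by
    have := dn_nonneg 0 ‖w‖ P
    have hm : 0 ≤ max (dn 0 ‖w‖ P) (dn 0 ‖w‖ Q) := this.trans (le_max_left _ _)
    gcongr <;> apply m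
  linarith

/-- Step 0, norms. -/
lemma Frame.close (F : Frame A B S κ k) {P Q : K[X]} {S2 δ : ℝ} (hδ : 0 ≤ δ)
    (hδ2 : δ * (κ * S2 ^ k) ^ 2 < 1) (hPQ : P ≠ 0 ∨ Q ≠ 0)
    (hpt : ∀ x : K, 1 ≤ ‖x‖ → ‖(P * B - Q * A).eval x‖ ≤
      δ * max ‖P.eval x‖ ‖Q.eval x‖ * max ‖A.eval x‖ ‖B.eval x‖) {s : ℝ} (hs : S ≤ s) (hs2 : s ≤ S2) :
    DMaps P Q 0 s 0 (κ * s ^ k) ∧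
      dn 0 s (P * B - Q * A) ≤ δ * (κ * S2 ^ k) ^ 2 * (dn 0 s Q * dn 0 s B) := by
  have hS1 := F.hS1
  have hsp : 0 < s := by linarith
  set R := κ * s ^ k with hR
  set R2 := κ * S2 ^ k
  have hR1 : 1 ≤ R := F.hκ1.trans (F.le le_rfl hs)
  have hRR2 : R ≤ R2 := F.le hs hs2
  have hNB := dn_pos 0 hsp F.hB
  have hNA : dn 0 s A = R * dn 0 s B := F.hA s hs
  have h0 := pt_to_dn hpt hδ (s := s) (by linarith)
  rw [hNA, max_eq_left (a := R * dn 0 s B) (by nlinarith)] at h0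
  have hNP0 := dn_nonneg 0 s P
  have hNQ0 := dn_nonneg 0 s Q
  set NP := dn 0 s P with hNP
  set NQ := dn 0 s Q with hNQ
  set NB := dn 0 s B
  set NR := dn 0 s (P * B - Q * A) with hNR
  have hδR : δ * R < 1 := by
    calc δ * R ≤ δ * R2 ^ 2 := by gcongr; nlinarith
      _ < 1 := hδ2
  have hPQ' : NP ≤ R * NQ := by
    have e : P * B = Q * A + (P * B - Q * A) := by ring
    have h1 : NP * NB ≤ max (NQ * (R * NB)) NR := by
      have := dn_add_le 0 hsp (Q * A) (P * B - Q * A)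
      rw [← e, dn_mul, dn_mul, hNA] at this
      exact this
    rcases le_max_iff.1 h1 with h | h
    · have : NP * NB ≤ (R * NQ) * NB := by linarith
      exact le_of_mul_le_mul_right this hNB
    · have h3 : NP * NB ≤ (δ * R * max NP NQ) * NB := by linarith
      have h3 := le_of_mul_le_mul_right h3 hNB
      rcases le_total NP NQ with h4 | h4
      · nlinarith
      · rw [max_eq_left h4] at h3
        have : NP ≤ 0 := by
          by_contra hh
          push Not at hh
          nlinarith
        nlinarith
  have hQ0 : Q ≠ 0 := by
    rintro rfl
    have h1 : NQ = 0 := dn_zero _ _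
    rw [h1] at hPQ'
    rcases hPQ with h | h
    · have := dn_pos 0 hsp h
      linarith
    · exact h rfl
  have hNQp : 0 < NQ := dn_pos 0 hsp hQ0
  have hNR2 : NR ≤ δ * R2 ^ 2 * (NQ * NB) := by
    have hm : max NP NQ ≤ R * NQ := max_le hPQ' (by nlinarith)
    calc NR ≤ δ * max NP NQ * (R * NB) := h0
      _ ≤ δ * (R * NQ) * (R * NB) := by gcongr
      _ = δ * R ^ 2 * (NQ * NB) := by ring
      _ ≤ δ * R2 ^ 2 * (NQ * NB) := by gcongr
  refine ⟨⟨hQ0, fun a' => ?_⟩, hNR2⟩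
  have hD := (F.dmaps hs).2 a'
  have e : (P - C a' * Q) * B = (A - C a' * B) * Q + (P * B - Q * A) := by ring
  have h5 : dn 0 s ((P - C a' * Q) * B) = dn 0 s ((A - C a' * B) * Q) := by
    rw [e]
    apply dn_add_eq 0 hsp
    rw [dn_mul, hD]
    have : 1 ≤ max R ‖0 - a'‖ := hR1.trans (le_max_left _ _)
    calc NR ≤ δ * R2 ^ 2 * (NQ * NB) := hNR2
      _ < 1 * (NQ * NB) := by gcongr
      _ ≤ max R ‖0 - a'‖ * (NQ * NB) := by gcongr
      _ = _ := by ring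
  rw [dn_mul, dn_mul, hD] at h5
  apply mul_right_cancel₀ hNB.ne'
  linarith

/-- Step 0, roots. -/
lemma Frame.pw (F : Frame A B S κ k) {P Q : K[X]} {δ : ℝ} {E : ℕ} (hδ : 0 ≤ δ)
    (hδ2 : δ * (κ * S ^ k) < 1) (hP : P.natDegree ≤ E) (hQ : Q.natDegree ≤ E)
    (hnv : ∀ x, P.eval x ≠ 0 ∨ Q.eval x ≠ 0) (hnv' : P.coeff E ≠ 0 ∨ Q.coeff E ≠ 0)
    (hpt : ∀ x : K, 1 ≤ ‖x‖ → ‖(P * B - Q * A).eval x‖ ≤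
      δ * max ‖P.eval x‖ ‖Q.eval x‖ * max ‖A.eval x‖ ‖B.eval x‖) {γ : K} (hγ : ‖γ‖ ≤ κ * S ^ k) :
    (P - C γ * Q).natDegree = E ∧ ∀ x ∈ (P - C γ * Q).roots, ‖x‖ ≤ S := by
  have hS1 := F.hS1
  set R := κ * S ^ k with hR
  have hR1 : 1 ≤ R := F.hκ1
  constructor
  · have hle : (P - C γ * Q).natDegree ≤ E :=
      (natDegree_sub_le _ _).trans (max_le hP ((natDegree_C_mul_le _ _).trans hQ))
    by_contra hne
    have hlt : (P - C γ * Q).natDegree < E := lt_of_le_of_ne hle hne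
    have hc : (P - C γ * Q).coeff E = 0 := coeff_eq_zero_of_natDegree_lt hlt
    rw [coeff_sub, coeff_C_mul, sub_eq_zero] at hc
    have hQc : Q.coeff E ≠ 0 := by
      rcases hnv' with h | h
      · intro h0; rw [h0, mul_zero] at hc; exact h hc
      · exact h
    have hQ0 : Q ≠ 0 := by rintro rfl; simp at hQc
    have hQd : Q.natDegree = E := le_antisymm hQ (le_natDegree_of_ne_zero hQc)
    set W := P - C γ * Q with hW
    obtain ⟨T1, hT1⟩ := roots_bound W
    obtain ⟨T2, hT2⟩ := roots_bound Q
    have hlq : 0 < ‖Q.leadingCoeff‖ := by simpa using hQ0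
    set s := max (max T1 T2) (max (S + 1) (‖W.leadingCoeff‖ / ‖Q.leadingCoeff‖)) with hs
    have a1 : T1 ≤ s := le_trans (le_max_left _ _) (le_max_left _ _)
    have a2 : T2 ≤ s := le_trans (le_max_right _ _) (le_max_left _ _)
    have a3 : S + 1 ≤ s := le_trans (le_max_left _ _) (le_max_right _ _)
    have a4 : ‖W.leadingCoeff‖ / ‖Q.leadingCoeff‖ ≤ s := le_trans (le_max_right _ _) (le_max_right _ _)
    have hsp : 0 < s := by linarith
    have nW := full_conv (p := W) (s := s) 0 (fun β hβ => by rw [zero_sub, norm_neg]; linarith [hT1 β hβ])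
    have nQ := full_conv (p := Q) (s := s) 0 (fun β hβ => by rw [zero_sub, norm_neg]; linarith [hT2 β hβ])
    have hWQ : dn 0 s W ≤ dn 0 s Q := by
      rw [nW, nQ, hQd]
      rw [div_le_iff₀ hlq] at a4
      calc ‖W.leadingCoeff‖ * s ^ W.natDegree ≤ (s * ‖Q.leadingCoeff‖) * s ^ (E - 1) := by
            gcongr
            · linarith
            · omega
        _ = ‖Q.leadingCoeff‖ * (s ^ (E - 1) * s) := by ring
        _ = _ := by rw [← pow_succ]; congr 2; omega
    have h0 := pt_to_dn hpt hδ (s := s) (by linarith)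
    have hNB := dn_pos 0 hsp F.hB
    have hNA := F.hA s (by linarith)
    have hRs : R < κ * s ^ k := F.lt le_rfl (by linarith)
    set R' := κ * s ^ k with hR'
    have hNQ := dn_pos 0 hsp hQ0
    have hNP : dn 0 s P ≤ R * dn 0 s Q := by
      have e : P = W + C γ * Q := by rw [hW]; ring
      rw [e]
      refine (dn_add_le 0 hsp _ _).trans (max_le ?_ ?_)
      · nlinarith
      · rw [dn_C_mul]; gcongr
    rw [hNA, max_eq_left (a := R' * dn 0 s B) (by nlinarith)] at h0
    have hm : max (dn 0 s P) (dn 0 s Q) ≤ R * dn 0 s Q := max_le hNP (by nlinarith)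
    have hD := (F.dmaps (s := s) (by linarith)).2 γ
    rw [← hR', max_eq_left (by rw [zero_sub, norm_neg]; linarith)] at hD
    have e : P * B - Q * A = -(Q * (A - C γ * B)) + W * B := by rw [hW]; ring
    have h6 : dn 0 s (P * B - Q * A) = dn 0 s Q * (R' * dn 0 s B) := by
      rw [e, dn_add_eq 0 hsp, dn_neg, dn_mul, hD]
      rw [dn_neg, dn_mul, dn_mul, hD]
      have : 0 < dn 0 s Q * dn 0 s B := by positivity
      calc dn 0 s W * dn 0 s B ≤ dn 0 s Q * dn 0 s B := by gcongr
        _ < dn 0 s Q * (R' * dn 0 s B) := by nlinarith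
    have h7 : dn 0 s (P * B - Q * A) ≤ δ * (R * dn 0 s Q) * (R' * dn 0 s B) := by
      refine h0.trans ?_
      have : 0 < R' * dn 0 s B := by nlinarith
      gcongr
    have : 0 < dn 0 s Q * (R' * dn 0 s B) := by
      have : 0 < R' := by linarith
      positivity
    rw [h6] at h7
    nlinarith
  · intro x hx
    by_contra hcon
    push Not at hcon
    obtain ⟨hA0, hAn⟩ := F.hx x hcon
    have hr : P.eval x = γ * Q.eval x := by
      have := (mem_roots'.1 hx).2
      simpa [IsRoot, sub_eq_zero] using this
    have hQx : Q.eval x ≠ 0 := by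
      rcases hnv x with h | h
      · intro h0; rw [h0, mul_zero] at hr; exact h hr
      · exact h
    have hRs : R < κ * ‖x‖ ^ k := F.lt le_rfl hcon
    have h0 := hpt x (by linarith)
    have hBx : ‖B.eval x‖ ≤ ‖A.eval x‖ := by
      rw [hAn]; nlinarith [norm_nonneg (B.eval x)]
    have e : (P * B - Q * A).eval x = Q.eval x * (γ * B.eval x - A.eval x) := by
      simp [hr]; ring
    have hAp : 0 < ‖A.eval x‖ := by simpa using hA0
    have hQp : 0 < ‖Q.eval x‖ := by simpa using hQx
    have hBp : 0 < ‖B.eval x‖ := by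
      rcases (norm_nonneg (B.eval x)).eq_or_lt with h | h
      · rw [← h] at hAn; simp at hAn; exact absurd hAn hA0
      · exact h
    have h1 : ‖γ * B.eval x - A.eval x‖ = ‖A.eval x‖ := by
      have hlt : ‖γ * B.eval x‖ < ‖A.eval x‖ := by
        rw [norm_mul, hAn]
        have := hγ.trans_lt hRs
        gcongr
      rw [sub_eq_add_neg, IsUltrametricDist.norm_add_eq_max_of_norm_ne_norm
        (by rw [norm_neg]; exact hlt.ne), norm_neg, max_eq_right hlt.le]
    rw [e, norm_mul, h1, max_eq_left hBx, hr, norm_mul] at h0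
    have hm : max (‖γ‖ * ‖Q.eval x‖) ‖Q.eval x‖ ≤ R * ‖Q.eval x‖ :=
      max_le (by gcongr) (by nlinarith)
    have h2 : ‖Q.eval x‖ * ‖A.eval x‖ ≤ δ * (R * ‖Q.eval x‖) * ‖A.eval x‖ := h0.trans (by gcongr)
    have : 0 < ‖Q.eval x‖ * ‖A.eval x‖ := by positivity
    nlinarith

end HelpersH

section HelpersI
set_option linter.unusedSectionVars false
variable {K : Type*} [NontriviallyNormedField K] [IsAlgClosed K] [IsUltrametricDist K]

lemma roots_norm_of_eq {P : K[X]} {S s : ℝ} (h : ∀ x ∈ P.roots, ‖x‖ ≤ S) (hs : S ≤ s) :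
    dn 0 s P = ‖P.leadingCoeff‖ * s ^ P.natDegree :=
  full_conv 0 (fun β hβ => by rw [zero_sub, norm_neg]; exact (h β hβ).trans hs)

lemma step1 {P Q p q : K[X]} {N E : ℕ} {S S2 κ : ℝ} {k : ℕ} (hS : 0 < S) (hS2 : S < S2) (hκ : 0 < κ)
    (hk : 1 ≤ k) (hp : p.natDegree ≤ N) (hq : q.natDegree ≤ N) (hE : P ≠ 0)
    (hD1 : ∀ s, S ≤ s → s ≤ S2 → DMaps P Q 0 s 0 (κ * s ^ k))
    (hD2 : ∀ s, S ≤ s → s ≤ S2 → DMaps (hev N p P Q) (hev N q P Q) 0 s 0 (κ * s ^ k))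
    (hP : P.natDegree = E ∧ ∀ x ∈ P.roots, ‖x‖ ≤ S)
    (hP' : ∀ γ : K, ‖γ‖ ≤ κ * S ^ k → (hev N p P Q - C γ * hev N q P Q).natDegree = E * N ∧
      ∀ x ∈ (hev N p P Q - C γ * hev N q P Q).roots, ‖x‖ ≤ S) :
    (∀ t, κ * S ^ k ≤ t → t ≤ κ * S2 ^ k → DMaps p q 0 t 0 t) ∧
    (∀ γ : K, ‖γ‖ ≤ κ * S ^ k → (p - C γ * q).natDegree = N ∧
      ∀ x ∈ (p - C γ * q).roots, ‖x‖ ≤ κ * S ^ k) := by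
  have hD : ∀ s, S ≤ s → s ≤ S2 → DMaps p q 0 (κ * s ^ k) 0 (κ * s ^ k) := fun s h1 h2 =>
    (hD1 s h1 h2).of_comp (by linarith) hp hq (hD2 s h1 h2)
  constructor
  · intro t h1 h2
    have hc : ContinuousOn (fun s : ℝ => κ * s ^ k) (Set.Icc S S2) := by fun_prop
    obtain ⟨s, hs, rfl⟩ := intermediate_value_Icc hS2.le hc ⟨h1, h2⟩
    exact hD s hs.1 hs.2
  · intro γ hγ
    set φ := p - C γ * q with hφ
    have hφd : φ.natDegree ≤ N :=
      (natDegree_sub_le _ _).trans (max_le hp ((natDegree_C_mul_le _ _).trans hq))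
    have e : hev N φ P Q = hev N p P Q - C γ * hev N q P Q := by
      rw [hφ, hev_sub, hev_C_mul]; rfl
    obtain ⟨g1, g2⟩ := hP' γ hγ
    rw [← e] at g1 g2
    have hne : hev N φ P Q ≠ 0 := by
      have h := hD2 S le_rfl hS2.le
      have := h.2 γ
      rw [← e] at this
      apply ne_zero_of_dn_pos (c := 0) (s := S)
      rw [this]
      have := dn_pos 0 hS h.1
      have : 0 < κ * S ^ k := by positivity
      have : 0 < max (κ * S ^ k) ‖0 - γ‖ := lt_max_of_lt_left this
      positivity
    set L := ‖(hev N φ P Q).leadingCoeff‖ with hL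
    have hLp : 0 < L := by simpa [hL] using hne
    set L0 := ‖P.leadingCoeff‖ with hL0
    have hL0p : 0 < L0 := by simpa [hL0] using hE
    have key : ∀ s, S ≤ s → s ≤ S2 → dn 0 (κ * s ^ k) φ * L0 ^ N = L * (κ * s ^ k) ^ N := by
      intro s h1 h2
      have hsp : 0 < s := by linarith
      have k1 := (hD1 s h1 h2).dn_hev hφd
      have k2 := (hD1 s h1 h2).2 0
      have k3 := roots_norm_of_eq hP.2 h1
      have k4 := roots_norm_of_eq g2 h1
      rw [map_zero, zero_mul, sub_zero, sub_zero, norm_zero, max_eq_left (by positivity), k3, hP.1] at k2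
      rw [k4, g1] at k1
      have hQp : 0 < dn 0 s Q := dn_pos 0 hsp (hD1 s h1 h2).1
      have : dn 0 (κ * s ^ k) φ * L0 ^ N * s ^ (E * N) = L * (κ * s ^ k) ^ N * s ^ (E * N) := by
        calc dn 0 (κ * s ^ k) φ * L0 ^ N * s ^ (E * N) = dn 0 (κ * s ^ k) φ * (L0 * s ^ E) ^ N := by
              rw [mul_pow, ← pow_mul]; ring
          _ = dn 0 (κ * s ^ k) φ * dn 0 s Q ^ N * (κ * s ^ k) ^ N := by
              rw [k2, mul_pow]; ring
          _ = _ := by rw [← k1]; ring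
      exact mul_right_cancel₀ (by positivity) this
    have hφ0 : φ ≠ 0 := by
      intro h0
      apply hne
      rw [h0]; simp [hev]
    refine ⟨?_, ?_⟩ <;> [skip; intro x hx] <;>
    · have k1 := key S le_rfl hS2.le
      have k2 := key S2 hS2.le le_rfl
      have hfg := full_growth (p := φ) 0 (R1 := κ * S ^ k) (R2 := κ * S2 ^ k) (by positivity)
        (by have : S ^ k < S2 ^ k := pow_lt_pow_left₀ hS2 hS.le (by omega)
            gcongr) hφd hφ0 (by
          have : 0 < L0 ^ N := by positivity
          have : dn 0 (κ * S ^ k) φ * (κ * S2 ^ k) ^ N * L0 ^ N ≤ dn 0 (κ * S2 ^ k) φ * (κ * S ^ k) ^ N * L0 ^ N := by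
            apply le_of_eq
            calc _ = (dn 0 (κ * S ^ k) φ * L0 ^ N) * (κ * S2 ^ k) ^ N := by ring
              _ = (dn 0 (κ * S2 ^ k) φ * L0 ^ N) * (κ * S ^ k) ^ N := by rw [k1, k2]; ring
              _ = _ := by ring
          exact le_of_mul_le_mul_right this (by positivity))
      first
      | exact hfg.1
      | simpa using hfg.2 x hx

lemma step2 {p q : K[X]} {N : ℕ} {R1 R2 : ℝ} (hN : 2 ≤ N) (hR1 : 0 < R1) (hR2 : R1 < R2)
    (hq : q.natDegree ≤ N)
    (hnv : ∀ x, p.eval x ≠ 0 ∨ q.eval x ≠ 0)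
    (hD : ∀ t, R1 ≤ t → t ≤ R2 → DMaps p q 0 t 0 t)
    (hf : ∀ γ : K, ‖γ‖ ≤ R1 → (p - C γ * q).natDegree = N ∧ ∀ x ∈ (p - C γ * q).roots, ‖x‖ ≤ R1) :
    ∃ α c : K, ∃ ρ L : ℝ, 0 < ρ ∧ 0 < L ∧ ρ ≤ R1 ∧ ‖α‖ ≤ R1 ∧ ‖c - α‖ = ρ ∧ DMaps p q α ρ α ρ ∧
      dn α ρ q * ρ = L * ρ ^ N ∧ q.eval α = 0 ∧ (p.eval c = α * q.eval c ∨ q.eval c = 0) ∧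
      ∀ y0 y1 : K, ρ * ‖y1‖ < ‖y0 - α * y1‖ →
        ρ * ‖hev N q y0 y1‖ < ‖hev N p y0 y1 - α * hev N q y0 y1‖ ∧
        ‖hev N p y0 y1 - α * hev N q y0 y1‖ = L * ‖y0 - α * y1‖ ^ N := by
  have hNN : N = (N - 1) + 1 := by omega
  have hp0 := hf 0 (by simpa using hR1.le)
  rw [map_zero, zero_mul, sub_zero] at hp0
  set L := ‖p.leadingCoeff‖ with hL
  have hLp : 0 < L := by
    have : p ≠ 0 := by rintro rfl; simp at hp0; omega
    simpa [hL] using this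
  have hq0 : q ≠ 0 := (hD R1 le_rfl hR2.le).1
  have nq : ∀ t, R1 ≤ t → t ≤ R2 → dn 0 t q = L * t ^ (N - 1) := by
    intro t h1 h2
    have k2 := (hD t h1 h2).2 0
    have htp : 0 < t := by linarith
    rw [map_zero, zero_mul, sub_zero, sub_zero, norm_zero, max_eq_left htp.le,
      roots_norm_of_eq hp0.2 h1, hp0.1, hNN, pow_succ] at k2
    have : dn 0 t q * t = L * t ^ (N - 1) * t := by rw [mul_comm, ← k2]; ring
    exact mul_right_cancel₀ htp.ne' this
  obtain ⟨t, ht1, ht2, htg⟩ := exists_gap hR2 q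
  have hcount := count_eq (c := (0 : K)) hR1 ht1 hLp (nq R1 le_rfl hR2.le) (nq t ht1.le ht2.le)
    (by intro a ha; simpa using htg a ha)
  obtain ⟨α, hα⟩ : ∃ α, α ∈ q.roots.filter (fun a => ‖(0 : K) - a‖ < t) := by
    apply Multiset.card_pos_iff_exists_mem.1
    rw [rcount] at hcount
    omega
  rw [Multiset.mem_filter] at hα
  have hαR : ‖α‖ ≤ R1 := htg α hα.1 (by simpa using hα.2)
  have hqα : q.eval α = 0 := (mem_roots'.1 hα.1).2
  set u := p - C α * q with hu
  obtain ⟨ud, ur⟩ := hf α hαR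
  have hu0 : u ≠ 0 := by intro h; rw [← hu, h] at ud; simp at ud; omega
  have hLu : ‖u.leadingCoeff‖ = L := by
    have k1 := roots_norm_of_eq ur hR2.le
    have k2 := (hD R2 hR2.le le_rfl).2 α
    rw [← hu] at k1 k2 ud
    rw [k1, ud, max_eq_left (by rw [zero_sub, norm_neg]; linarith), nq R2 hR2.le le_rfl] at k2
    have hR2p : 0 < R2 := by linarith
    have k3 : R2 ^ N = R2 * R2 ^ (N - 1) := by conv_lhs => rw [hNN, pow_succ]; simp [mul_comm]
    have : ‖u.leadingCoeff‖ * R2 ^ N = L * R2 ^ N := by rw [k2, k3]; ring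
    exact mul_right_cancel₀ (by positivity) this
  rw [← hu] at ud ur
  -- the finite set
  set Z : Finset K := u.roots.toFinset ∪ q.roots.toFinset.filter (fun a => ‖a‖ ≤ R1) with hZ
  have hZne : Z.Nonempty := by
    have : 0 < u.roots.card := by
      rw [← (IsAlgClosed.splits u).natDegree_eq_card_roots]; omega
    obtain ⟨a, ha⟩ := Multiset.card_pos_iff_exists_mem.1 this
    exact ⟨a, by simp only [hZ, Finset.mem_union, Multiset.mem_toFinset]; exact Or.inl ha⟩
  obtain ⟨c, hcZ, hcmax⟩ := Z.exists_max_image (fun a => ‖a - α‖) hZne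
  set ρ := ‖c - α‖ with hρ
  have hu1 : ∀ a ∈ u.roots, ‖a - α‖ ≤ ρ := fun a ha =>
    hcmax a (by simp only [hZ, Finset.mem_union, Multiset.mem_toFinset]; exact Or.inl ha)
  have hq1 : ∀ a ∈ q.roots, ‖a‖ ≤ R1 → ‖a - α‖ ≤ ρ := fun a ha hb =>
    hcmax a (by simp only [hZ, Finset.mem_union, Finset.mem_filter, Multiset.mem_toFinset]
                exact Or.inr ⟨ha, hb⟩)
  have hcR : ‖c‖ ≤ R1 ∧ (p.eval c = α * q.eval c ∨ q.eval c = 0) := by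
    simp only [hZ, Finset.mem_union, Finset.mem_filter, Multiset.mem_toFinset] at hcZ
    rcases hcZ with h | h
    · refine ⟨ur c h, Or.inl ?_⟩
      have := (mem_roots'.1 h).2
      simpa [hu, IsRoot, sub_eq_zero] using this
    · exact ⟨h.2, Or.inr (mem_roots'.1 h.1).2⟩
  have hρR : ρ ≤ R1 := by
    rw [hρ, sub_eq_add_neg]
    exact (IsUltrametricDist.norm_add_le_max _ _).trans (max_le hcR.1 (by simpa using hαR))
  have hρ0 : 0 < ρ := by
    by_contra h
    have h : ρ = 0 := le_antisymm (not_lt.1 h) (norm_nonneg _)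
    have : 0 < u.roots.card := by
      rw [← (IsAlgClosed.splits u).natDegree_eq_card_roots]; omega
    obtain ⟨a, ha⟩ := Multiset.card_pos_iff_exists_mem.1 this
    have h1 := hu1 a ha
    rw [h] at h1
    have h2 : a = α := by simpa [sub_eq_zero] using h1
    rw [h2] at ha
    have h3 := (mem_roots'.1 ha).2
    have h3 : p.eval α = 0 := by simpa [hu, IsRoot, hqα] using h3
    rcases hnv α with h4 | h4
    · exact h4 h3
    · exact h4 hqα
  have nu : ∀ σ, ρ ≤ σ → dn α σ u = L * σ ^ N := by
    intro σ hσ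
    rw [full_conv α (fun β hβ => by rw [norm_sub_rev]; exact (hu1 β hβ).trans hσ), ud, hLu]
  have nq1 : ∀ σ, R1 ≤ σ → σ ≤ R2 → dn α σ q = L * σ ^ (N - 1) := by
    intro σ h1 h2
    rw [← nq σ h1 h2]
    exact dn_recenter (by rw [sub_zero]; linarith) q
  have hgap : ∀ a ∈ q.roots, ‖α - a‖ < t → ‖a‖ ≤ R1 := by
    intro a ha h
    apply htg a ha
    have e : a = α + -(α - a) := by ring
    rw [e]
    exact (IsUltrametricDist.norm_add_le_max _ _).trans_lt (max_lt (by linarith) (by rw [norm_neg]; exact h))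
  have hcount' := count_eq (c := α) hR1 ht1 hLp (nq1 R1 le_rfl hR2.le) (nq1 t ht1.le ht2.le)
    (by intro a ha h
        rw [norm_sub_rev]
        exact (hq1 a ha (hgap a ha h)).trans hρR)
  have nq2 : ∀ σ, ρ ≤ σ → σ ≤ R2 → dn α σ q = L * σ ^ (N - 1) := by
    intro σ h1 h2
    rcases le_total R1 σ with h | h
    · exact nq1 σ h h2
    · have k := dn_scale α (s := t) (σ := σ) (by linarith) q (by
        intro a ha h
        rw [norm_sub_rev]
        exact (hq1 a ha (hgap a ha h)).trans h1)
      rw [hcount', nq1 t ht1.le ht2.le] at k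
      have htp : 0 < t := by linarith
      have : dn α σ q * t ^ (N - 1) = L * σ ^ (N - 1) * t ^ (N - 1) := by rw [k]; ring
      exact mul_right_cancel₀ (by positivity) this
  have hpow : ∀ σ : ℝ, σ ^ N = σ ^ (N - 1) * σ := by
    intro σ; conv_lhs => rw [hNN, pow_succ]
  refine ⟨α, c, ρ, L, hρ0, hLp, hρR, hαR, rfl, ?_, ?_, hqα, hcR.2, ?_⟩
  · refine DMaps.of_crossing hq0 hρ0 ?_ ?_
    · rw [← hu, nu ρ le_rfl, nq2 ρ le_rfl (by linarith), hpow]; ring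
    · have h1 : ∃ᶠ s in 𝓝[>] ρ, dn α s (p - C α * q) ≠ ρ * dn α s q := by
        apply Eventually.frequently
        filter_upwards [Ioo_mem_nhdsGT (show ρ < R2 by linarith)] with s hs
        rw [← hu, nu s hs.1.le, nq2 s hs.1.le hs.2.le, hpow]
        have hsp : 0 < s := by linarith [hs.1]
        have : 0 < L * s ^ (N - 1) := by positivity
        intro h
        nlinarith [hs.1]
      exact h1.filter_mono nhdsWithin_le_nhds
  · rw [nq2 ρ le_rfl (by linarith), hpow]; ring
  · intro y0 y1 hy
    set T := ‖y0 - α * y1‖ with hT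
    have hTp : 0 < T := lt_of_le_of_lt (by positivity) hy
    have e1 : hev N p y0 y1 - α * hev N q y0 y1 = hev N u y0 y1 := by
      rw [hu, hev_sub, hev_C_mul]; rfl
    have e2 : ‖hev N u y0 y1‖ = L * T ^ N := by
      rw [hev_factor ud.le, ud, Nat.sub_self, pow_zero, one_mul, norm_mul]
      have : ‖algebraMap K K u.leadingCoeff‖ = L := hLu
      rw [this]
      congr 1
      rw [← ud, (IsAlgClosed.splits u).natDegree_eq_card_roots]
      have key : ∀ m : Multiset K, (∀ a ∈ m, ‖a - α‖ ≤ ρ) →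
          ‖(m.map (fun c => y0 - algebraMap K K c * y1)).prod‖ = T ^ m.card := by
        intro m
        induction m using Multiset.induction_on with
        | empty => simp
        | cons a m ih =>
          intro h
          rw [Multiset.map_cons, Multiset.prod_cons, norm_mul, Multiset.card_cons, pow_succ', ih (fun b hb => h b (Multiset.mem_cons_of_mem hb))]
          congr 1
          have e : y0 - algebraMap K K a * y1 = (y0 - α * y1) + -((a - α) * y1) := by
            simp only [Algebra.algebraMap_self, RingHom.id_apply]; ring
          have hlt : ‖-((a - α) * y1)‖ < ‖y0 - α * y1‖ := by
            rw [norm_neg, norm_mul]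
            refine lt_of_le_of_lt ?_ hy
            have := h a (Multiset.mem_cons_self _ _)
            gcongr
          rw [e, IsUltrametricDist.norm_add_eq_max_of_norm_ne_norm hlt.ne', max_eq_left hlt.le]
      exact key _ hu1
    rw [e1, e2]
    refine ⟨?_, rfl⟩
    by_cases hy1 : y1 = 0
    · subst hy1
      have e3 : hev N q y0 0 = q.coeff N * y0 ^ N := by
        rw [hev_sum, Finset.sum_range_succ, Finset.sum_eq_zero]
        · simp
        · intro i hi
          rw [Finset.mem_range] at hi
          rw [zero_pow (by omega)]; simp
      have hT' : T = ‖y0‖ := by rw [hT]; simp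
      have k := dn_coeff_le 0 (show 0 < R2 by linarith) q N
      rw [map_zero, add_zero, comp_X, nq R2 hR2.le le_rfl, hpow, ← mul_assoc] at k
      have hR2p : 0 < R2 := by linarith
      have k2 : ‖q.coeff N‖ * R2 ≤ L := by
        have : (‖q.coeff N‖ * R2) * R2 ^ (N - 1) ≤ L * R2 ^ (N - 1) := by nlinarith
        exact le_of_mul_le_mul_right this (by positivity)
      rw [e3, norm_mul, norm_pow, ← hT', ← mul_assoc]
      have : ρ * ‖q.coeff N‖ < L := by
        rcases (norm_nonneg (q.coeff N)).eq_or_lt with h | h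
        · rw [← h]; simpa using hLp
        · nlinarith
      gcongr
    · have hy1p : 0 < ‖y1‖ := by simpa using hy1
      set x := y0 / y1 with hx
      have hy0 : y0 = y1 * x := by rw [hx]; field_simp
      have e3 : hev N q y0 y1 = y1 ^ N * q.eval x := by
        have := hev_smul N q y1 x 1
        rw [mul_one, ← hy0, hev_eval_one N hq] at this
        exact this
      set τ := ‖x - α‖ with hτ
      have hTτ : T = ‖y1‖ * τ := by
        rw [hT, hτ, ← norm_mul, hy0]; congr 1; ring
      have hτρ : ρ < τ := by
        rw [hTτ, mul_comm] at hy
        exact lt_of_mul_lt_mul_left hy hy1p.le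
      have hτp : 0 < τ := by linarith
      have hqx : ‖q.eval x‖ ≤ dn α τ q := norm_eval_le le_rfl q
      have main : ρ * dn α τ q < L * τ ^ N := by
        rcases le_total τ R2 with h | h
        · rw [nq2 τ hτρ.le h, hpow]
          have : 0 < L * τ ^ (N - 1) := by positivity
          nlinarith
        · have hR2p : 0 < R2 := by linarith
          have k := dn_upper α hR2p h hq
          rw [nq2 R2 (by linarith) le_rfl, hpow] at k
          have k1 : dn α τ q * R2 ≤ L * τ ^ N := by
            have : (dn α τ q * R2) * R2 ^ (N - 1) ≤ (L * τ ^ N) * R2 ^ (N - 1) := by nlinarith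
            exact le_of_mul_le_mul_right this (by positivity)
          have := dn_pos α hτp hq0
          nlinarith
      rw [e3, norm_mul, norm_pow, hTτ, mul_pow]
      calc ρ * (‖y1‖ ^ N * ‖q.eval x‖) = ‖y1‖ ^ N * (ρ * ‖q.eval x‖) := by ring
        _ ≤ ‖y1‖ ^ N * (ρ * dn α τ q) := by gcongr
        _ < ‖y1‖ ^ N * (L * τ ^ N) := by gcongr
        _ = _ := by ring

end HelpersI

section HelpersJ
set_option linter.unusedSectionVars false
variable {K : Type*} [NontriviallyNormedField K] [IsAlgClosed K] [IsUltrametricDist K]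
variable {d : ℕ} {p q : K[X]}

lemma hit_add (a b : ℕ) : hit d p q (a + b) =
    (hev (d ^ a) (hit d p q a).1 (hit d p q b).1 (hit d p q b).2,
     hev (d ^ a) (hit d p q a).2 (hit d p q b).1 (hit d p q b).2) := by
  conv_lhs => rw [hit, Function.iterate_add_apply]
  rw [hstep_iter]; rfl

lemma hit_eval (n : ℕ) (x : K) : ((hit d p q n).1.eval x, (hit d p q n).2.eval x) =
    (hstep d p q)^[n] (x, 1) := by
  have := hstep_iter_eval (d := d) (p := p) (q := q) n (X, 1) x
  simp only [eval_X, eval_one] at this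
  rw [this]; rfl

lemma hit_fix {per : ℕ} {α : K} {ρ : ℝ} (hρ : 0 < ρ)
    (h : DMaps (hit d p q per).1 (hit d p q per).2 α ρ α ρ) (j : ℕ) :
    DMaps (hit d p q (per * j)).1 (hit d p q (per * j)).2 α ρ α ρ := by
  induction j with
  | zero =>
    have e : hit d p q (per * 0) = (X, 1) := by simp [hit]
    rw [e]
    refine ⟨one_ne_zero, fun a' => ?_⟩
    simp only [mul_one, dn_one]
    exact dn_X_sub_C _ _ _
  | succ j ih =>
    have e : per * (j + 1) = per + per * j := by ring
    rw [e, hit_add]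
    exact ih.comp hρ (hit_natDegree per).1 (hit_natDegree per).2 hρ h

lemma hstep_ne (hnv : ∀ x y : K, hev d p x y = 0 → hev d q x y = 0 → x = 0 ∧ y = 0)
    {z : K × K} (hz : z ≠ 0) : hstep d p q z ≠ 0 := by
  intro h
  apply hz
  have h1 : hev d p z.1 z.2 = 0 := congrArg Prod.fst h
  have h2 : hev d q z.1 z.2 = 0 := congrArg Prod.snd h
  obtain ⟨h3, h4⟩ := hnv _ _ h1 h2
  exact Prod.ext h3 h4

lemma hstep_iter_ne (hnv : ∀ x y : K, hev d p x y = 0 → hev d q x y = 0 → x = 0 ∧ y = 0)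
    {z : K × K} (hz : z ≠ 0) (n : ℕ) : (hstep d p q)^[n] z ≠ 0 := by
  induction n with
  | zero => exact hz
  | succ n ih => rw [Function.iterate_succ_apply']; exact hstep_ne hnv ih

lemma hit_nv (hnv : ∀ x y : K, hev d p x y = 0 → hev d q x y = 0 → x = 0 ∧ y = 0) (n : ℕ) (x : K) :
    (hit d p q n).1.eval x ≠ 0 ∨ (hit d p q n).2.eval x ≠ 0 := by
  have h := hstep_iter_ne hnv (z := (x, 1)) (by simp) n
  rw [← hit_eval] at h
  by_contra hc
  push Not at hc
  exact h (Prod.ext hc.1 hc.2)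

/-- the norm attached to a disc -/
noncomputable def dnrm (α : K) (ρ : ℝ) (z : K × K) : ℝ := max ‖z.1 - α * z.2‖ (ρ * ‖z.2‖)

lemma dnrm_pos {α : K} {ρ : ℝ} (hρ : 0 < ρ) {z : K × K} (hz : z ≠ 0) : 0 < dnrm α ρ z := by
  by_cases h : z.2 = 0
  · refine lt_max_of_lt_left ?_
    rw [h, mul_zero, sub_zero, norm_pos_iff]
    intro h1; exact hz (Prod.ext h1 h)
  · refine lt_max_of_lt_right ?_
    have : 0 < ‖z.2‖ := by simpa using h
    positivity

lemma hev_bound (α : K) {ρ : ℝ} (hρ : 0 < ρ) (d : ℕ) (p : K[X]) :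
    ∃ C, 0 ≤ C ∧ ∀ z : K × K, ‖hev d p z.1 z.2‖ ≤ C * dnrm α ρ z ^ d := by
  set E := 1 + ‖α‖ * ρ⁻¹ + ρ⁻¹ with hE
  refine ⟨∑ i ∈ Finset.range (d + 1), ‖p.coeff i‖ * E ^ d, Finset.sum_nonneg (fun i _ => by positivity), fun z => ?_⟩
  have hn : 0 ≤ dnrm α ρ z := (norm_nonneg _).trans (le_max_left _ _)
  have h2 : ‖z.2‖ ≤ ρ⁻¹ * dnrm α ρ z := by
    have : ρ * ‖z.2‖ ≤ dnrm α ρ z := le_max_right _ _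
    rw [inv_mul_eq_div, le_div_iff₀ hρ]; linarith
  have h2' : ‖z.2‖ ≤ E * dnrm α ρ z := by
    refine h2.trans ?_
    have : ρ⁻¹ ≤ E := by
      have : 0 ≤ ‖α‖ * ρ⁻¹ := by positivity
      linarith
    gcongr
  have h1 : ‖z.1‖ ≤ E * dnrm α ρ z := by
    have e : z.1 = (z.1 - α * z.2) + α * z.2 := by ring
    calc ‖z.1‖ ≤ ‖z.1 - α * z.2‖ + ‖α * z.2‖ := by
          have := norm_add_le (z.1 - α * z.2) (α * z.2)
          rwa [← e] at this
      _ ≤ dnrm α ρ z + ‖α‖ * (ρ⁻¹ * dnrm α ρ z) := by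
          rw [norm_mul]; gcongr; exact le_max_left _ _
      _ ≤ E * dnrm α ρ z := by
          have : 0 ≤ ρ⁻¹ * dnrm α ρ z := by positivity
          rw [hE]; nlinarith
  rw [hev_sum, Finset.sum_mul]
  refine (norm_sum_le _ _).trans (Finset.sum_le_sum fun i hi => ?_)
  have hi' : i ≤ d := by rw [Finset.mem_range] at hi; omega
  rw [norm_mul, norm_mul, norm_pow, norm_pow, mul_assoc, ← mul_pow]
  have e3 : ‖algebraMap K K (p.coeff i)‖ = ‖p.coeff i‖ := rfl
  rw [e3]
  gcongr
  calc ‖z.1‖ ^ i * ‖z.2‖ ^ (d - i) ≤ (E * dnrm α ρ z) ^ i * (E * dnrm α ρ z) ^ (d - i) := by gcongr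
    _ = _ := by rw [← pow_add]; congr 1; omega

/-- no-bad-point implies potentially good reduction -/
lemma good_of_no_bad (hd : 2 ≤ d) (hnv : ∀ x y : K, hev d p x y = 0 → hev d q x y = 0 → x = 0 ∧ y = 0)
    {per : ℕ} (hper : 1 ≤ per) {α : K} {ρ L : ℝ} (hρ : 0 < ρ) (hL : 0 < L)
    (h : ∀ z : K × K, z ≠ 0 → dnrm α ρ ((hstep d p q)^[per] z) = L * dnrm α ρ z ^ (d ^ per)) :
    ∃ c, 0 < c ∧ ∀ z : K × K, dnrm α ρ (hstep d p q z) = c * dnrm α ρ z ^ d := by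
  obtain ⟨C1, hC1, h1⟩ := hev_bound α hρ d p
  obtain ⟨C2, hC2, h2⟩ := hev_bound α hρ d q
  set Cc := C1 + ‖α‖ * C2 + ρ * C2 + 1 with hCc
  have hCp : 0 < Cc := by positivity
  have hub : ∀ z : K × K, dnrm α ρ (hstep d p q z) ≤ Cc * dnrm α ρ z ^ d := by
    intro z
    have hn : 0 ≤ dnrm α ρ z := (norm_nonneg _).trans (le_max_left _ _)
    have hnd : 0 ≤ dnrm α ρ z ^ d := by positivity
    have a1 := h1 z
    have a2 := h2 z
    have b1 : 0 ≤ ‖α‖ * C2 * dnrm α ρ z ^ d := by positivity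
    have b2 : 0 ≤ ρ * C2 * dnrm α ρ z ^ d := by positivity
    have b3 : 0 ≤ C1 * dnrm α ρ z ^ d := by positivity
    apply max_le
    · simp only [hstep]
      calc ‖hev d p z.1 z.2 - α * hev d q z.1 z.2‖ ≤ ‖hev d p z.1 z.2‖ + ‖α * hev d q z.1 z.2‖ := norm_sub_le _ _
        _ ≤ C1 * dnrm α ρ z ^ d + ‖α‖ * (C2 * dnrm α ρ z ^ d) := by rw [norm_mul]; gcongr
        _ ≤ _ := by rw [hCc]; nlinarith
    · simp only [hstep]
      calc ρ * ‖hev d q z.1 z.2‖ ≤ ρ * (C2 * dnrm α ρ z ^ d) := by gcongr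
        _ ≤ _ := by rw [hCc]; nlinarith
  let T := {z : K × K // z ≠ 0}
  let F : T → T := fun z => ⟨hstep d p q z.1, hstep_ne hnv z.2⟩
  have hF : ∀ n (z : T), (F^[n] z).1 = (hstep d p q)^[n] z.1 := by
    intro n z
    induction n with
    | zero => rfl
    | succ n ih => rw [Function.iterate_succ_apply', Function.iterate_succ_apply', ← ih]
  obtain ⟨l, hl⟩ := rigid F (fun z => Real.log (dnrm α ρ z.1)) hd hper (c := Real.log L) (L := Real.log Cc)
    (by
      intro z
      have hz := dnrm_pos (α := α) hρ z.2
      simp only [hF]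
      rw [h z.1 z.2, Real.log_mul hL.ne' (by positivity), Real.log_pow]
      push_cast; ring)
    (by
      intro z
      have hz := dnrm_pos (α := α) hρ z.2
      have hz2 := dnrm_pos (α := α) hρ (F z).2
      have := Real.log_le_log hz2 (hub z.1)
      rw [Real.log_mul hCp.ne' (by positivity), Real.log_pow] at this
      change Real.log (dnrm α ρ (hstep d p q z.1)) - d * Real.log (dnrm α ρ z.1) ≤ _
      linarith)
  refine ⟨Real.exp l, Real.exp_pos _, fun z => ?_⟩
  by_cases hz : z = 0
  · subst hz
    have hub0 := hub 0
    have e : dnrm α ρ (0 : K × K) = 0 := by simp [dnrm]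
    rw [e, zero_pow (by omega), mul_zero] at hub0
    rw [e, zero_pow (by omega), mul_zero]
    exact le_antisymm hub0 ((norm_nonneg _).trans (le_max_left _ _))
  · have hz1 := dnrm_pos (α := α) hρ hz
    have hz2 := dnrm_pos (α := α) hρ (hstep_ne hnv hz)
    have := hl ⟨z, hz⟩
    simp only [F] at this
    rw [← Real.exp_log hz2, this, Real.exp_add, mul_comm]
    congr 1
    rw [← Real.log_pow, Real.exp_log (by positivity)]

/-- output of the dynamical construction -/
def Engine (d : ℕ) (p q A B : K[X]) (per : ℕ) (R : ℝ) : Prop :=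
  ∃ j : ℕ, 1 ≤ j ∧ ∃ c0 α w : K, ∃ r ρ : ℝ, 0 < r ∧ 0 < ρ ∧ ‖c0‖ ≤ R ∧ r ≤ R ∧ ‖α‖ ≤ R ∧ ρ ≤ R ∧ ‖w‖ = ρ ∧
    DMaps (hit d p q (per * j)).1 (hit d p q (per * j)).2 c0 r α ρ ∧
    DMaps (hit d p q (per * j)).1 (hit d p q (per * j)).2 α ρ α ρ ∧
    (∀ e0 e1 : K, (e0 ≠ 0 ∨ e1 ≠ 0) → ∃ x, ‖x - c0‖ < r ∧
      e1 * (hit d p q (per * j)).1.eval x = e0 * (hit d p q (per * j)).2.eval x) ∧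
    ∀ Z : K[X] × K[X], ∃ T0, ∀ t, T0 ≤ t → ∀ b s, 0 < s →
      DMaps ((hstep d p q)^[per * j * t] Z).1 ((hstep d p q)^[per * j * t] Z).2 b s c0 r →
      ∀ᶠ t' in atTop, dn b s (((hstep d p q)^[per * j * t'] Z).1 * B - ((hstep d p q)^[per * j * t'] Z).2 * A) =
        dn b s ((hstep d p q)^[per * j * t'] Z).2 * max (ρ * dn b s B) (dn b s (A - C α * B))

lemma iter_dmaps {Z : K[X] × K[X]} {n m : ℕ} {b a a' : K} {s r ρ : ℝ} (hs : 0 < s) (hr : 0 < r)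
    (h : DMaps ((hstep d p q)^[n] Z).1 ((hstep d p q)^[n] Z).2 b s a r)
    (h2 : DMaps (hit d p q m).1 (hit d p q m).2 a r a' ρ) :
    DMaps ((hstep d p q)^[n + m] Z).1 ((hstep d p q)^[n + m] Z).2 b s a' ρ := by
  rw [add_comm, Function.iterate_add_apply, hstep_iter]
  exact h.comp hs (hit_natDegree m).1 (hit_natDegree m).2 hr h2

lemma engineA (hd : 2 ≤ d) (hnv : ∀ x y : K, hev d p x y = 0 → hev d q x y = 0 → x = 0 ∧ y = 0)
    {A B : K[X]} (hB : B ≠ 0) {per : ℕ} (hper : 1 ≤ per) {R : ℝ} {α c : K} {ρ L : ℝ} (hρ : 0 < ρ) (hL : 0 < L)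
    (hρR : ρ ≤ R) (hαR : ‖α‖ ≤ R) (hc : ‖c - α‖ = ρ)
    (hPGR : ¬ ∃ c, 0 < c ∧ ∀ z : K × K, dnrm α ρ (hstep d p q z) = c * dnrm α ρ z ^ d)
    (hζ : DMaps (hit d p q per).1 (hit d p q per).2 α ρ α ρ)
    (hdn : dn α ρ (hit d p q per).2 * ρ = L * ρ ^ (d ^ per))
    (hV : ∀ y0 y1 : K, ρ * ‖y1‖ < ‖y0 - α * y1‖ →
        ρ * ‖hev (d ^ per) (hit d p q per).2 y0 y1‖ < ‖hev (d ^ per) (hit d p q per).1 y0 y1 - α * hev (d ^ per) (hit d p q per).2 y0 y1‖ ∧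
        ‖hev (d ^ per) (hit d p q per).1 y0 y1 - α * hev (d ^ per) (hit d p q per).2 y0 y1‖ = L * ‖y0 - α * y1‖ ^ (d ^ per))
    (hA : ∀ j, 1 ≤ j → ρ * dn α ρ (hit d p q (per * j)).2 ≤
      dn α ρ ((hit d p q (per * j)).1 - X * (hit d p q (per * j)).2)) :
    Engine d p q A B per R := by
  have hbad : ∃ y, ‖y - α‖ ≤ ρ ∧ ‖(hit d p q per).2.eval y‖ < dn α ρ (hit d p q per).2 ∧
      ‖(hit d p q per).1.eval y - α * (hit d p q per).2.eval y‖ < ρ * dn α ρ (hit d p q per).2 := by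
    by_contra hcon
    push Not at hcon
    apply hPGR
    apply good_of_no_bad hd hnv hper hρ hL
    intro z hz
    rw [hstep_iter]
    by_cases hzV : ρ * ‖z.2‖ < ‖z.1 - α * z.2‖
    · obtain ⟨k1, k2⟩ := hV z.1 z.2 hzV
      simp only [dnrm]
      rw [max_eq_left k1.le, k2, max_eq_left hzV.le]
    · push Not at hzV
      have hz2 : z.2 ≠ 0 := by
        intro h
        rw [h] at hzV
        simp at hzV
        exact hz (Prod.ext hzV h)
      have hz2p : 0 < ‖z.2‖ := by simpa using hz2
      set y := z.1 / z.2 with hy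
      have e0 : z.1 = z.2 * y := by rw [hy]; field_simp
      have hyd : ‖y - α‖ ≤ ρ := by
        have : z.1 - α * z.2 = z.2 * (y - α) := by rw [e0]; ring
        rw [this, norm_mul, mul_comm] at hzV
        exact le_of_mul_le_mul_right hzV hz2p
      have e1 : ∀ φ : K[X], φ.natDegree ≤ d ^ per → hev (d ^ per) φ z.1 z.2 = z.2 ^ (d ^ per) * φ.eval y := by
        intro φ hφ
        have := hev_smul (d ^ per) φ z.2 y 1
        rw [mul_one, ← e0, hev_eval_one _ hφ] at this
        exact this
      simp only [dnrm]
      rw [max_eq_right hzV, e1 _ (hit_natDegree per).1, e1 _ (hit_natDegree per).2]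
      set u := (hit d p q per).1 with hu
      set v := (hit d p q per).2 with hv
      have e2 : z.2 ^ (d ^ per) * u.eval y - α * (z.2 ^ (d ^ per) * v.eval y) =
          z.2 ^ (d ^ per) * (u.eval y - α * v.eval y) := by ring
      have up1 : ‖v.eval y‖ ≤ dn α ρ v := norm_eval_le hyd v
      have up2 : ‖u.eval y - α * v.eval y‖ ≤ ρ * dn α ρ v := by
        have k1 := norm_eval_le hyd (u - C α * v)
        rw [hζ.2, sub_self, norm_zero, max_eq_left hρ.le] at k1
        simpa using k1
      have m : max ‖u.eval y - α * v.eval y‖ (ρ * ‖v.eval y‖) = ρ * dn α ρ v := by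
        apply le_antisymm
        · exact max_le up2 (by gcongr)
        · by_cases h : ‖v.eval y‖ < dn α ρ v
          · exact (hcon y hyd h).trans (le_max_left _ _)
          · push Not at h
            exact le_trans (by gcongr) (le_max_right _ _)
      rw [e2, norm_mul, norm_mul, norm_pow]
      have : ρ * (‖z.2‖ ^ d ^ per * ‖v.eval y‖) = ‖z.2‖ ^ d ^ per * (ρ * ‖v.eval y‖) := by ring
      rw [this, ← mul_max_of_nonneg _ _ (by positivity), m, mul_comm ρ, hdn, mul_pow]
      ring
  obtain ⟨y, hy, hb1, hb2⟩ := hbad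
  have hyα : ‖α - y‖ ≤ ρ := by rw [norm_sub_rev]; exact hy
  refine ⟨1, le_rfl, y, α, c - α, ρ, ρ, hρ, hρ, ?_, hρR, hαR, hρR, hc, ?_, ?_, ?_, ?_⟩
  · have e : y = (y - α) + α := by ring
    rw [e]
    exact (IsUltrametricDist.norm_add_le_max _ _).trans (max_le (hy.trans hρR) hαR)
  · rw [mul_one]; exact hζ.recenter_source hyα
  · rw [mul_one]; exact hζ
  · rw [mul_one]; exact cov_of_bad hρ hζ hy hb1 hb2
  · intro Z
    refine ⟨0, fun t _ b s hs h => ?_⟩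
    rw [mul_one] at *
    have h := h.recenter_target (b := α) (by rw [norm_sub_rev]; exact hyα)
    have hall : ∀ t', t ≤ t' → DMaps ((hstep d p q)^[per * t'] Z).1 ((hstep d p q)^[per * t'] Z).2 b s α ρ := by
      intro t' ht'
      obtain ⟨i, rfl⟩ := Nat.exists_eq_add_of_le ht'
      rw [mul_add]
      exact iter_dmaps hs hρ h (hit_fix hρ hζ i)
    by_contra hcon
    rw [not_eventually] at hcon
    obtain ⟨t1, ht1, hn1⟩ := (frequently_atTop.1 hcon) t
    obtain ⟨t2, ht2, hn2⟩ := (frequently_atTop.1 hcon) (t1 + 1)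
    have g1 := degenerate_lt hs (hall t1 ht1) hn1 hρ
    have g2 := degenerate_lt hs (hall t2 (by omega)) hn2 hρ
    obtain ⟨i, rfl⟩ := Nat.exists_eq_add_of_le ht2
    have e : per * (t1 + 1 + i) = per * (1 + i) + per * t1 := by ring
    rw [e, Function.iterate_add_apply, hstep_iter] at g2
    have := degenerate_two hs hρ (hall t1 ht1) hB (hit_natDegree (per * (1 + i))).1
      (hit_natDegree (per * (1 + i))).2 (hit_fix hρ hζ (1 + i)).1 g1 g2
    linarith [hA (1 + i) (by omega)]

end HelpersJ

section HelpersK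
set_option linter.unusedSectionVars false
variable {K : Type*} [NontriviallyNormedField K] [IsAlgClosed K] [IsUltrametricDist K]
variable {d : ℕ} {p q : K[X]}

lemma engineB (hnv : ∀ x y : K, hev d p x y = 0 → hev d q x y = 0 → x = 0 ∧ y = 0)
    {A B : K[X]} (hB : B ≠ 0) {per : ℕ} {R : ℝ} {α c : K} {ρ L : ℝ} (hρ : 0 < ρ)
    (hρR : ρ ≤ R) (hαR : ‖α‖ ≤ R) (hc : ‖c - α‖ = ρ)
    (hζ : DMaps (hit d p q per).1 (hit d p q per).2 α ρ α ρ)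
    (hqα : (hit d p q per).2.eval α = 0)
    (hqc : (hit d p q per).1.eval c = α * (hit d p q per).2.eval c ∨ (hit d p q per).2.eval c = 0)
    (hV : ∀ y0 y1 : K, ρ * ‖y1‖ < ‖y0 - α * y1‖ →
        ρ * ‖hev (d ^ per) (hit d p q per).2 y0 y1‖ < ‖hev (d ^ per) (hit d p q per).1 y0 y1 - α * hev (d ^ per) (hit d p q per).2 y0 y1‖ ∧
        ‖hev (d ^ per) (hit d p q per).1 y0 y1 - α * hev (d ^ per) (hit d p q per).2 y0 y1‖ = L * ‖y0 - α * y1‖ ^ (d ^ per))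
    {j : ℕ} (hj : 1 ≤ j) (hlt : dn α ρ ((hit d p q (per * j)).1 - X * (hit d p q (per * j)).2) <
      ρ * dn α ρ (hit d p q (per * j)).2) :
    Engine d p q A B per R := by
  set V : Set (K × K) := {z | ρ * ‖z.2‖ < ‖z.1 - α * z.2‖} with hVdef
  set W : Set (K × K) := {z | z ∈ V ∨ z.1 = α * z.2} with hWdef
  have hVinv : ∀ z ∈ V, (hstep d p q)^[per] z ∈ V := by
    intro z hz
    rw [hstep_iter]
    exact (hV z.1 z.2 hz).1
  have hpα : (hit d p q per).1.eval α ≠ 0 := by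
    rcases hit_nv hnv per α with h | h
    · exact h
    · exact absurd hqα h
  have hαV : (hstep d p q)^[per] (α, 1) ∈ V := by
    rw [← hit_eval]
    change ρ * ‖(hit d p q per).2.eval α‖ < _
    simp [hqα, hpα]
  have hWinv : ∀ z ∈ W, (hstep d p q)^[per] z ∈ W := by
    intro z hz
    rcases hz with hz | hz
    · exact Or.inl (hVinv z hz)
    · by_cases h2 : z.2 = 0
      · right
        rw [hstep_iter]
        have h1 : z.1 = 0 := by rw [hz, h2, mul_zero]
        have hpos : d ^ per ≠ 0 ∨ d ^ per = 0 := by tauto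
        have e : ∀ φ : K[X], hev (d ^ per) φ z.1 z.2 = 0 ^ (d ^ per) * hev (d ^ per) φ z.1 z.2 := by
          intro φ
          have := hev_smul (d ^ per) φ 0 z.1 z.2
          rw [zero_mul, zero_mul] at this
          rw [h1, h2] at *
          exact this
        rcases hpos with hpos | hpos
        · change hev (d ^ per) (hit d p q per).1 z.1 z.2 = α * hev (d ^ per) (hit d p q per).2 z.1 z.2
          rw [e, e (hit d p q per).2, zero_pow hpos]; ring
        · exfalso
          have hdd := (hit_natDegree (d := d) (p := p) (q := q) per)
          rw [hpos] at hdd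
          have h5 : (hit d p q per).2 = C ((hit d p q per).2.coeff 0) :=
            eq_C_of_natDegree_le_zero hdd.2
          rw [h5] at hqα
          rw [eval_C] at hqα
          rw [hqα, map_zero] at h5
          exact hζ.1 h5
      · left
        rw [hstep_iter]
        have e : ∀ φ : K[X], φ.natDegree ≤ d ^ per → hev (d ^ per) φ z.1 z.2 = z.2 ^ (d ^ per) * φ.eval α := by
          intro φ hφ
          have := hev_smul (d ^ per) φ z.2 α 1
          rw [mul_one, mul_comm, ← hz, hev_eval_one _ hφ] at this
          exact this
        change ρ * ‖hev (d ^ per) (hit d p q per).2 z.1 z.2‖ <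
          ‖hev (d ^ per) (hit d p q per).1 z.1 z.2 - α * hev (d ^ per) (hit d p q per).2 z.1 z.2‖
        rw [e _ (hit_natDegree per).1, e _ (hit_natDegree per).2, hqα]
        simp [hpα, h2]
  have hiter : ∀ (z : K × K) (i : ℕ), (hstep d p q)^[per * i] z = ((hstep d p q)^[per])^[i] z := by
    intro z i; rw [Function.iterate_mul]
  obtain ⟨i, rfl⟩ := Nat.exists_eq_add_of_le' hj
  have hαj : (hstep d p q)^[per * (i + 1)] (α, 1) ∈ V := by
    rw [hiter, Function.iterate_succ_apply]
    generalize hz : (hstep d p q)^[per] (α, 1) = z at hαV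
    clear hz
    clear hlt
    induction i with
    | zero => exact hαV
    | succ i ih => rw [Function.iterate_succ_apply']; exact hVinv _ (ih (by omega))
  have hcj : (hstep d p q)^[per * (i + 1)] (c, 1) ∈ W := by
    rw [hiter, Function.iterate_succ_apply]
    have h0 : (hstep d p q)^[per] (c, 1) ∈ W := by
      rw [← hit_eval]
      rcases hqc with h | h
      · exact Or.inr h
      · left
        have : (hit d p q per).1.eval c ≠ 0 := by
          rcases hit_nv hnv per c with h' | h'
          · exact h'
          · exact absurd h h'
        change ρ * ‖(hit d p q per).2.eval c‖ < _
        simp [h, this]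
    generalize hz : (hstep d p q)^[per] (c, 1) = z at h0
    clear hz
    clear hlt hαj
    induction i with
    | zero => exact h0
    | succ i ih => rw [Function.iterate_succ_apply']; exact hWinv _ (ih (by omega))
  rw [← hit_eval] at hαj hcj
  set m := per * (i + 1) with hm
  have hζm : DMaps (hit d p q m).1 (hit d p q m).2 α ρ α ρ := hit_fix hρ hζ (i + 1)
  set u := (hit d p q m).1 with hu
  set v := (hit d p q m).2 with hv
  have hud : u.natDegree ≤ d ^ m := (hit_natDegree m).1
  have hvd : v.natDegree ≤ d ^ m := (hit_natDegree m).2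
  have huv : ∀ x, u.eval x ≠ 0 ∨ v.eval x ≠ 0 := hit_nv hnv m
  set Nv := dn α ρ v with hNv
  have hclose : ∀ y, ‖y - α‖ ≤ ρ → ‖u.eval y - y * v.eval y‖ < ρ * Nv := by
    intro y hy
    have := norm_eval_le hy (u - X * v)
    simp only [eval_sub, eval_mul, eval_X] at this
    linarith
  have hαV2 : ρ * ‖v.eval α‖ < ‖u.eval α - α * v.eval α‖ := hαj
  have badα1 : ‖u.eval α - α * v.eval α‖ < ρ * Nv := hclose α (by simpa using hρ.le)
  have badα2 : ‖v.eval α‖ < Nv := lt_of_mul_lt_mul_left (hαV2.trans badα1) hρ.le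
  have bc := hclose c hc.le
  have badc : ‖v.eval c‖ < Nv ∧ ‖u.eval c - α * v.eval c‖ < ρ * Nv := by
    have hcj' : (ρ * ‖v.eval c‖ < ‖u.eval c - α * v.eval c‖) ∨ u.eval c = α * v.eval c := hcj
    have e : u.eval c - c * v.eval c = (u.eval c - α * v.eval c) + -((c - α) * v.eval c) := by ring
    have hn : ‖-((c - α) * v.eval c)‖ = ρ * ‖v.eval c‖ := by rw [norm_neg, norm_mul, hc]
    rcases hcj' with h | h
    · rw [e, IsUltrametricDist.norm_add_eq_max_of_norm_ne_norm (by rw [hn]; exact h.ne'), hn,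
        max_eq_left h.le] at bc
      exact ⟨lt_of_mul_lt_mul_left (h.trans bc) hρ.le, bc⟩
    · rw [e, h, sub_self, zero_add, hn] at bc
      have h1 := lt_of_mul_lt_mul_left bc hρ.le
      refine ⟨h1, ?_⟩
      rw [h, sub_self, norm_zero]
      have := norm_nonneg (v.eval c)
      have : 0 < Nv := by linarith
      positivity
  obtain ⟨c0, hc0, hc0r⟩ := cov_of_bad hρ hζm (y := α) (by simpa using hρ.le) badα2 badα1 c 1 (Or.inr one_ne_zero)
  rw [one_mul] at hc0r
  have hvc0 : v.eval c0 ≠ 0 := by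
    rcases huv c0 with h | h
    · intro h0; rw [h0, mul_zero] at hc0r; exact h hc0r
    · exact h
  have hcγ : ‖c0 - c‖ = ρ := by
    have e : c0 - c = -(c - α) + (c0 - α) := by ring
    rw [e, IsUltrametricDist.norm_add_eq_max_of_norm_ne_norm (by rw [norm_neg, hc]; exact hc0.ne'),
      norm_neg, hc, max_eq_left hc0.le]
  obtain ⟨r, hr, hrρ, hDr, hcovr⟩ := first_crossing hρ hζm hlt hc0.le hc.le hcγ hc0r hvc0
  have em : per * ((i + 1) * 2) = m + m := by rw [hm]; ring
  have h2D : DMaps (hit d p q (m + m)).1 (hit d p q (m + m)).2 c0 r α ρ := by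
    rw [hit_add]; exact hDr.comp hr hud hvd hρ hζm
  have h2ζ : DMaps (hit d p q (m + m)).1 (hit d p q (m + m)).2 α ρ α ρ := by
    rw [hit_add]; exact hζm.comp hρ hud hvd hρ hζm
  refine ⟨(i + 1) * 2, by omega, c0, α, c - α, r, ρ, hr, hρ, ?_, by linarith, hαR, hρR, hc, ?_, ?_, ?_, ?_⟩
  · have e : c0 = (c0 - α) + α := by ring
    rw [e]
    exact (IsUltrametricDist.norm_add_le_max _ _).trans (max_le (hc0.le.trans hρR) hαR)
  · rw [em]; exact h2D
  · rw [em]; exact h2ζ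
  · intro e0 e1 he
    obtain ⟨y, hy, hye⟩ := cov_of_bad hρ hζm hc.le badc.1 badc.2 e0 e1 he
    obtain ⟨x, hx, hxe⟩ := hcovr y hy
    refine ⟨x, hx, ?_⟩
    rw [em, hit_add]
    simp only [eval_hev]
    rw [← hu, ← hv, hxe]
    have e : ∀ φ : K[X], φ.natDegree ≤ d ^ m → hev (d ^ m) φ (y * v.eval x) (v.eval x) = (v.eval x) ^ (d ^ m) * φ.eval y := by
      intro φ hφ
      have := hev_smul (d ^ m) φ (v.eval x) y 1
      rw [mul_one, hev_eval_one _ hφ] at this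
      rw [mul_comm, this]
    rw [e _ hud, e _ hvd]
    linear_combination (v.eval x) ^ (d ^ m) * hye
  · intro Z
    rw [em]
    set M := m + m with hM
    obtain ⟨F, hF⟩ := finite_discs (A := A) (B := B) hρ (show ‖α - c‖ = ρ by rw [norm_sub_rev]; exact hc)
    have hfix : ∀ {t b s}, 0 < s → DMaps ((hstep d p q)^[M * t] Z).1 ((hstep d p q)^[M * t] Z).2 b s c0 r →
        ∀ t', t < t' → DMaps ((hstep d p q)^[M * t'] Z).1 ((hstep d p q)^[M * t'] Z).2 b s α ρ := by
      intro t b s hs h t' ht'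
      obtain ⟨l, rfl⟩ := Nat.exists_eq_add_of_lt ht'
      have h1 := iter_dmaps hs hr h h2D
      have h2 := iter_dmaps hs hρ h1 (hit_fix hρ h2ζ l)
      have e : M * (t + l + 1) = M * t + M + M * l := by ring
      rw [e]; exact h2
    have huniq : ∀ {t b s}, 0 < s → DMaps ((hstep d p q)^[M * t] Z).1 ((hstep d p q)^[M * t] Z).2 b s c0 r →
        ∀ t', t < t' → ¬ DMaps ((hstep d p q)^[M * t'] Z).1 ((hstep d p q)^[M * t'] Z).2 b s c0 r := by
      intro t b s hs h t' ht' h'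
      have h1 := (hfix hs h t' ht').2 c0
      rw [h'.2 c0, sub_self, norm_zero, max_eq_left hr.le] at h1
      have := mul_right_cancel₀ (dn_pos b hs h'.1).ne' h1
      have := le_max_left ρ ‖α - c0‖
      linarith
    have hT : ∃ T0, ∀ z ∈ F, 0 < z.2 → ∀ t, T0 ≤ t →
        ¬ DMaps ((hstep d p q)^[M * t] Z).1 ((hstep d p q)^[M * t] Z).2 z.1 z.2 c0 r := by
      have hz : ∀ z : K × ℝ, ∃ T, 0 < z.2 → ∀ t, T ≤ t →
          ¬ DMaps ((hstep d p q)^[M * t] Z).1 ((hstep d p q)^[M * t] Z).2 z.1 z.2 c0 r := by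
        intro z
        by_cases hex : ∃ t, 0 < z.2 ∧ DMaps ((hstep d p q)^[M * t] Z).1 ((hstep d p q)^[M * t] Z).2 z.1 z.2 c0 r
        · obtain ⟨t, h1, h2⟩ := hex
          exact ⟨t + 1, fun _ t' ht' => huniq h1 h2 t' (by omega)⟩
        · push Not at hex
          exact ⟨0, fun h t _ => hex t h⟩
      choose T hT using hz
      refine ⟨F.sup T, fun z hz h t ht => hT z h t (le_trans (Finset.le_sup hz) ht)⟩
    obtain ⟨T0, hT0⟩ := hT
    refine ⟨T0, fun t ht b s hs h => ?_⟩
    filter_upwards [eventually_gt_atTop t] with t' ht'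
    by_contra hn
    have hd' := hfix hs h t' ht'
    have g1 := degenerate_lt hs hd' hn hρ
    have g2 := degenerate_dmaps hs hd' hB g1
    obtain ⟨z, hz, hz1, hz2⟩ := hF b s hs g2
    refine hT0 z hz (by rw [hz1]; exact hs) t ht ?_
    rw [hz1]
    exact h.recenter_source hz2

end HelpersK

section HelpersL
set_option linter.unusedSectionVars false
variable {K : Type*} [NontriviallyNormedField K] [IsAlgClosed K] [IsUltrametricDist K]
variable {d : ℕ} {p q : K[X]}

lemma residue_pigeon {N : ℕ → Prop} (h : ∃ᶠ n in atTop, N n) {m : ℕ} (hm : 1 ≤ m) :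
    ∃ n0, N n0 ∧ ∃ᶠ t in atTop, N (n0 + m * t) := by
  have h1 : ∃ c < m, ∃ᶠ n in atTop, N n ∧ n % m = c := by
    by_contra hcon
    push Not at hcon
    have : ∀ᶠ n in atTop, ∀ c ∈ Finset.range m, ¬ (N n ∧ n % m = c) := by
      rw [Filter.eventually_all_finset]
      intro c hc
      have := hcon c (Finset.mem_range.1 hc)
      exact this.mono (fun n hn h => by first | exact hn h | exact hn h.1 h.2)
    obtain ⟨n, hn, hn2⟩ := (h.and_eventually this).exists
    exact hn2 (n % m) (Finset.mem_range.2 (Nat.mod_lt _ (by omega))) ⟨hn, rfl⟩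
  obtain ⟨c, hc, hfr⟩ := h1
  obtain ⟨n0, hn0, hn0c⟩ := hfr.exists
  refine ⟨n0, hn0, frequently_atTop.2 fun T => ?_⟩
  obtain ⟨n, hn, hnN, hnc⟩ := frequently_atTop.1 hfr (n0 + m * T)
  have hmod : n0 ≡ n [MOD m] := by rw [Nat.ModEq, hn0c, hnc]
  have hle : n0 ≤ n := by nlinarith [Nat.zero_le (m * T)]
  obtain ⟨t, ht⟩ := (Nat.modEq_iff_dvd' hle).1 hmod
  refine ⟨t, ?_, ?_⟩
  · have : m * T ≤ m * t := by omega
    exact Nat.le_of_mul_le_mul_left this (by omega)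
  · rw [← ht]
    have : n0 + (n - n0) = n := by omega
    rw [this]; exact hnN

lemma hev_coeff_top {D : ℕ} (p : K[X]) {u v : K[X]} (hu : u.natDegree ≤ D) (hv : v.natDegree ≤ D) :
    (hev d p u v).coeff (D * d) = hev d p (u.coeff D) (v.coeff D) := by
  rw [hev_sum, hev_sum, finset_sum_coeff]
  refine Finset.sum_congr rfl fun i hi => ?_
  have hi' : i ≤ d := by rw [Finset.mem_range] at hi; omega
  have e : D * d = i * D + (d - i) * D := by rw [← add_mul, mul_comm]; congr 1; omega
  have h1 : (algebraMap K K[X] (p.coeff i)) = C (p.coeff i) := rfl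
  rw [h1, coeff_C_mul, e, coeff_mul_add_eq_of_natDegree_le (natDegree_pow_le_of_le i hu)
    (natDegree_pow_le_of_le (d - i) hv), coeff_pow_of_natDegree_le hu, coeff_pow_of_natDegree_le hv]
  rfl

lemma hstep_coeff_top {D : ℕ} {z : K[X] × K[X]} (h1 : z.1.natDegree ≤ D) (h2 : z.2.natDegree ≤ D) (n : ℕ) :
    (((hstep d p q)^[n] z).1.coeff (D * d ^ n), ((hstep d p q)^[n] z).2.coeff (D * d ^ n)) =
      (hstep d p q)^[n] (z.1.coeff D, z.2.coeff D) := by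
  induction n with
  | zero => simp
  | succ n ih =>
    obtain ⟨g1, g2⟩ := hstep_iter_natDegree (d := d) (p := p) (q := q) h1 h2 n
    rw [Function.iterate_succ_apply', Function.iterate_succ_apply', ← ih, pow_succ, ← mul_assoc]
    simp only [hstep]
    rw [hev_coeff_top _ g1 g2, hev_coeff_top _ g1 g2]

set_option maxHeartbeats 4000000 in
theorem core (hd : 2 ≤ d) (hnv : ∀ x y : K, hev d p x y = 0 → hev d q x y = 0 → x = 0 ∧ y = 0)
    {P0 Q0 : K[X]} (hP0 : P0.natDegree ≤ 1) (hQ0 : Q0.natDegree ≤ 1)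
    (h0 : ∀ x, P0.eval x ≠ 0 ∨ Q0.eval x ≠ 0) (h0' : P0.coeff 1 ≠ 0 ∨ Q0.coeff 1 ≠ 0)
    {A B : K[X]} (hA : A ≠ 0) (hB : B ≠ 0) (hAB : B.natDegree < A.natDegree)
    {N : ℕ → Prop} (hN : ∃ᶠ n in atTop, N n) {Cc ε : ℝ} (hC : 0 ≤ Cc) (hε : 0 < ε)
    (hpt : ∀ n, N n → ∀ x : K, 1 ≤ ‖x‖ →
      ‖(((hstep d p q)^[n] (P0, Q0)).1 * B - ((hstep d p q)^[n] (P0, Q0)).2 * A).eval x‖ ≤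
      Cc * Real.exp (-ε * (d : ℝ) ^ n) *
        max ‖((hstep d p q)^[n] (P0, Q0)).1.eval x‖ ‖((hstep d p q)^[n] (P0, Q0)).2.eval x‖ *
        max ‖A.eval x‖ ‖B.eval x‖)
    (hPGR : ∀ α w : K, w ≠ 0 →
      ¬ ∃ c, 0 < c ∧ ∀ z : K × K, dnrm α ‖w‖ (hstep d p q z) = c * dnrm α ‖w‖ z ^ d) : False := by
  obtain ⟨S, κ, k, F⟩ := exists_frame hA hB hAB
  set S2 := S + 1 with hS2
  have hS1 := F.hS1
  set R := κ * S ^ k with hR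
  set R2 := κ * S2 ^ k with hR2
  have hRR2 : R < R2 := F.lt le_rfl (by linarith)
  have hR1 : 1 ≤ R := F.hκ1
  set δ : ℕ → ℝ := fun n => Cc * Real.exp (-ε * (d : ℝ) ^ n) with hδ
  have hδ0 : ∀ n, 0 ≤ δ n := fun n => by simp only [hδ]; positivity
  have hlim : Tendsto (fun n => δ n * R2 ^ 2) atTop (𝓝 0) := by
    have h1 : Tendsto (fun n : ℕ => (d : ℝ) ^ n) atTop atTop :=
      tendsto_pow_atTop_atTop_of_one_lt (by exact_mod_cast (by omega : 1 < d))
    have h2 : Tendsto (fun n : ℕ => -ε * (d : ℝ) ^ n) atTop atBot :=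
      h1.const_mul_atTop_of_neg (by linarith)
    have h3 := (Real.tendsto_exp_atBot.comp h2)
    have h4 := (h3.const_mul Cc).mul_const (R2 ^ 2)
    simpa [hδ] using h4
  have hevt : ∀ᶠ n in atTop, δ n * R2 ^ 2 < 1 := hlim.eventually_lt_const one_pos
  set Ps : ℕ → K[X] × K[X] := fun n => (hstep d p q)^[n] (P0, Q0) with hPs
  have hPsd : ∀ n, (Ps n).1.natDegree ≤ d ^ n ∧ (Ps n).2.natDegree ≤ d ^ n := by
    intro n
    have := hstep_iter_natDegree (d := d) (p := p) (q := q) (z := (P0, Q0)) hP0 hQ0 n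
    simpa using this
  have hPsnv : ∀ n x, (Ps n).1.eval x ≠ 0 ∨ (Ps n).2.eval x ≠ 0 := by
    intro n x
    have hz : (P0.eval x, Q0.eval x) ≠ 0 := by
      intro h
      rcases h0 x with h1 | h1
      · exact h1 (congrArg Prod.fst h)
      · exact h1 (congrArg Prod.snd h)
    have h := hstep_iter_ne hnv hz n
    rw [hstep_iter_eval n (P0, Q0)] at h
    by_contra hc
    push Not at hc
    exact h (Prod.ext hc.1 hc.2)
  have hPsc : ∀ n, (Ps n).1.coeff (d ^ n) ≠ 0 ∨ (Ps n).2.coeff (d ^ n) ≠ 0 := by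
    intro n
    have hz : (P0.coeff 1, Q0.coeff 1) ≠ 0 := by
      intro h
      rcases h0' with h1 | h1
      · exact h1 (congrArg Prod.fst h)
      · exact h1 (congrArg Prod.snd h)
    have h := hstep_iter_ne hnv hz n
    rw [← hstep_coeff_top (z := (P0, Q0)) hP0 hQ0 n, one_mul] at h
    by_contra hc
    push Not at hc
    exact h (Prod.ext hc.1 hc.2)
  set N' : ℕ → Prop := fun n => N n ∧ δ n * R2 ^ 2 < 1 with hN'
  have hN'f : ∃ᶠ n in atTop, N' n := hN.and_eventually hevt
  have hclose : ∀ n, N' n → ∀ s, S ≤ s → s ≤ S2 → DMaps (Ps n).1 (Ps n).2 0 s 0 (κ * s ^ k) ∧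
      dn 0 s ((Ps n).1 * B - (Ps n).2 * A) ≤ δ n * R2 ^ 2 * (dn 0 s (Ps n).2 * dn 0 s B) := by
    intro n hn s h1 h2
    refine F.close (hδ0 n) hn.2 ?_ (hpt n hn.1) h1 h2
    rcases hPsnv n 0 with h | h
    · left; intro h'; rw [h'] at h; simp at h
    · right; intro h'; rw [h'] at h; simp at h
  have hpw : ∀ n, N' n → ∀ γ, ‖γ‖ ≤ R → ((Ps n).1 - C γ * (Ps n).2).natDegree = d ^ n ∧
      ∀ x ∈ ((Ps n).1 - C γ * (Ps n).2).roots, ‖x‖ ≤ S := by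
    intro n hn γ hγ
    refine F.pw (hδ0 n) ?_ (hPsd n).1 (hPsd n).2 (hPsnv n) (hPsc n) (hpt n hn.1) hγ
    refine lt_of_le_of_lt ?_ hn.2
    have := hδ0 n
    have : R ≤ R2 ^ 2 := by nlinarith
    gcongr
  -- two times
  obtain ⟨n0, hn0⟩ := hN'f.exists
  obtain ⟨n1, hn1, hn1N⟩ := frequently_atTop.1 hN'f (n0 + 1)
  obtain ⟨per0, rfl⟩ := Nat.exists_eq_add_of_le hn1
  obtain ⟨per, hper⟩ : ∃ per, per = per0 + 1 := ⟨_, rfl⟩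
  have hper1 : 1 ≤ per := by omega
  have en : n0 + 1 + per0 = per + n0 := by omega
  rw [en] at hn1N
  have hcomp : Ps (per + n0) = (hev (d ^ per) (hit d p q per).1 (Ps n0).1 (Ps n0).2,
      hev (d ^ per) (hit d p q per).2 (Ps n0).1 (Ps n0).2) := by
    simp only [hPs]
    rw [Function.iterate_add_apply, hstep_iter per]
  have hst1 := step1 (P := (Ps n0).1) (Q := (Ps n0).2) (p := (hit d p q per).1) (q := (hit d p q per).2)
    (N := d ^ per) (E := d ^ n0) (S := S) (S2 := S2) (by linarith) (by linarith) F.hκ F.hk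
    (hit_natDegree per).1 (hit_natDegree per).2
    (by
      have h := (hpw n0 hn0 0 (by rw [norm_zero]; linarith)).1
      intro h'
      rw [h'] at h
      have : 0 < d ^ n0 := by positivity
      simp at h
      omega)
    (fun s h1 h2 => (hclose n0 hn0 s h1 h2).1)
    (fun s h1 h2 => by have := (hclose _ hn1N s h1 h2).1; rw [hcomp] at this; exact this)
    (by have := hpw n0 hn0 0 (by rw [norm_zero]; linarith); simpa using this)
    (fun γ hγ => by
      have := hpw _ hn1N γ hγ
      rw [hcomp] at this
      have e2 : d ^ (per + n0) = d ^ n0 * d ^ per := by rw [pow_add, mul_comm]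
      rw [e2] at this
      exact this)
  obtain ⟨hst1a, hst1b⟩ := hst1
  have hdN : 2 ≤ d ^ per := by
    calc 2 ≤ d := hd
      _ = d ^ 1 := (pow_one d).symm
      _ ≤ d ^ per := Nat.pow_le_pow_right (by omega) hper1
  obtain ⟨α, c, ρ, L, hρ, hL, hρR, hαR, hc, hζ, hdn, hqα, hqc, hV⟩ :=
    step2 hdN (by linarith) hRR2 (hit_natDegree per).2 (hit_nv hnv per) hst1a hst1b
  have hEng : Engine d p q A B per R := by
    by_cases hcase : ∀ j, 1 ≤ j → ρ * dn α ρ (hit d p q (per * j)).2 ≤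
      dn α ρ ((hit d p q (per * j)).1 - X * (hit d p q (per * j)).2)
    · refine engineA hd hnv hB hper1 hρ hL hρR hαR hc ?_ hζ hdn hV hcase
      have := hPGR α (c - α) (by rw [← norm_pos_iff, hc]; exact hρ)
      rwa [hc] at this
    · push Not at hcase
      obtain ⟨j, hj, hlt⟩ := hcase
      exact engineB hnv hB hρ hρR hαR hc hζ hqα hqc hV hj hlt
  obtain ⟨j, hj, c0, α', w, r, ρ', hr, hρ', hc0R, hrR, hα'R, hρ'R, hw, hz, hζ', hcov, hND⟩ := hEng
  obtain ⟨m, hm⟩ : ∃ m, m = per * j := ⟨_, rfl⟩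
  rw [← hm] at hz hζ' hcov hND
  have hm1 : 1 ≤ m := hm ▸ Nat.mul_pos hper1 hj
  obtain ⟨n2, hn2, hfr⟩ := residue_pigeon hN'f hm1
  have hiter : ∀ t, (hstep d p q)^[m * t] (Ps n2) = Ps (n2 + m * t) := by
    intro t
    simp only [hPs]
    rw [← Function.iterate_add_apply, add_comm]
  have hM : 2 ≤ d ^ m := by
    calc 2 ≤ d := hd
      _ = d ^ 1 := (pow_one d).symm
      _ ≤ d ^ m := Nat.pow_le_pow_right (by omega) hm1
  have epow : ∀ t, d ^ n2 * (d ^ m) ^ t = d ^ (n2 + m * t) := by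
    intro t; rw [pow_add, pow_mul]
  have hstepP : ∀ t, (hstep d p q)^[m * (t + 1)] (Ps n2) =
      (hev (d ^ m) (hit d p q m).1 ((hstep d p q)^[m * t] (Ps n2)).1 ((hstep d p q)^[m * t] (Ps n2)).2,
       hev (d ^ m) (hit d p q m).2 ((hstep d p q)^[m * t] (Ps n2)).1 ((hstep d p q)^[m * t] (Ps n2)).2) := by
    intro t
    have : m * (t + 1) = m + m * t := by ring
    rw [this, Function.iterate_add_apply, hstep_iter m]
  have hR2fix : DMaps (hit d p q per).1 (hit d p q per).2 0 R2 0 R2 := hst1a R2 hRR2.le le_rfl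
  refine final_estimate (K := K) hM (u := (hit d p q m).1) (v := (hit d p q m).2) (hit_natDegree m).1
    (hit_natDegree m).2 (P := fun t => ((hstep d p q)^[m * t] (Ps n2)).1)
    (Q := fun t => ((hstep d p q)^[m * t] (Ps n2)).2) (fun t => by simp only [hstepP])
    (fun t => by simp only [hstepP]) (D := d ^ n2) (Nat.one_le_pow _ _ (by omega))
    (fun t => by rw [epow, hiter]; exact (hPsd _).1) (fun t => by rw [epow, hiter]; exact (hPsd _).2)
    (fun t x => by simp only [hiter]; exact hPsnv _ x) (A := A) hB (S := S) (S' := S2) (R := R) (R' := R2)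
    (by linarith) (by linarith) hRR2 hr hρ' hc0R hrR hα'R hρ'R hw hz hζ' hcov hfr ?_ ?_
    (Cc := Cc * R2 ^ 2 * dn 0 S2 B) hε ?_ (hND (Ps n2))
  · intro t
    have h1 := (hclose n2 hn2 S2 (by linarith) le_rfl).1
    have hS2p : 0 < S2 := by linarith
    have hR2p : 0 < R2 := by linarith
    have h2 := iter_dmaps (d := d) (p := p) (q := q) (Z := Ps n2) (n := 0) hS2p hR2p h1 (hit_fix hR2p hR2fix (j * t))
    show DMaps ((hstep d p q)^[m * t] (Ps n2)).1 ((hstep d p q)^[m * t] (Ps n2)).2 0 S2 0 R2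
    have e : m * t = 0 + per * (j * t) := by rw [hm]; ring
    rw [e]; exact h2
  · intro t ht γ hγ
    simp only [hiter]
    rw [epow]
    exact hpw _ ht γ hγ
  · intro t ht
    simp only [hiter]
    have h1 := (hclose _ ht S2 (by linarith) le_rfl).2
    refine h1.trans (le_of_eq ?_)
    have : ((d ^ n2 : ℕ) : ℝ) * ((d ^ m : ℕ) : ℝ) ^ t = (d : ℝ) ^ (n2 + m * t) := by
      have := congrArg (Nat.cast : ℕ → ℝ) (epow t)
      push_cast at this ⊢
      exact this
    rw [this]
    simp only [hδ]
    ring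

end HelpersL

section HelpersM
set_option linter.unusedSectionVars false
variable {K : Type*} [NontriviallyNormedField K] [IsAlgClosed K] [CompleteSpace K] [IsUltrametricDist K]

/-- `z` is a homogeneous representative of the point `x`. -/
def PRep (x : OnePoint K) (z : K × K) : Prop :=
  ∃ l : K, l ≠ 0 ∧ z = (l * (homCoord K x).1, l * (homCoord K x).2)

lemma homCoord_coe (a : K) : homCoord K (a : OnePoint K) = (a, 1) := rfl
lemma homCoord_infty : homCoord K OnePoint.infty = (1, 0) := rfl

lemma rep_coe (a : K) : PRep (a : OnePoint K) (a, 1) := ⟨1, one_ne_zero, by simp [homCoord_coe]⟩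

lemma PRep.smul {x : OnePoint K} {z : K × K} (h : PRep x z) {l : K} (hl : l ≠ 0) :
    PRep x (l * z.1, l * z.2) := by
  obtain ⟨m, hm, rfl⟩ := h
  exact ⟨l * m, mul_ne_zero hl hm, by simp [mul_assoc]⟩

lemma exists_rep {z : K × K} (hz : z ≠ 0) : ∃ x : OnePoint K, PRep x z := by
  by_cases h : z.2 = 0
  · refine ⟨OnePoint.infty, z.1, ?_, ?_⟩
    · intro h1; exact hz (Prod.ext h1 h)
    · ext <;> simp [homCoord_infty, h]
  · refine ⟨((z.1 / z.2 : K) : OnePoint K), z.2, h, ?_⟩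
    ext
    · simp [homCoord_coe]; field_simp
    · simp [homCoord_coe]

lemma PRep.ne {x : OnePoint K} {z : K × K} (h : PRep x z) : z ≠ 0 := by
  obtain ⟨m, hm, rfl⟩ := h
  intro h0
  induction x using OnePoint.rec with
  | infty => simp [homCoord_infty] at h0; exact hm h0
  | coe a =>
    have := congrArg Prod.snd h0
    simp [homCoord_coe] at this; exact hm this

lemma max_norm_pos {z : K × K} (h : z ≠ 0) : 0 < max ‖z.1‖ ‖z.2‖ := by
  by_contra hc
  push Not at hc
  have h1 := (le_max_left _ _).trans hc
  have h2 := (le_max_right _ _).trans hc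
  exact h (Prod.ext (norm_le_zero_iff.1 h1) (norm_le_zero_iff.1 h2))

lemma chordal_rep {x y : OnePoint K} {z u : K × K} (hz : PRep x z) (hu : PRep y u) :
    ‖z.1 * u.2 - z.2 * u.1‖ = chordal K x y * max ‖z.1‖ ‖z.2‖ * max ‖u.1‖ ‖u.2‖ := by
  have hx : PRep x (homCoord K x) := ⟨1, one_ne_zero, by simp⟩
  have hy : PRep y (homCoord K y) := ⟨1, one_ne_zero, by simp⟩
  have px := max_norm_pos hx.ne
  have py := max_norm_pos hy.ne
  obtain ⟨l, hl, rfl⟩ := hz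
  obtain ⟨m, hm, rfl⟩ := hu
  simp only [chordal, norm_mul]
  rw [← mul_max_of_nonneg _ _ (norm_nonneg l), ← mul_max_of_nonneg _ _ (norm_nonneg m)]
  have : l * (homCoord K x).1 * (m * (homCoord K y).2) - l * (homCoord K x).2 * (m * (homCoord K y).1)
    = l * m * ((homCoord K x).1 * (homCoord K y).2 - (homCoord K x).2 * (homCoord K y).1) := by ring
  rw [this, norm_mul, norm_mul]
  field_simp

lemma chordal_le_one (x y : OnePoint K) : chordal K x y ≤ 1 := by
  unfold chordal
  apply div_le_one_of_le₀
  · rw [sub_eq_add_neg]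
    refine (IsUltrametricDist.norm_add_le_max _ _).trans ?_
    rw [norm_neg, norm_mul, norm_mul]
    apply max_le
    · gcongr
      · exact le_max_left _ _
      · exact le_max_right _ _
    · gcongr
      · exact le_max_right _ _
      · exact le_max_left _ _
  · positivity

lemma hev_one_zero (d : ℕ) (p : K[X]) : hev d p (1 : K) 0 = p.coeff d := by
  rw [hev_sum, Finset.sum_eq_single d]
  · simp
  · intro i hi hid
    rw [Finset.mem_range] at hi
    have : d - i ≠ 0 := by omega
    simp [this]
  · simp

lemma num_le (h : RatFunc K) : h.num.natDegree ≤ rdeg K h := le_max_left _ _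
lemma denom_le (h : RatFunc K) : h.denom.natDegree ≤ rdeg K h := le_max_right _ _

lemma eval_num_ne (h : RatFunc K) {a : K} (ha : h.denom.eval a = 0) : h.num.eval a ≠ 0 := by
  have := aeval_ne_zero_of_isCoprime h.isCoprime_num_denom a
  simp only [coe_aeval_eq_eval, ha] at this
  simpa using this

lemma rep_eval (h : RatFunc K) {x : OnePoint K} {z : K × K} (hz : PRep x z) :
    PRep (evalP1 K h x) (hstep (rdeg K h) h.num h.denom z) := by
  obtain ⟨l, hl, rfl⟩ := hz
  simp only [hstep]
  rw [hev_smul, hev_smul]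
  refine PRep.smul (z := (hev (rdeg K h) h.num (homCoord K x).1 (homCoord K x).2,
    hev (rdeg K h) h.denom (homCoord K x).1 (homCoord K x).2)) ?_ (pow_ne_zero _ hl)
  induction x using OnePoint.rec with
  | infty =>
    simp only [homCoord_infty, hev_one_zero]
    have e : evalP1 K h OnePoint.infty = if h.denom.natDegree < h.num.natDegree then OnePoint.infty
      else ((h.num.coeff h.denom.natDegree / h.denom.leadingCoeff : K) : OnePoint K) := rfl
    rw [e]
    split_ifs with hlt
    · have hr : rdeg K h = h.num.natDegree := max_eq_left hlt.le
      rw [hr, coeff_eq_zero_of_natDegree_lt hlt]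
      refine ⟨h.num.leadingCoeff, ?_, by simp [homCoord_infty]⟩
      intro h0
      rw [leadingCoeff_eq_zero] at h0
      rw [h0] at hlt; simp at hlt
    · have hr : rdeg K h = h.denom.natDegree := max_eq_right (by omega)
      rw [hr]
      have h0 : h.denom.leadingCoeff ≠ 0 := leadingCoeff_ne_zero.2 h.denom_ne_zero
      refine ⟨h.denom.leadingCoeff, h0, ?_⟩
      simp only [homCoord_coe]
      ext
      · simp only []; field_simp
      · simp
  | coe a =>
    simp only [homCoord_coe]
    rw [hev_eval_one _ (num_le h), hev_eval_one _ (denom_le h)]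
    have e : evalP1 K h (a : OnePoint K) = if h.denom.eval a = 0 then OnePoint.infty
      else ((h.num.eval a / h.denom.eval a : K) : OnePoint K) := rfl
    rw [e]
    split_ifs with h0
    · exact ⟨h.num.eval a, eval_num_ne h h0, by simp [homCoord_infty, h0]⟩
    · refine ⟨h.denom.eval a, h0, ?_⟩
      simp only [homCoord_coe]
      ext
      · simp only []; field_simp
      · simp

lemma rep_iter (h : RatFunc K) {x : OnePoint K} {z : K × K} (hz : PRep x z) (n : ℕ) :
    PRep ((evalP1 K h)^[n] x) ((hstep (rdeg K h) h.num h.denom)^[n] z) := by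
  induction n with
  | zero => simpa using hz
  | succ n ih =>
    rw [Function.iterate_succ_apply', Function.iterate_succ_apply']
    exact rep_eval h ih

lemma lift_nv (h : RatFunc K) {z : K × K} (hz : hstep (rdeg K h) h.num h.denom z = 0) : z = 0 := by
  by_contra hne
  obtain ⟨x, hx⟩ := exists_rep hne
  exact (rep_eval h hx).ne hz

/-- coordinate change `v ↦ 1/(v - w)` -/
def Tm (w : K) (z : K × K) : K × K := (z.2, z.1 - w * z.2)

/-- conjugated pair -/
noncomputable def cp (d : ℕ) (f1 : K[X]) (w : K) : K[X] := hev d f1 (C w * X + 1) X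
noncomputable def cq (d : ℕ) (f0 f1 : K[X]) (w : K) : K[X] :=
  hev d f0 (C w * X + 1) X - C w * cp d f1 w

lemma hev_lin (d : ℕ) (p : K[X]) (a b c e x y : K) :
    hev d (hev d p (C a * X + C b) (C c * X + C e)) x y = hev d p (a * x + b * y) (c * x + e * y) := by
  have h1 : ∀ a b : K, (C a * X + C b : K[X]).natDegree ≤ 1 := fun a b => natDegree_linear_le
  have h2 : ∀ a b : K, hev 1 (C a * X + C b) x y = a * x + b * y := by
    intro a b
    rw [hev_add, hev_C_mul, hev_X, ← mul_one (C b), hev_C_mul, hev_one]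
    simp
  have := hev_comp (d := d) p (h1 a b) (h1 c e) x y
  rw [one_mul, h2, h2] at this
  exact this.symm

lemma hstep_Tm (d : ℕ) (f0 f1 : K[X]) (w : K) (z : K × K) :
    hstep d (cp d f1 w) (cq d f0 f1 w) (Tm w z) = Tm w (hstep d f0 f1 z) := by
  have key : ∀ p : K[X], hev d (hev d p (C w * X + 1) X) (Tm w z).1 (Tm w z).2 = hev d p z.1 z.2 := by
    intro p
    have := hev_lin d p w 1 1 0 (Tm w z).1 (Tm w z).2
    simp only [map_one, map_zero, one_mul, add_zero, zero_mul] at this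
    rw [this]
    simp [Tm]
  simp only [hstep, cq, cp]
  rw [hev_sub, hev_C_mul, key, key]
  rfl

lemma hstep_iter_Tm (d : ℕ) (f0 f1 : K[X]) (w : K) (z : K × K) (n : ℕ) :
    (hstep d (cp d f1 w) (cq d f0 f1 w))^[n] (Tm w z) = Tm w ((hstep d f0 f1)^[n] z) := by
  induction n with
  | zero => rfl
  | succ n ih => rw [Function.iterate_succ_apply', Function.iterate_succ_apply', ih, hstep_Tm]

lemma Tm_surj (w : K) (y : K × K) : Tm w (w * y.1 + y.2, y.1) = y := by
  simp [Tm]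

lemma Tm_norm (w : K) (z : K × K) : max ‖z.1‖ ‖z.2‖ ≤ max 1 ‖w‖ * max ‖(Tm w z).1‖ ‖(Tm w z).2‖ := by
  have e : z.1 = (Tm w z).2 + w * (Tm w z).1 := by simp [Tm]
  have e2 : z.2 = (Tm w z).1 := rfl
  apply max_le
  · rw [e]
    refine (IsUltrametricDist.norm_add_le_max _ _).trans (max_le ?_ ?_)
    · refine (one_mul _).symm.le.trans ?_
      exact mul_le_mul (le_max_left _ _) (le_max_right _ _) (norm_nonneg _) (by positivity)
    · rw [norm_mul]
      exact mul_le_mul (le_max_right _ _) (le_max_left _ _) (norm_nonneg _) (by positivity)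
  · rw [e2]
    refine (one_mul _).symm.le.trans ?_
    exact mul_le_mul (le_max_left _ _) (le_max_left _ _) (norm_nonneg _) (by positivity)

lemma exists_ball {D : Set (OnePoint K)} (hD : IsOpen D) (hne : D.Nonempty) {r : K[X]} (hr : r ≠ 0) :
    ∃ a ϖ : K, ϖ ≠ 0 ∧ r.eval a ≠ 0 ∧ ∀ v : K, ‖v - a‖ ≤ ‖ϖ‖ → (v : OnePoint K) ∈ D := by
  have hO : IsOpen ((fun v : K => (v : OnePoint K)) ⁻¹' D) := hD.preimage OnePoint.continuous_coe
  have hNC : NoncompactSpace K := by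
    refine ⟨fun hc => ?_⟩
    obtain ⟨x, hx⟩ := NormedField.exists_lt_norm K (Classical.choose hc.isBounded.exists_norm_le)
    have := Classical.choose_spec hc.isBounded.exists_norm_le x (Set.mem_univ _)
    linarith
  obtain ⟨b, hb⟩ : ((fun v : K => (v : OnePoint K)) ⁻¹' D).Nonempty := by
    obtain ⟨x, hx, y, rfl⟩ := (OnePoint.denseRange_coe (X := K)).exists_mem_open hD hne |>.elim
      (fun a ha => (⟨(a : OnePoint K), ha, a, rfl⟩ : ∃ x, x ∈ D ∧ ∃ y : K, (y : OnePoint K) = x))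
    exact ⟨y, hx⟩
  have hinf : {x : K | r.eval x ≠ 0} ∈ 𝓝[≠] b := by
    refine nhdsNE_le_cofinite b ?_
    rw [mem_cofinite]
    refine (r.roots.toFinset.finite_toSet).subset ?_
    intro x hx
    simp only [Set.mem_compl_iff, Set.mem_ofPred_eq, not_not] at hx
    simp [hr, hx]
  have hO' : IsOpen (((fun v : K => (v : OnePoint K)) ⁻¹' D) ∩ {x | r.eval x ≠ 0}) :=
    hO.inter (isOpen_ne_fun r.continuous continuous_const)
  have hne' : (((fun v : K => (v : OnePoint K)) ⁻¹' D) ∩ {x | r.eval x ≠ 0}).Nonempty := by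
    have h1 : ((fun v : K => (v : OnePoint K)) ⁻¹' D) ∈ 𝓝[≠] b := mem_nhdsWithin_of_mem_nhds (hO.mem_nhds hb)
    exact (𝓝[≠] b).nonempty_of_mem (inter_mem h1 hinf)
  obtain ⟨a, ha⟩ := hne'
  obtain ⟨ρ, hρ, hball⟩ := Metric.isOpen_iff.1 hO' a ha
  obtain ⟨ϖ, h1, h2⟩ := NormedField.exists_norm_lt K hρ
  refine ⟨a, ϖ, norm_pos_iff.1 h1, ha.2, fun v hv => ?_⟩
  exact (hball (show v ∈ Metric.ball a ρ by rw [Metric.mem_ball, dist_eq_norm]; linarith)).1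

end HelpersM

section HelpersN
set_option linter.unusedSectionVars false
variable {K : Type*} [NontriviallyNormedField K] [IsAlgClosed K] [CompleteSpace K] [IsUltrametricDist K]

lemma rcomp_eq {h : RatFunc K} {P Q : K[X]} (hQ : Q ≠ 0)
    (hh : h = algebraMap K[X] (RatFunc K) P / algebraMap K[X] (RatFunc K) Q) (g : RatFunc K)
    (hg : aeval g Q ≠ 0) : rcomp K h g = aeval g P / aeval g Q := by
  have h1 := (RatFunc.num_mul_eq_mul_denom_iff hQ).2 hh
  have h2 : h.denom ∣ Q := by rw [hh]; exact RatFunc.denom_div_dvd P Q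
  have h3 : aeval g h.denom ≠ 0 := by
    obtain ⟨c, rfl⟩ := h2
    rw [map_mul] at hg
    exact left_ne_zero_of_mul hg
  have h4 := congrArg (aeval g) h1
  rw [map_mul, map_mul] at h4
  have : rcomp K h g = aeval g h.num / aeval g h.denom := rfl
  rw [this, div_eq_div_iff h3 hg, h4]

lemma rdeg_eq {h : RatFunc K} {P Q : K[X]} (hQ : Q ≠ 0) (hc : IsCoprime P Q)
    (hh : h = algebraMap K[X] (RatFunc K) P / algebraMap K[X] (RatFunc K) Q) :
    max P.natDegree Q.natDegree = rdeg K h := by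
  have h1 := (RatFunc.num_mul_eq_mul_denom_iff hQ).2 hh
  have hc' := h.isCoprime_num_denom
  have a1 : Associated h.num P := by
    apply associated_of_dvd_dvd
    · exact hc'.dvd_of_dvd_mul_right (h1 ▸ dvd_mul_right _ _)
    · exact hc.dvd_of_dvd_mul_right (h1.symm ▸ dvd_mul_right _ _)
  have a2 : Associated h.denom Q := by
    apply associated_of_dvd_dvd
    · exact hc'.symm.dvd_of_dvd_mul_left (h1.symm ▸ dvd_mul_left _ _)
    · exact hc.symm.dvd_of_dvd_mul_left (h1 ▸ dvd_mul_left _ _)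
  rw [rdeg, natDegree_eq_of_degree_eq (degree_eq_degree_of_associated a1),
    natDegree_eq_of_degree_eq (degree_eq_degree_of_associated a2)]

lemma aeval_div_hev {d : ℕ} {p : K[X]} (hp : p.natDegree ≤ d) {F : Type*} [Field F] [Algebra K F]
    (u : F) {v : F} (hv : v ≠ 0) : aeval (u / v) p = hev d p u v / v ^ d := by
  rw [eq_div_iff (pow_ne_zero _ hv), hev_sum, aeval_eq_sum_range' (n := d + 1) (by omega), Finset.sum_mul]
  refine Finset.sum_congr rfl fun i hi => ?_
  rw [Finset.mem_range] at hi
  rw [Algebra.smul_def, div_pow, mul_assoc]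
  congr 1
  have : v ^ d = v ^ i * v ^ (d - i) := by rw [← pow_add]; congr 1; omega
  rw [this]
  field_simp

lemma coprime_of_norm {P Q : K[X]} (h : ∀ x : K, P.eval x ≠ 0 ∨ Q.eval x ≠ 0) : IsCoprime P Q := by
  refine (isCoprime_iff_aeval_ne_zero_of_isAlgClosed _ K P Q).2 ?_
  simpa [coe_aeval_eq_eval] using h

/-- coprimality of the reductions -/
lemma coprime_red {k : Type*} [Field k] (π : intRing K →+* k) (hs : Function.Surjective π)
    (hker : ∀ x, π x = 0 ↔ ‖(x : K)‖ < 1) {P Q : (intRing K)[X]}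
    (h : ∀ x : intRing K, ‖((P.eval x : intRing K) : K)‖ = 1 ∨ ‖((Q.eval x : intRing K) : K)‖ = 1) :
    IsCoprime (P.map π) (Q.map π) := by
  have hac : IsAlgClosed k := by
    refine IsAlgClosed.of_exists_root k fun p hm hirr => ?_
    have hl : p ∈ lifts π := by
      rw [lifts_iff_coeff_lifts]
      intro n
      obtain ⟨y, hy⟩ := hs (p.coeff n)
      exact ⟨y, hy⟩
    obtain ⟨r, hr, hdeg, hrm⟩ := lifts_and_natDegree_eq_and_monic hl hm
    have hrm' : (r.map (intRing K).subtype).Monic := hrm.map _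
    have hdeg' : (r.map (intRing K).subtype).degree ≠ 0 := by
      rw [hrm.degree_map]
      rw [hrm.degree_map π |>.symm, hr]
      exact hirr.degree_pos.ne'
    obtain ⟨x, hx⟩ := IsAlgClosed.exists_root _ hdeg'
    have hx1 : ‖x‖ ≤ 1 := by
      by_contra hgt
      push Not at hgt
      rw [IsRoot, hrm'.as_sum, eval_add, eval_pow, eval_X, eval_finset_sum] at hx
      set n := (r.map (intRing K).subtype).natDegree with hn
      have hn0 : n ≠ 0 := fun h0 => hdeg' (by
        rw [degree_eq_natDegree hrm'.ne_zero, ← hn, h0]; rfl)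
      have hb : ‖∑ i ∈ Finset.range n, eval x (C ((r.map (intRing K).subtype).coeff i) * X ^ i)‖ ≤
          ‖x‖ ^ (n - 1) := by
        refine IsUltrametricDist.norm_sum_le_of_forall_le_of_nonneg (by positivity) fun i hi => ?_
        rw [Finset.mem_range] at hi
        rw [eval_mul, eval_C, eval_pow, eval_X, norm_mul, norm_pow, coeff_map]
        have h1 : ‖(intRing K).subtype (r.coeff i)‖ ≤ 1 := (r.coeff i).2
        calc _ ≤ 1 * ‖x‖ ^ (n - 1) :=
              mul_le_mul h1 (pow_le_pow_right₀ hgt.le (by omega)) (by positivity) zero_le_one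
          _ = _ := one_mul _
      rw [eq_neg_of_add_eq_zero_right hx, norm_neg, norm_pow] at hb
      have := pow_lt_pow_right₀ hgt (by omega : n - 1 < n)
      linarith
    refine ⟨π ⟨x, hx1⟩, ?_⟩
    have h1 : r.eval (⟨x, hx1⟩ : intRing K) = 0 := by
      apply Subtype.ext
      have h2 := eval₂_at_apply (p := r) (intRing K).subtype (⟨x, hx1⟩ : intRing K)
      rw [IsRoot, eval_map] at hx
      exact h2.symm.trans hx
    rw [← hr, eval_map, eval₂_at_apply, h1, map_zero]
  refine (isCoprime_iff_aeval_ne_zero_of_isAlgClosed _ k _ _).2 ?_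
  intro a
  obtain ⟨x, rfl⟩ := hs a
  simp only [coe_aeval_eq_eval, eval_map, eval₂_at_apply]
  rcases h x with h | h
  · left; rw [Ne, hker, h]; exact lt_irrefl _
  · right; rw [Ne, hker, h]; exact lt_irrefl _

lemma maxIdeal_isMaximal : (maxIdeal K).IsMaximal := by
  rw [Ideal.isMaximal_iff]
  constructor
  · intro h
    have : ‖((1 : intRing K) : K)‖ < 1 := h
    simp at this
  · intro J x hJ hx hxJ
    have hx1 : ¬ ‖(x : K)‖ < 1 := hx
    have hxle : ‖(x : K)‖ ≤ 1 := x.2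
    have hxe : ‖(x : K)‖ = 1 := le_antisymm hxle (not_lt.1 hx1)
    have hx0 : (x : K) ≠ 0 := by rw [← norm_pos_iff, hxe]; exact one_pos
    have hi : ‖(x : K)⁻¹‖ ≤ 1 := by rw [norm_inv, hxe]; simp
    have : (1 : intRing K) = ⟨(x : K)⁻¹, hi⟩ * x := by
      apply Subtype.ext
      show (1 : K) = (x : K)⁻¹ * x
      rw [inv_mul_cancel₀ hx0]
    rw [this]
    exact J.mul_mem_left _ hxJ

lemma red_coprime {P Q : (intRing K)[X]}
    (h : ∀ x : intRing K, ‖((P.eval x : intRing K) : K)‖ = 1 ∨ ‖((Q.eval x : intRing K) : K)‖ = 1) :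
    IsCoprime (redPoly K P) (redPoly K Q) := by
  haveI := maxIdeal_isMaximal (K := K)
  letI : Field (residueRing K) := Ideal.Quotient.field (maxIdeal K)
  exact coprime_red (k := residueRing K) (Ideal.Quotient.mk (maxIdeal K)) Ideal.Quotient.mk_surjective
    (fun x => Ideal.Quotient.eq_zero_iff_mem) h

lemma not_drops {d : ℕ} {P Q : (intRing K)[X]} 
    (h : ∀ x : intRing K, ‖((P.eval x : intRing K) : K)‖ = 1 ∨ ‖((Q.eval x : intRing K) : K)‖ = 1)
    (h2 : ‖((P.coeff d : intRing K) : K)‖ = 1 ∨ ‖((Q.coeff d : intRing K) : K)‖ = 1) :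
    ¬ ReductionDegreeDrops K P Q d := by
  have key : ∀ R : (intRing K)[X], ‖((R.coeff d : intRing K) : K)‖ = 1 → ¬ (redPoly K R).natDegree < d := by
    intro R hR hlt
    have := coeff_eq_zero_of_natDegree_lt hlt
    rw [redPoly, coeff_map, Ideal.Quotient.eq_zero_iff_mem] at this
    have h3 : ‖((R.coeff d : intRing K) : K)‖ < 1 := this
    linarith
  rintro (h3 | ⟨h3, h4⟩)
  · exact h3 (red_coprime h)
  · rcases h2 with h2 | h2
    · exact key P h2 h3
    · exact key Q h2 h4

end HelpersN

section HelpersO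
set_option linter.unusedSectionVars false
variable {K : Type*} [NontriviallyNormedField K] [IsAlgClosed K] [CompleteSpace K] [IsUltrametricDist K]

lemma rcomp_lift {d : ℕ} {h ψ : RatFunc K} {P Q U V : K[X]} (hP : P.natDegree ≤ d) (hQ : Q.natDegree ≤ d)
    (hV : V ≠ 0) (hQV : hev d Q U V ≠ 0)
    (hh : h = algebraMap K[X] (RatFunc K) P / algebraMap K[X] (RatFunc K) Q)
    (hψ : ψ = algebraMap K[X] (RatFunc K) U / algebraMap K[X] (RatFunc K) V) :
    rcomp K h ψ = algebraMap K[X] (RatFunc K) (hev d P U V) / algebraMap K[X] (RatFunc K) (hev d Q U V) := by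
  have hV' : algebraMap K[X] (RatFunc K) V ≠ 0 := RatFunc.algebraMap_ne_zero hV
  have hQV' : algebraMap K[X] (RatFunc K) (hev d Q U V) ≠ 0 := RatFunc.algebraMap_ne_zero hQV
  have key : ∀ p : K[X], p.natDegree ≤ d → aeval ψ p =
      algebraMap K[X] (RatFunc K) (hev d p U V) / algebraMap K[X] (RatFunc K) V ^ d := by
    intro p hp
    rw [hψ, aeval_div_hev hp _ hV']
    have := hev_map (IsScalarTower.toAlgHom K K[X] (RatFunc K)) d p U V
    rw [IsScalarTower.coe_toAlgHom'] at this
    rw [this]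
  have hQ0 : Q ≠ 0 := by
    rintro rfl
    apply hQV
    rw [hev_sum]; simp
  rw [rcomp_eq hQ0 hh, key P hP, key Q hQ]
  · have := pow_ne_zero d hV'
    field_simp
  · rw [key Q hQ]
    exact div_ne_zero hQV' (pow_ne_zero _ hV')

lemma hev_lin_one {A : Type*} [CommRing A] [Algebra K A] (a b : K) (x y : A) :
    hev 1 (C a * X + C b) x y = algebraMap K A a * x + algebraMap K A b * y := by
  rw [hev_add, hev_C_mul, hev_X, ← mul_one (C b), hev_C_mul, hev_one]
  simp

lemma lin_ne {a b : K} (h : a ≠ 0 ∨ b ≠ 0) : (C a * X + C b : K[X]) ≠ 0 := by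
  intro h0
  have h1 := congrArg (fun p => coeff p 1) h0
  have h2 := congrArg (fun p => coeff p 0) h0
  simp at h1 h2
  tauto

lemma mob_rdeg {a b c e : K} (hδ : a * e - b * c ≠ 0) {φ : RatFunc K}
    (hφ : φ = algebraMap K[X] (RatFunc K) (C a * X + C b) / algebraMap K[X] (RatFunc K) (C c * X + C e)) :
    rdeg K φ = 1 := by
  have hQ : (C c * X + C e : K[X]) ≠ 0 := by
    apply lin_ne
    by_contra hc
    push Not at hc
    apply hδ
    rw [hc.1, hc.2]; ring
  rw [← rdeg_eq hQ (coprime_of_norm ?_) hφ]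
  · apply le_antisymm (max_le natDegree_linear_le natDegree_linear_le)
    by_cases ha : a = 0
    · have hc : c ≠ 0 := by
        rintro rfl
        apply hδ; rw [ha]; ring
      rw [natDegree_linear hc]; exact le_max_right _ _
    · rw [natDegree_linear ha]; exact le_max_left _ _
  · intro x
    by_contra hc
    push Not at hc
    simp at hc
    apply hδ
    linear_combination a * hc.2 - c * hc.1

lemma exists_toK {p : K[X]} (h : ∀ x : K, ‖x‖ ≤ 1 → ‖p.eval x‖ ≤ 1) : ∃ P, toK K P = p := by
  obtain ⟨x, hx, hx2⟩ := exists_generic (0 : K) (one_ne_zero (α := K)) norm_one p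
  have h1 : dn (0 : K) 1 p ≤ 1 := by
    rw [← hx2]; apply h
    rw [sub_zero] at hx; exact hx.le
  have : p ∈ lifts (intRing K).subtype := by
    rw [lifts_iff_coeff_lifts]
    intro n
    have h2 := dn_coeff_le (0 : K) one_pos p n
    simp only [map_zero, add_zero, comp_X, one_pow, mul_one] at h2
    exact ⟨⟨p.coeff n, h2.trans h1⟩, rfl⟩
  obtain ⟨P, hP⟩ := (mem_lifts _).1 this
  exact ⟨P, hP⟩

lemma toK_eval (P : (intRing K)[X]) (x : intRing K) : ((P.eval x : intRing K) : K) = (toK K P).eval (x : K) := by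
  rw [toK, eval_map]
  exact (eval₂_at_apply (p := P) (intRing K).subtype x).symm

lemma toK_coeff (P : (intRing K)[X]) (i : ℕ) : ((P.coeff i : intRing K) : K) = (toK K P).coeff i := by
  rw [toK, coeff_map]; rfl

theorem no_good {f : RatFunc K} (hd : 1 < rdeg K f) (hf : NoPotentiallyGoodReductions K f)
    {a b c e : K} (hδ : a * e - b * c ≠ 0) {κ : ℝ} (hκ : 0 < κ)
    (hn : ∀ x y : K, max ‖a * hev (rdeg K f) f.num x y + b * hev (rdeg K f) f.denom x y‖
      ‖c * hev (rdeg K f) f.num x y + e * hev (rdeg K f) f.denom x y‖ =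
      κ * (max ‖a * x + b * y‖ ‖c * x + e * y‖) ^ (rdeg K f)) : False := by
  set d := rdeg K f with hdd
  obtain ⟨δ, hδd⟩ : ∃ δ, δ = a * e - b * c := ⟨_, rfl⟩
  rw [← hδd] at hδ
  set U : K[X] := C e * X + C (-b) with hU
  set V : K[X] := C (-c) * X + C a with hV
  set R0 : K[X] := C a * f.num + C b * f.denom with hR0
  set R1 : K[X] := C c * f.num + C e * f.denom with hR1
  have hR0d : R0.natDegree ≤ d := natDegree_add_le_of_degree_le
    ((natDegree_C_mul_le _ _).trans (num_le f)) ((natDegree_C_mul_le _ _).trans (denom_le f))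
  have hR1d : R1.natDegree ≤ d := natDegree_add_le_of_degree_le
    ((natDegree_C_mul_le _ _).trans (num_le f)) ((natDegree_C_mul_le _ _).trans (denom_le f))
  set P' := hev d R0 U V with hP'
  set Q' := hev d R1 U V with hQ'
  have hev0 : ∀ x y : K, hev d R0 x y = a * hev d f.num x y + b * hev d f.denom x y := by
    intro x y; rw [hR0, hev_add, hev_C_mul, hev_C_mul]; rfl
  have hev1 : ∀ x y : K, hev d R1 x y = c * hev d f.num x y + e * hev d f.denom x y := by
    intro x y; rw [hR1, hev_add, hev_C_mul, hev_C_mul]; rfl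
  set κ' := κ * ‖δ‖ ^ d with hκ'
  have hκ'0 : 0 < κ' := mul_pos hκ (pow_pos (norm_pos_iff.2 hδ) _)
  have hn' : ∀ x y : K, max ‖hev d R0 (e * x - b * y) (-c * x + a * y)‖ ‖hev d R1 (e * x - b * y) (-c * x + a * y)‖ =
      κ' * (max ‖x‖ ‖y‖) ^ d := by
    intro x y
    rw [hev0, hev1, hn]
    have e1 : a * (e * x - b * y) + b * (-c * x + a * y) = δ * x := by rw [hδd]; ring
    have e2 : c * (e * x - b * y) + e * (-c * x + a * y) = δ * y := by rw [hδd]; ring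
    rw [e1, e2, norm_mul, norm_mul, ← mul_max_of_nonneg _ _ (norm_nonneg _), mul_pow, ← mul_assoc]
  have hevx : ∀ x : K, max ‖P'.eval x‖ ‖Q'.eval x‖ = κ' * (max ‖x‖ 1) ^ d := by
    intro x
    have := hn' x 1
    rw [norm_one] at this
    rw [← this, hP', hQ', eval_hev, eval_hev]
    simp [hU, hV, sub_eq_add_neg]
  have hUd : U.natDegree ≤ 1 := natDegree_linear_le
  have hVd : V.natDegree ≤ 1 := natDegree_linear_le
  have htop : max ‖P'.coeff d‖ ‖Q'.coeff d‖ = κ' := by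
    have := hn' 1 0
    have t0 := hev_coeff_top (d := d) R0 hUd hVd
    have t1 := hev_coeff_top (d := d) R1 hUd hVd
    rw [one_mul] at t0 t1
    rw [hP', hQ', t0, t1]
    have c1 : U.coeff 1 = e := by simp [hU]
    have c2 : V.coeff 1 = -c := by simp [hV]
    rw [c1, c2]
    simpa using this
  have hP'd : P'.natDegree ≤ d := by have := hev_natDegree (d := d) R0 hUd hVd; rwa [one_mul] at this
  have hQ'd : Q'.natDegree ≤ d := by have := hev_natDegree (d := d) R1 hUd hVd; rwa [one_mul] at this
  have hQ'0 : Q' ≠ 0 := by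
    intro h0
    rw [h0, coeff_zero, norm_zero, max_eq_left (norm_nonneg _)] at htop
    have h1 : P'.coeff d ≠ 0 := by rw [← norm_pos_iff, htop]; exact hκ'0
    have h2 : P'.natDegree = d := le_antisymm hP'd (le_natDegree_of_ne_zero h1)
    have h3 : P'.degree ≠ 0 := by
      intro h4
      have h6 : P'.natDegree = 0 := natDegree_eq_of_degree_eq_some h4
      rw [h2] at h6
      omega
    obtain ⟨x, hx⟩ := IsAlgClosed.exists_root _ h3
    have h5 := hevx x
    rw [h0, hx.eq_zero] at h5
    simp only [eval_zero, norm_zero, max_self] at h5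
    have : 0 < κ' * (max ‖x‖ 1) ^ d := by positivity
    linarith
  have hR10 : R1 ≠ 0 := by
    intro h0
    apply hQ'0
    rw [hQ', h0, hev_sum]; simp
  obtain ⟨s, hs⟩ : ∃ s : K, ‖s‖ = κ' := by
    rcases max_choice ‖P'.coeff d‖ ‖Q'.coeff d‖ with h | h
    · exact ⟨P'.coeff d, by rw [← htop, h]⟩
    · exact ⟨Q'.coeff d, by rw [← htop, h]⟩
  have hs0 : s ≠ 0 := by rw [← norm_pos_iff, hs]; exact hκ'0
  have hsc : C s⁻¹ ≠ (0 : K[X]) := by simpa using hs0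
  have hsev : ∀ x : K, max ‖(C s⁻¹ * P').eval x‖ ‖(C s⁻¹ * Q').eval x‖ = (max ‖x‖ 1) ^ d := by
    intro x
    rw [eval_mul, eval_mul, eval_C, norm_mul, norm_mul, ← mul_max_of_nonneg _ _ (norm_nonneg _), hevx, norm_inv, hs]
    field_simp
  have hs1 : ∀ x : K, ‖x‖ ≤ 1 → max ‖(C s⁻¹ * P').eval x‖ ‖(C s⁻¹ * Q').eval x‖ = 1 := by
    intro x hx
    rw [hsev, max_eq_right hx, one_pow]
  obtain ⟨P, hP⟩ := exists_toK (p := C s⁻¹ * P') (fun x hx => (le_max_left _ _).trans (hs1 x hx).le)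
  obtain ⟨Q, hQ⟩ := exists_toK (p := C s⁻¹ * Q') (fun x hx => (le_max_right _ _).trans (hs1 x hx).le)
  have hor : ∀ u v : ℝ, max u v = 1 → u = 1 ∨ v = 1 := by
    intro u v h
    rcases max_choice u v with h1 | h1
    · left; rw [← h1, h]
    · right; rw [← h1, h]
  have hc1 : ‖((P.coeff d : intRing K) : K)‖ = 1 ∨ ‖((Q.coeff d : intRing K) : K)‖ = 1 := by
    apply hor
    rw [toK_coeff, toK_coeff, hP, hQ, coeff_C_mul, coeff_C_mul, norm_mul, norm_mul,
      ← mul_max_of_nonneg _ _ (norm_nonneg _), htop, norm_inv, hs]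
    field_simp
  have hnd := not_drops (d := d) (P := P) (Q := Q) (fun x => by
    apply hor
    rw [toK_eval, toK_eval, hP, hQ]
    exact hs1 x x.2) hc1
  set φ : RatFunc K := algebraMap K[X] (RatFunc K) (C a * X + C b) / algebraMap K[X] (RatFunc K) (C c * X + C e) with hφ
  set ψ : RatFunc K := algebraMap K[X] (RatFunc K) U / algebraMap K[X] (RatFunc K) V with hψ
  have hV0 : V ≠ 0 := by
    apply lin_ne
    by_contra hcc
    push Not at hcc
    apply hδ
    rw [hδd, hcc.2, neg_eq_zero.1 hcc.1]; ring
  have hφψ : rcomp K φ ψ = RatFunc.X := by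
    have k1 : hev 1 (C a * X + C b) U V = C δ * X := by
      rw [hev_lin_one, hU, hV, hδd]
      simp only [algebraMap_eq, map_sub, map_mul, map_neg]
      ring
    have k2 : hev 1 (C c * X + C e) U V = C δ := by
      rw [hev_lin_one, hU, hV, hδd]
      simp only [algebraMap_eq, map_sub, map_mul, map_neg]
      ring
    have hδC : (C δ : K[X]) ≠ 0 := by simpa using hδ
    rw [rcomp_lift (d := 1) natDegree_linear_le natDegree_linear_le hV0 (by rw [k2]; exact hδC) hφ hψ, k1, k2,
      map_mul, RatFunc.algebraMap_X]
    have := RatFunc.algebraMap_ne_zero hδC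
    field_simp
  have hφf : rcomp K φ f = algebraMap K[X] (RatFunc K) R0 / algebraMap K[X] (RatFunc K) R1 := by
    have k1 : ∀ a b : K, hev 1 (C a * X + C b) f.num f.denom = C a * f.num + C b * f.denom := by
      intro a b; rw [hev_lin_one]; rfl
    have := rcomp_lift (d := 1) (h := φ) natDegree_linear_le natDegree_linear_le f.denom_ne_zero
      (by rw [k1]; exact hR10) hφ (RatFunc.num_div_denom f).symm
    rw [this, k1, k1]
  have hall := rcomp_lift hR0d hR1d hV0 hQ'0 hφf hψ
  refine hnd (hf φ ψ (mob_rdeg (by rwa [← hδd]) hφ) (mob_rdeg (a := e) (b := -b) (c := -c) (e := a) ?_ hψ) hφψ P Q ?_)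
  · have : e * a - -b * -c = δ := by rw [hδd]; ring
    rwa [this]
  · have hQ0 : C s⁻¹ * Q' ≠ 0 := mul_ne_zero hsc hQ'0
    have hcop : IsCoprime (C s⁻¹ * P') (C s⁻¹ * Q') := by
      apply coprime_of_norm
      intro x
      by_contra hcc
      push Not at hcc
      have h1 := hsev x
      rw [hcc.1, hcc.2, norm_zero, max_self] at h1
      have : 0 < (max ‖x‖ 1) ^ d := by positivity
      linarith
    have heq : rcomp K (rcomp K φ f) ψ = algebraMap K[X] (RatFunc K) (C s⁻¹ * P') /
        algebraMap K[X] (RatFunc K) (C s⁻¹ * Q') := by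
      rw [hall, map_mul, map_mul, mul_div_mul_left _ _ (RatFunc.algebraMap_ne_zero hsc)]
    refine ⟨?_, ?_, ?_, ?_, ⟨d, hc1⟩⟩
    · rw [hQ]; exact hQ0
    · rw [hP, hQ]; exact hcop
    · rw [hP, hQ]; exact rdeg_eq hQ0 hcop heq
    · rw [hP, hQ, heq, div_mul_cancel₀ _ (RatFunc.algebraMap_ne_zero hQ0)]

end HelpersO

section HelpersP
set_option linter.unusedSectionVars false
variable {K : Type*} [NontriviallyNormedField K] [IsAlgClosed K] [CompleteSpace K] [IsUltrametricDist K]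

lemma num_sub_ne {g : RatFunc K} (hg : 0 < rdeg K g) (w : K) : g.num - C w * g.denom ≠ 0 := by
  intro h
  have h1 : g.num = C w * g.denom := sub_eq_zero.1 h
  have h2 : IsUnit g.denom := by
    have := g.isCoprime_num_denom
    rw [h1] at this
    exact this.isUnit_of_dvd' (dvd_mul_left _ _) dvd_rfl
  have h3 : g.denom.natDegree = 0 := natDegree_eq_zero_of_isUnit h2
  have h4 : g.num.natDegree = 0 := by
    rw [h1]
    have := natDegree_C_mul_le w g.denom
    omega
  rw [rdeg, h3, h4] at hg
  simp at hg

theorem link (f g : RatFunc K) (hd : 1 < rdeg K f) (hf : NoPotentiallyGoodReductions K f)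
    (hg : 0 < rdeg K g) {D : Set (OnePoint K)} {a ϖ : K} (hϖ : ϖ ≠ 0) (hga : g.denom.eval a ≠ 0)
    (hball : ∀ v : K, ‖v - a‖ ≤ ‖ϖ‖ → (v : OnePoint K) ∈ D) {N : ℕ → Prop} (hN : ∃ᶠ n in atTop, N n)
    {ε : ℝ} (hε : 0 < ε) (hNb : ∀ n, N n → ∀ w ∈ D, chordal K ((evalP1 K f)^[n] w) (evalP1 K g w) ≤
      Real.exp (-ε * ((rdeg K f : ℝ) ^ n + (rdeg K g : ℝ)))) : False := by
  obtain ⟨d, hdd⟩ : ∃ d, d = rdeg K f := ⟨_, rfl⟩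
  obtain ⟨e, hee⟩ : ∃ e, e = rdeg K g := ⟨_, rfl⟩
  obtain ⟨w0, hw0⟩ : ∃ w0, w0 = g.num.eval a / g.denom.eval a := ⟨_, rfl⟩
  have hw0' : g.num.eval a - w0 * g.denom.eval a = 0 := by rw [hw0]; field_simp; ring
  set p := cp d f.denom w0 with hp
  set q := cq d f.num f.denom w0 with hq
  set P0 : K[X] := X with hP0
  set Q0 : K[X] := C (a - w0) * X + C ϖ with hQ0
  set U : K[X] := C a * X + C ϖ with hU
  set A : K[X] := hev e g.denom U X with hA
  set B : K[X] := hev e (g.num - C w0 * g.denom) U X with hB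
  have hUd : U.natDegree ≤ 1 := natDegree_linear_le
  have hXd : (X : K[X]).natDegree ≤ 1 := natDegree_X_le
  have hU1 : U.coeff 1 = a := by simp [hU]
  have hgd : (g.num - C w0 * g.denom).natDegree ≤ e := by
    rw [hee]
    exact (natDegree_sub_le _ _).trans (max_le (num_le g) ((natDegree_C_mul_le _ _).trans (denom_le g)))
  have hAc : A.coeff e = g.denom.eval a := by
    have := hev_coeff_top (d := e) g.denom hUd hXd
    rw [one_mul, hU1, coeff_X_one, hev_eval_one _ (by rw [hee]; exact denom_le g)] at this
    exact this
  have hBc : B.coeff e = 0 := by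
    have := hev_coeff_top (d := e) (g.num - C w0 * g.denom) hUd hXd
    rw [one_mul, hU1, coeff_X_one, hev_eval_one _ hgd] at this
    rw [hB, this, eval_sub, eval_mul, eval_C, hw0']
  have hAd : A.natDegree = e := by
    apply le_antisymm
    · have := hev_natDegree (d := e) g.denom hUd hXd
      rwa [one_mul] at this
    · apply le_natDegree_of_ne_zero
      rw [hAc]; exact hga
  have hBd : B.natDegree ≤ e := by
    have := hev_natDegree (d := e) (g.num - C w0 * g.denom) hUd hXd
    rwa [one_mul] at this
  have hB0 : B ≠ 0 := by
    intro h0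
    apply num_sub_ne hg w0
    apply eq_zero_of_infinite_isRoot
    refine Set.Infinite.mono (s := {x : K | x ≠ a}) ?_ ?_
    · intro x hx
      have hx' : x - a ≠ 0 := sub_ne_zero.2 hx
      have h1 : B.eval (ϖ / (x - a)) = 0 := by rw [h0, eval_zero]
      rw [hB, eval_hev] at h1
      have h2 : U.eval (ϖ / (x - a)) = ϖ / (x - a) * x := by
        simp [hU]; field_simp; ring
      have h3 : (X : K[X]).eval (ϖ / (x - a)) = ϖ / (x - a) * 1 := by simp
      rw [h2, h3, hev_smul, hev_eval_one _ hgd] at h1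
      rcases mul_eq_zero.1 h1 with h1 | h1
      · exact absurd h1 (pow_ne_zero _ (div_ne_zero hϖ hx'))
      · exact h1
    · have : {x : K | x ≠ a} = ({a} : Set K)ᶜ := rfl
      rw [this]
      exact (Set.finite_singleton a).infinite_compl
  have hAB : B.natDegree < A.natDegree := by
    rw [hAd]
    rcases hBd.lt_or_eq with h | h
    · exact h
    · exfalso
      apply hB0
      rw [← leadingCoeff_eq_zero, leadingCoeff, h, hBc]
  have hA0 : A ≠ 0 := by
    intro h0
    rw [h0] at hAB; simp at hAB
  have hTeq : ∀ z : K × K, hstep d p q (Tm w0 z) = Tm w0 (hstep d f.num f.denom z) := hstep_Tm _ _ _ _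
  refine core (d := d) (p := p) (q := q) (by omega) ?_ (P0 := P0) (Q0 := Q0) hXd natDegree_linear_le ?_ ?_
    hA0 hB0 hAB hN (Cc := max 1 ‖w0‖ * max 1 ‖w0‖) (ε := ε) (by positivity) hε ?_ ?_
  · intro x y h1 h2
    have h3 : hstep d p q (Tm w0 (w0 * x + y, x)) = 0 := by
      have := Tm_surj w0 (x, y)
      simp only at this
      rw [this]
      exact Prod.ext h1 h2
    rw [hTeq] at h3
    have h4 : hstep (rdeg K f) f.num f.denom (w0 * x + y, x) = 0 := by
      rw [← hdd]
      have h5 : (hstep d f.num f.denom (w0 * x + y, x)).2 = 0 := congrArg Prod.fst h3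
      have h6 : (hstep d f.num f.denom (w0 * x + y, x)).1 - w0 * (hstep d f.num f.denom (w0 * x + y, x)).2 = 0 :=
        congrArg Prod.snd h3
      rw [h5, mul_zero, sub_zero] at h6
      exact Prod.ext h6 h5
    have h7 := lift_nv f h4
    have h8 : x = 0 := congrArg Prod.snd h7
    have h9 : w0 * x + y = 0 := congrArg Prod.fst h7
    rw [h8] at h9
    exact ⟨h8, by simpa using h9⟩
  · intro x
    by_contra hc
    push Not at hc
    obtain ⟨h1, h2⟩ := hc
    simp only [hP0, eval_X] at h1
    rw [h1] at h2
    simp [hQ0] at h2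
    exact hϖ h2
  · left; simp [hP0]
  · intro n hn x hx
    have hx0 : x ≠ 0 := by rw [← norm_pos_iff]; linarith
    set v : K := a + ϖ / x with hv
    have hvD : (v : OnePoint K) ∈ D := by
      apply hball
      rw [hv, add_sub_cancel_left, norm_div]
      exact div_le_self (norm_nonneg _) hx
    have hrep : PRep (v : OnePoint K) (a * x + ϖ, x) := by
      have := (rep_coe v).smul hx0
      have e1 : x * v = a * x + ϖ := by rw [hv]; field_simp
      simpa [e1] using this
    have hrf := rep_iter f hrep n
    have hrg := rep_eval g hrep
    rw [← hdd] at hrf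
    rw [← hee] at hrg
    set z := (hstep d f.num f.denom)^[n] (a * x + ϖ, x) with hz
    set u := hstep e g.num g.denom (a * x + ϖ, x) with hu
    have hch := chordal_rep hrf hrg
    have hle := hNb n hn _ hvD
    have hTz : (((hstep d p q)^[n] (P0, Q0)).1.eval x, ((hstep d p q)^[n] (P0, Q0)).2.eval x) = Tm w0 z := by
      rw [← hstep_iter_eval n (P0, Q0) x, hz, ← hstep_iter_Tm]
      congr 1
      simp [hP0, hQ0, Tm]
      ring
    have hTu : (A.eval x, B.eval x) = Tm w0 u := by
      rw [hA, hB, eval_hev, eval_hev, hev_sub, hev_C_mul, hu]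
      simp [Tm, hstep, hU]
    have z1 : ((hstep d p q)^[n] (P0, Q0)).1.eval x = (Tm w0 z).1 := congrArg Prod.fst hTz
    have z2 : ((hstep d p q)^[n] (P0, Q0)).2.eval x = (Tm w0 z).2 := congrArg Prod.snd hTz
    have u1 : A.eval x = (Tm w0 u).1 := congrArg Prod.fst hTu
    have u2 : B.eval x = (Tm w0 u).2 := congrArg Prod.snd hTu
    rw [eval_sub, eval_mul, eval_mul, z1, z2, u1, u2]
    have hdet : (Tm w0 z).1 * (Tm w0 u).2 - (Tm w0 z).2 * (Tm w0 u).1 = -(z.1 * u.2 - z.2 * u.1) := by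
      simp [Tm]; ring
    rw [hdet, norm_neg, hch]
    have hexp : Real.exp (-ε * ((rdeg K f : ℝ) ^ n + (rdeg K g : ℝ))) ≤ Real.exp (-ε * (d : ℝ) ^ n) := by
      apply Real.exp_le_exp.2
      rw [hdd]
      have : 0 ≤ ε * (rdeg K g : ℝ) := by positivity
      linarith
    have hTz' := Tm_norm w0 z
    have hTu' := Tm_norm w0 u
    calc _ ≤ Real.exp (-ε * (d : ℝ) ^ n) * (max 1 ‖w0‖ * max ‖(Tm w0 z).1‖ ‖(Tm w0 z).2‖) *
          (max 1 ‖w0‖ * max ‖(Tm w0 u).1‖ ‖(Tm w0 u).2‖) := by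
          gcongr
          exact hle.trans hexp
      _ = _ := by ring
  · intro α w hw
    rintro ⟨c, hc, hcn⟩
    -- matrix: (-α, 1+αw0; w, -w w0)
    refine no_good hd hf (a := -α) (b := 1 + α * w0) (c := w) (e := -(w * w0)) ?_ hc ?_
    · have : -α * -(w * w0) - (1 + α * w0) * w = -w := by ring
      rw [this]; exact neg_ne_zero.2 hw
    · intro x y
      have key : ∀ s t : K, dnrm α ‖w‖ (Tm w0 (s, t)) =
          max ‖-α * s + (1 + α * w0) * t‖ ‖w * s + -(w * w0) * t‖ := by
        intro s t
        simp only [dnrm, Tm]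
        rw [← norm_mul]
        congr 2 <;> ring_nf
      have h1 := hcn (Tm w0 (x, y))
      rw [hTeq, key x y] at h1
      rw [← hdd, ← h1, ← key]
      rfl

end HelpersP

/-- **Theorem A** (a priori bound for moving targets).
If `f` has degree `d > 1` and no potentially good reductions, `g` has degree `> 0`, and
`D ⊆ P^1(K)` is a non-empty open set, then
`lim_{n→∞} (sup_{w ∈ D} log [fⁿ(w), g(w)]) / (dⁿ + deg g) = 0`.
(The convergence of the suprema of the logarithms is stated in `ε`-form, via the exponential:
the trivial upper bound `sup ≤ ε (dⁿ + deg g)` and the essential lower bound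
`sup ≥ -ε (dⁿ + deg g)`, i.e. some `w ∈ D` has `[fⁿ(w), g(w)] ≥ exp (-ε (dⁿ + deg g))`.) -/
theorem apriori_bound_moving_targets (f g : RatFunc K)
    (hd : 1 < rdeg K f) (hf : NoPotentiallyGoodReductions K f) (hg : 0 < rdeg K g)
    (D : Set (OnePoint K)) (hD : IsOpen D) (hDne : D.Nonempty) :
    ∀ ε : ℝ, 0 < ε → ∀ᶠ n : ℕ in atTop,
      (∀ w ∈ D, chordal K ((evalP1 K f)^[n] w) (evalP1 K g w) ≤
          Real.exp (ε * ((rdeg K f : ℝ) ^ n + (rdeg K g : ℝ)))) ∧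
      ∃ w ∈ D, Real.exp (-ε * ((rdeg K f : ℝ) ^ n + (rdeg K g : ℝ))) ≤
          chordal K ((evalP1 K f)^[n] w) (evalP1 K g w) := by
  intro ε hε
  by_contra hcon
  rw [Filter.not_eventually] at hcon
  set d := rdeg K f with hdd
  set e := rdeg K g with hee
  set N : ℕ → Prop := fun n => ∀ w ∈ D, chordal K ((evalP1 K f)^[n] w) (evalP1 K g w) <
    Real.exp (-ε * ((d : ℝ) ^ n + (e : ℝ))) with hNdef
  have hN : ∃ᶠ n in atTop, N n := by
    refine hcon.mono fun n hn => ?_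
    by_contra hc
    apply hn
    refine ⟨fun w _ => (chordal_le_one _ _).trans (Real.one_le_exp (by positivity)), ?_⟩
    simp only [hNdef] at hc
    push Not at hc
    exact hc
  obtain ⟨a, ϖ, hϖ, hga, hball⟩ := exists_ball hD hDne g.denom_ne_zero
  exact link f g hd hf hg hϖ hga hball hN hε (fun n hn w hw => (hn w hw).le)
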